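/- There exists a universal constant c (independent of n and m) such that the following holds. Let Q₁, …, Q_m ∈ ℂ[x₁,…,xₙ] be pairwise linearly independent homogeneous polynomials of degree 2, each of which is either irreducible or the square of a linear form. Assume that for every i ≠ j the product ∏_{k ∈ {1,…,m}∖{i,j}} Q_k lies in √⟨Q_i, Q_j⟩ (equivalently, every common zero of Q_i and Q_j in ℂⁿ is a zero of this product). Then the dimension of the ℂ-linear span of {Q₁,…,Q_m} is at most c. -/

import Mathlib

open Module

/-- A curve in a complex vector space all of whose linear coordinates are polynomials. -/
def PolyCurve {E : Type*} [AddCommGroup E] [Module ℂ E] (γ : ℂ → E) : Prop :=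
  ∀ l : Dual ℂ E, ∃ p : Polynomial ℂ, ∀ t, l (γ t) = p.eval t

/-- A function that is polynomial along every polynomial curve. -/
def PolyFun {E : Type*} [AddCommGroup E] [Module ℂ E] (f : E → ℂ) : Prop :=
  ∀ γ : ℂ → E, PolyCurve γ → ∃ p : Polynomial ℂ, ∀ t, f (γ t) = p.eval t

/-- A nonempty set on which polynomial functions have no zero divisors. -/
def PolyIrred {E : Type*} [AddCommGroup E] [Module ℂ E] (X : Set E) : Prop :=
  X.Nonempty ∧ ∀ f g : E → ℂ, PolyFun f → PolyFun g → (∀ x ∈ X, f x * g x = 0) →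
    (∀ x ∈ X, f x = 0) ∨ (∀ x ∈ X, g x = 0)

section PolyBasics

variable {E : Type*} [AddCommGroup E] [Module ℂ E]

theorem PolyCurve.line (a b : E) : PolyCurve (fun t : ℂ => a + t • b) := fun l =>
  ⟨Polynomial.C (l a) + Polynomial.C (l b) * Polynomial.X, fun t => by simp; ring⟩

theorem PolyCurve.const (a : E) : PolyCurve (fun _ : ℂ => a) := fun l =>
  ⟨Polynomial.C (l a), fun t => by simp⟩

theorem PolyCurve.add {γ δ : ℂ → E} (h : PolyCurve γ) (k : PolyCurve δ) :
    PolyCurve (fun t => γ t + δ t) := fun l => by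
  obtain ⟨p, hp⟩ := h l
  obtain ⟨q, hq⟩ := k l
  exact ⟨p + q, fun t => by simp [hp, hq]⟩

theorem PolyCurve.sub {γ δ : ℂ → E} (h : PolyCurve γ) (k : PolyCurve δ) :
    PolyCurve (fun t => γ t - δ t) := fun l => by
  obtain ⟨p, hp⟩ := h l
  obtain ⟨q, hq⟩ := k l
  exact ⟨p - q, fun t => by simp [hp, hq]⟩

theorem PolyCurve.smul {f : ℂ → ℂ} {δ : ℂ → E} (h : ∃ p : Polynomial ℂ, ∀ t, f t = p.eval t)
    (k : PolyCurve δ) : PolyCurve (fun t => f t • δ t) := fun l => by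
  obtain ⟨p, hp⟩ := h
  obtain ⟨q, hq⟩ := k l
  exact ⟨p * q, fun t => by simp [hp, hq]⟩

theorem PolyCurve.map {F : Type*} [AddCommGroup F] [Module ℂ F] {γ : ℂ → E} (h : PolyCurve γ)
    (φ : E →ₗ[ℂ] F) : PolyCurve (fun t => φ (γ t)) := fun l => h (l.comp φ)

theorem PolyFun.const (c : ℂ) : PolyFun (fun _ : E => c) := fun _ _ =>
  ⟨Polynomial.C c, fun t => by simp⟩

theorem PolyFun.dual (l : Dual ℂ E) : PolyFun (fun x : E => l x) := fun _ h => h l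

theorem PolyFun.add {f g : E → ℂ} (hf : PolyFun f) (hg : PolyFun g) :
    PolyFun (fun x => f x + g x) := fun γ h => by
  obtain ⟨p, hp⟩ := hf γ h
  obtain ⟨q, hq⟩ := hg γ h
  exact ⟨p + q, fun t => by simp [hp, hq]⟩

theorem PolyFun.sub {f g : E → ℂ} (hf : PolyFun f) (hg : PolyFun g) :
    PolyFun (fun x => f x - g x) := fun γ h => by
  obtain ⟨p, hp⟩ := hf γ h
  obtain ⟨q, hq⟩ := hg γ h
  exact ⟨p - q, fun t => by simp [hp, hq]⟩

theorem PolyFun.mul {f g : E → ℂ} (hf : PolyFun f) (hg : PolyFun g) :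
    PolyFun (fun x => f x * g x) := fun γ h => by
  obtain ⟨p, hp⟩ := hf γ h
  obtain ⟨q, hq⟩ := hg γ h
  exact ⟨p * q, fun t => by simp [hp, hq]⟩

theorem PolyFun.pow {f : E → ℂ} (hf : PolyFun f) (n : ℕ) :
    PolyFun (fun x => f x ^ n) := fun γ h => by
  obtain ⟨p, hp⟩ := hf γ h
  exact ⟨p ^ n, fun t => by simp [hp]⟩

theorem PolyFun.sum {ι : Type*} (s : Finset ι) {f : ι → E → ℂ} (hf : ∀ i, PolyFun (f i)) :
    PolyFun (fun x => ∑ i ∈ s, f i x) := by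
  classical
  induction s using Finset.induction_on with
  | empty => simpa using PolyFun.const 0
  | insert a s ha ih =>
    simp only [Finset.sum_insert ha]
    exact (hf a).add ih

theorem PolyFun.comp {F : Type*} [AddCommGroup F] [Module ℂ F] {f : F → ℂ} (hf : PolyFun f)
    (φ : E →ₗ[ℂ] F) : PolyFun (fun x => f (φ x)) := fun _ h => hf _ (h.map φ)

theorem PolyFun.quad [FiniteDimensional ℂ E] (q : QuadraticForm ℂ E) :
    PolyFun (fun x => q x) := by
  have hb := Module.finBasis ℂ E
  have : (fun x => q x) = fun x => ∑ i, ∑ j, (hb.coord i x) * (hb.coord j x) *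
      (2⁻¹ * q.polarBilin (hb i) (hb j)) := by
    funext x
    have h1 : q.polarBilin x x = 2 * q x := by
      simp [QuadraticMap.polar_self]
    have h3 : q x = 2⁻¹ * q.polarBilin x x := by rw [h1]; ring
    have h4 : q.polarBilin x x = ∑ i, ∑ j, hb.repr x i * (hb.repr x j *
        q.polarBilin (hb i) (hb j)) := by
      conv_lhs => rw [← hb.sum_repr x]
      simp only [map_sum, map_smul, LinearMap.sum_apply, LinearMap.smul_apply, smul_eq_mul,
        Finset.mul_sum]
      rw [Finset.sum_comm]
      exact Finset.sum_congr rfl fun i _ => Finset.sum_congr rfl fun j _ => by ring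
    rw [h3, h4, Finset.mul_sum]
    refine Finset.sum_congr rfl fun i _ => ?_
    rw [Finset.mul_sum]
    refine Finset.sum_congr rfl fun j _ => ?_
    simp only [Basis.coord_apply]
    ring
  rw [this]
  exact PolyFun.sum _ fun i => PolyFun.sum _ fun j =>
    ((PolyFun.dual _).mul (PolyFun.dual _)).mul (PolyFun.const _)

/-- A set any two points of which lie on a polynomial curve inside the set is irreducible. -/
theorem PolyIrred.of_curves {X : Set E} (hne : X.Nonempty)
    (h : ∀ a ∈ X, ∀ b ∈ X, ∃ γ : ℂ → E, PolyCurve γ ∧ (∀ t, γ t ∈ X) ∧ γ 0 = a ∧ γ 1 = b) :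
    PolyIrred X := by
  refine ⟨hne, fun f g hf hg hfg => ?_⟩
  by_contra hcon
  push Not at hcon
  obtain ⟨⟨a, ha, hfa⟩, b, hb, hgb⟩ := hcon
  obtain ⟨γ, hγ, hX, h0, h1⟩ := h a ha b hb
  obtain ⟨p, hp⟩ := hf γ hγ
  obtain ⟨q, hq⟩ := hg γ hγ
  have hpq : p * q = 0 := by
    refine Polynomial.funext fun t => ?_
    simp [← hp, ← hq, hfg _ (hX t)]
  rcases mul_eq_zero.1 hpq with h | h
  · exact hfa (by rw [← h0, hp, h]; simp)
  · exact hgb (by rw [← h1, hq, h]; simp)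

theorem PolyIrred.univ : PolyIrred (Set.univ : Set E) :=
  PolyIrred.of_curves ⟨0, trivial⟩ fun a _ b _ =>
    ⟨_, PolyCurve.line a (b - a), fun _ => trivial, by simp, by simp⟩

theorem PolyIrred.submodule (S : Submodule ℂ E) : PolyIrred (S : Set E) :=
  PolyIrred.of_curves ⟨0, S.zero_mem⟩ fun a ha b hb =>
    ⟨_, PolyCurve.line a (b - a), fun t => S.add_mem ha (S.smul_mem t (S.sub_mem hb ha)),
      by simp, by simp⟩

theorem PolyIrred.exists_of_prod {X : Set E} (hX : PolyIrred X) {ι : Type*} (s : Finset ι)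
    {f : ι → E → ℂ} (hf : ∀ i ∈ s, PolyFun (f i)) (h : ∀ x ∈ X, ∃ i ∈ s, f i x = 0) :
    ∃ i ∈ s, ∀ x ∈ X, f i x = 0 := by
  classical
  suffices H : ∀ s : Finset ι, (∀ i ∈ s, PolyFun (f i)) →
      PolyFun (fun x => ∏ i ∈ s, f i x) ∧ ((∀ x ∈ X, ∏ i ∈ s, f i x = 0) →
        ∃ i ∈ s, ∀ x ∈ X, f i x = 0) by
    refine (H s hf).2 fun x hx => ?_
    obtain ⟨i, hi, h0⟩ := h x hx
    exact Finset.prod_eq_zero hi h0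
  intro s
  induction s using Finset.induction_on with
  | empty =>
    intro _
    refine ⟨by simpa using PolyFun.const 1, fun h => ?_⟩
    obtain ⟨x, hx⟩ := hX.1
    simpa using h x hx
  | insert a s ha ih =>
    intro hf
    obtain ⟨h1, h2⟩ := ih fun i hi => hf i (Finset.mem_insert_of_mem hi)
    have hfa := hf a (Finset.mem_insert_self _ _)
    simp only [Finset.prod_insert ha]
    refine ⟨hfa.mul h1, fun h => ?_⟩
    rcases hX.2 _ _ hfa h1 h with h | h
    · exact ⟨a, Finset.mem_insert_self _ _, h⟩
    · obtain ⟨i, hi, h⟩ := h2 h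
      exact ⟨i, Finset.mem_insert_of_mem hi, h⟩

theorem PolyIrred.exists_ne_zero {X : Set E} (hX : PolyIrred X) {ι : Type*} (s : Finset ι)
    {f : ι → E → ℂ} (hf : ∀ i ∈ s, PolyFun (f i)) (h : ∀ i ∈ s, ∃ x ∈ X, f i x ≠ 0) :
    ∃ x ∈ X, ∀ i ∈ s, f i x ≠ 0 := by
  by_contra hcon
  push Not at hcon
  obtain ⟨i, hi, h0⟩ := hX.exists_of_prod s hf hcon
  obtain ⟨x, hx, hne⟩ := h i hi
  exact hne (h0 x hx)

end PolyBasics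

/-- A quadratic form that is a product of two linear forms. -/
def IsProd {E : Type*} [AddCommGroup E] [Module ℂ E] (q : QuadraticForm ℂ E) : Prop :=
  ∃ c d : Dual ℂ E, ∀ x, q x = c x * d x

section QuadBasics

variable {E : Type*} [AddCommGroup E] [Module ℂ E]

theorem QuadraticForm.polarBilin_self' (q : QuadraticForm ℂ E) (x : E) :
    q.polarBilin x x = 2 * q x := by simp [QuadraticMap.polar_self]

theorem QuadraticForm.polarBilin_symm (q : QuadraticForm ℂ E) (x y : E) :
    q.polarBilin x y = q.polarBilin y x := by
  simp [QuadraticMap.polar_comm]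

theorem QuadraticForm.map_add' (q : QuadraticForm ℂ E) (x y : E) :
    q (x + y) = q x + q y + q.polarBilin x y := by
  simp [QuadraticMap.map_add]

theorem QuadraticForm.map_smul' (q : QuadraticForm ℂ E) (t : ℂ) (x : E) :
    q (t • x) = t ^ 2 * q x := by
  simp [QuadraticMap.map_smul, sq]

theorem QuadraticForm.map_add_smul (q : QuadraticForm ℂ E) (x y : E) (t : ℂ) :
    q (x + t • y) = q x + t * q.polarBilin x y + t ^ 2 * q y := by
  rw [q.map_add', q.map_smul', map_smul, smul_eq_mul]; ring

theorem QuadraticForm.map_sub_smul (q : QuadraticForm ℂ E) (x y : E) (t : ℂ) :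
    q (x - t • y) = q x - t * q.polarBilin x y + t ^ 2 * q y := by
  have := q.map_add_smul x y (-t)
  rw [neg_smul, ← sub_eq_add_neg] at this
  rw [this]; ring

theorem QuadraticForm.polarBilin_add' (q r : QuadraticForm ℂ E) :
    (q + r).polarBilin = q.polarBilin + r.polarBilin := by
  ext x y
  simp [QuadraticMap.polar]; ring

theorem QuadraticForm.polarBilin_sub' (q r : QuadraticForm ℂ E) :
    (q - r).polarBilin = q.polarBilin - r.polarBilin := by
  ext x y
  simp [QuadraticMap.polar]; ring

theorem QuadraticForm.polarBilin_smul' (c : ℂ) (q : QuadraticForm ℂ E) :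
    (c • q).polarBilin = c • q.polarBilin := by
  ext x y
  simp [QuadraticMap.polar]; ring

theorem QuadraticForm.ext_iff' {q r : QuadraticForm ℂ E} : q = r ↔ ∀ x, q x = r x :=
  ⟨fun h x => by rw [h], fun h => QuadraticMap.ext h⟩

theorem Dual.mul_eq_zero_of_forall {a b : Dual ℂ E} (h : ∀ x, a x * b x = 0) :
    a = 0 ∨ b = 0 := by
  rcases PolyIrred.univ.2 _ _ (PolyFun.dual a) (PolyFun.dual b) fun x _ => h x with h | h
  · exact Or.inl (LinearMap.ext fun x => h x trivial)
  · exact Or.inr (LinearMap.ext fun x => h x trivial)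

theorem Dual.exists_eq_one {a : Dual ℂ E} (h : a ≠ 0) : ∃ x, a x = 1 := by
  obtain ⟨x, hx⟩ : ∃ x, a x ≠ 0 := by
    by_contra hcon
    push Not at hcon
    exact h (LinearMap.ext hcon)
  exact ⟨(a x)⁻¹ • x, by simp [hx]⟩

/-- A linear form vanishing on the kernel of another is a multiple of it. -/
theorem Dual.eq_smul_of_ker {a b : Dual ℂ E} (h : ∀ x, a x = 0 → b x = 0) :
    ∃ c : ℂ, b = c • a := by
  by_cases ha : a = 0
  · exact ⟨0, LinearMap.ext fun x => by simpa using h x (by simp [ha])⟩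
  obtain ⟨x, hx⟩ := Dual.exists_eq_one ha
  refine ⟨b x, LinearMap.ext fun y => ?_⟩
  have := h (y - a y • x) (by simp [hx])
  simp only [map_sub, map_smul, smul_eq_mul, sub_eq_zero] at this
  simp [this, mul_comm]

theorem QuadraticForm.exists_dvd_of_ker (q : QuadraticForm ℂ E) (l : Dual ℂ E)
    (h : ∀ x, l x = 0 → q x = 0) : ∃ b : Dual ℂ E, ∀ x, q x = l x * b x := by
  by_cases hl : l = 0
  · exact ⟨0, fun x => by simpa using h x (by simp [hl])⟩
  obtain ⟨x0, h0⟩ := Dual.exists_eq_one hl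
  refine ⟨q.polarBilin x0 - q x0 • l, fun x => ?_⟩
  have h1 := h (x - l x • x0) (by simp [h0])
  rw [q.map_sub_smul] at h1
  simp only [LinearMap.sub_apply, LinearMap.smul_apply, smul_eq_mul]
  rw [q.polarBilin_symm x0 x]
  linear_combination h1

/-- Inclusion of zero sets of quadratic forms: proportional, or the square of a linear form
dividing the other. -/
theorem QuadraticForm.of_zeros_subset [FiniteDimensional ℂ E] (D F : QuadraticForm ℂ E)
    (h : ∀ x, D x = 0 → F x = 0) :
    (∃ c : ℂ, ∀ x, F x = c * D x) ∨
      ∃ a b : Dual ℂ E, (∀ x, D x = a x ^ 2) ∧ ∀ x, F x = a x * b x := by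
  by_cases hD : ∀ x, D x = 0
  · exact Or.inl ⟨0, fun x => by simp [h x (hD x)]⟩
  push Not at hD
  obtain ⟨x1, hx1⟩ := hD
  obtain ⟨s, hs⟩ := IsAlgClosed.exists_pow_nat_eq (D x1) (n := 2) (by norm_num)
  have hs0 : s ≠ 0 := by rintro rfl; exact hx1 (by simpa using hs.symm)
  obtain ⟨x0, h0⟩ : ∃ x0, D x0 = 1 := ⟨s⁻¹ • x1, by rw [D.map_smul', ← hs]; field_simp⟩
  let a : Dual ℂ E := (2⁻¹ : ℂ) • D.polarBilin x0
  have ha : ∀ x, D.polarBilin x x0 = 2 * a x := fun x => by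
    rw [D.polarBilin_symm]; simp [a]
  let f := F x0
  let m : Dual ℂ E := F.polarBilin x0
  have hm : ∀ x, F.polarBilin x x0 = m x := fun x => F.polarBilin_symm _ _
  have ha0 : a x0 = 1 := by
    have := ha x0
    rw [D.polarBilin_self', h0] at this
    linear_combination (-1/2) * this
  have hm0 : m x0 = 2 * f := F.polarBilin_self' x0
  let P : E →ₗ[ℂ] E := LinearMap.id - a.smulRight x0
  have hP : ∀ x, P x = x - a x • x0 := fun x => rfl
  have hDP : ∀ x, D (P x) = D x - a x ^ 2 := fun x => by
    rw [hP, D.map_sub_smul, ha, h0]; ring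
  have hFP : ∀ x, F (P x) = F x - a x * m x + a x ^ 2 * f := fun x => by
    rw [hP, F.map_sub_smul, hm]
  have key : ∀ y, a y = 0 → F y = f * D y ∧ m y * D y = 0 := by
    intro y hy
    obtain ⟨s, hs⟩ := IsAlgClosed.exists_pow_nat_eq (-D y) (n := 2) (by norm_num)
    have e1 := h (y + s • x0) (by rw [D.map_add_smul, ha, hy, h0, hs]; ring)
    have e2 := h (y - s • x0) (by rw [D.map_sub_smul, ha, hy, h0, hs]; ring)
    rw [F.map_add_smul, hm] at e1
    rw [F.map_sub_smul, hm] at e2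
    change F y + s * m y + s ^ 2 * f = 0 at e1
    change F y - s * m y + s ^ 2 * f = 0 at e2
    refine ⟨by linear_combination (e1 + e2) / 2 - f * hs, ?_⟩
    have e3 : s * m y = 0 := by linear_combination (e1 - e2) / 2
    linear_combination (-s) * e3 + m y * hs
  have haP : ∀ x, a (P x) = 0 := fun x => by simp [hP, ha0]
  have hmP : ∀ x, m (P x) = m x - 2 * f * a x := fun x => by simp [hP, hm0]; ring
  have hmul : ∀ x, (m.comp P) x * (D.comp P) x = 0 := fun x => (key _ (haP x)).2
  rcases PolyIrred.univ.2 _ _ (PolyFun.dual (m.comp P)) (PolyFun.quad (D.comp P))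
    fun x _ => hmul x with h1 | h1
  · left
    refine ⟨f, fun x => ?_⟩
    have e1 := h1 x trivial
    have e2 := (key _ (haP x)).1
    simp only [LinearMap.comp_apply] at e1
    rw [hmP] at e1
    rw [hFP, hDP] at e2
    linear_combination e2 + a x * e1
  · right
    refine ⟨a, m - f • a, fun x => ?_, fun x => ?_⟩
    · have e1 := h1 x trivial
      simp only [QuadraticMap.comp_apply] at e1
      rw [hDP] at e1
      linear_combination e1
    · have e1 := h1 x trivial
      simp only [QuadraticMap.comp_apply] at e1
      have e2 := (key _ (haP x)).1
      rw [e1, hFP] at e2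
      simp only [LinearMap.sub_apply, LinearMap.smul_apply, smul_eq_mul]
      linear_combination e2

theorem IsProd.of_eq_smul_sq {D : QuadraticForm ℂ E} {c : ℂ} {a : Dual ℂ E}
    (h : ∀ x, D x = c * a x ^ 2) : IsProd D :=
  ⟨c • a, a, fun x => by simp [h]; ring⟩

theorem exists_isotropic_of_not_isProd {D : QuadraticForm ℂ E} (hD : ¬ IsProd D) :
    ∃ p, D p = 0 ∧ D.polarBilin p ≠ 0 := by
  by_contra hcon
  push Not at hcon
  apply hD
  by_cases h0 : ∀ x, D x = 0
  · exact ⟨0, 0, fun x => by simp [h0]⟩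
  push Not at h0
  obtain ⟨x, hx⟩ := h0
  refine IsProd.of_eq_smul_sq (c := (4 * D x)⁻¹) (a := D.polarBilin x) fun y => ?_
  obtain ⟨s, hs⟩ := IsAlgClosed.exists_pow_nat_eq
    (D.polarBilin x y ^ 2 - 4 * D x * D y) (n := 2) (by norm_num)
  have h1 : D (y + ((-D.polarBilin x y + s) / (2 * D x)) • x) = 0 := by
    rw [D.map_add_smul, D.polarBilin_symm y x]
    field_simp
    linear_combination hs
  have h2 := congrArg (fun l => l x) (hcon _ h1)
  simp only [map_add, map_smul, LinearMap.add_apply, LinearMap.smul_apply, smul_eq_mul,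
    LinearMap.zero_apply] at h2
  rw [D.polarBilin_symm y x, D.polarBilin_self'] at h2
  have hs0 : s = 0 := by field_simp at h2; linear_combination h2
  rw [hs0] at hs
  field_simp
  linear_combination hs

/-- The zero set of a quadratic form that is not a product of linear forms is irreducible. -/
theorem PolyIrred.zeros [FiniteDimensional ℂ E] {D : QuadraticForm ℂ E} (hD : ¬ IsProd D) :
    PolyIrred {x | D x = 0} := by
  refine PolyIrred.of_curves ⟨0, by simp⟩ fun a ha b hb => ?_
  simp only [Set.mem_ofPred_eq] at ha hb ⊢
  by_cases hka : D.polarBilin a = 0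
  · refine ⟨_, PolyCurve.line a (b - a), fun t => ?_, by simp, by simp⟩
    have : a + t • (b - a) = (1 - t) • a + t • b := by module
    rw [this, D.map_add', D.map_smul', D.map_smul', ha, hb]
    simp [-QuadraticMap.polarBilin_apply_apply, hka]
  by_cases hkb : D.polarBilin b = 0
  · refine ⟨_, PolyCurve.line a (b - a), fun t => ?_, by simp, by simp⟩
    have : a + t • (b - a) = t • b + (1 - t) • a := by module
    rw [this, D.map_add', D.map_smul', D.map_smul', ha, hb]
    simp [-QuadraticMap.polarBilin_apply_apply, hkb]
  obtain ⟨p0, hp0, hp0'⟩ := exists_isotropic_of_not_isProd hD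
  have hψ : ∀ p, D p = 0 → ∀ v, D (D.polarBilin p v • v - D v • p) = 0 := fun p hp v => by
    rw [D.map_sub_smul, D.map_smul', hp]
    simp only [map_smul, LinearMap.smul_apply, smul_eq_mul]
    rw [D.polarBilin_symm v p]
    ring
  have nz : ∀ a, D.polarBilin a ≠ 0 → ∃ v ∈ (Set.univ : Set E),
      D.polarBilin p0 v * D.polarBilin a v - D v * D.polarBilin p0 a ≠ 0 := by
    intro a hka
    by_contra hcon
    push Not at hcon
    by_cases h : D.polarBilin p0 a = 0
    · rcases Dual.mul_eq_zero_of_forall (a := D.polarBilin p0) (b := D.polarBilin a)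
        (fun x => by simpa [-QuadraticMap.polarBilin_apply_apply, h] using hcon x trivial) with h | h
      · exact hp0' h
      · exact hka h
    · apply hD
      refine ⟨(D.polarBilin p0 a)⁻¹ • D.polarBilin p0, D.polarBilin a, fun x => ?_⟩
      have := hcon x trivial
      simp only [LinearMap.smul_apply, smul_eq_mul]
      field_simp
      linear_combination -this
  have pf : ∀ a, PolyFun fun v =>
      D.polarBilin p0 v * D.polarBilin a v - D v * D.polarBilin p0 a := fun a =>
    ((PolyFun.dual _).mul (PolyFun.dual _)).sub ((PolyFun.quad D).mul (PolyFun.const _))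
  obtain ⟨v, hva, hvb⟩ : ∃ v, (D.polarBilin p0 v * D.polarBilin a v - D v * D.polarBilin p0 a ≠ 0)
      ∧ (D.polarBilin p0 v * D.polarBilin b v - D v * D.polarBilin p0 b ≠ 0) := by
    by_contra hcon
    push Not at hcon
    rcases PolyIrred.univ.2 _ _ (pf a) (pf b) (fun x _ => by
      by_cases h : D.polarBilin p0 x * D.polarBilin a x - D x * D.polarBilin p0 a = 0
      · simp only [h, zero_mul]
      · rw [hcon x h, mul_zero]) with h | h
    · obtain ⟨v, hv, hne⟩ := nz a hka
      exact hne (h v hv)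
    · obtain ⟨v, hv, hne⟩ := nz b hkb
      exact hne (h v hv)
  set p := D.polarBilin p0 v • v - D v • p0 with hp
  have hpa : ∀ a, D.polarBilin p a =
      D.polarBilin p0 v * D.polarBilin a v - D v * D.polarBilin p0 a := fun a => by
    rw [hp, D.polarBilin_symm a v]
    simp only [map_sub, map_smul, LinearMap.sub_apply, LinearMap.smul_apply, smul_eq_mul]
  rw [← hpa] at hva hvb
  have hDp := hψ p0 hp0 v
  rw [← hp] at hDp
  let s : ℂ → ℂ := fun t => (1 - t) * (D.polarBilin p a)⁻¹ + t * (D.polarBilin p b)⁻¹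
  have hs : ∃ r : Polynomial ℂ, ∀ t, s t = r.eval t :=
    ⟨(1 - Polynomial.X) * Polynomial.C (D.polarBilin p a)⁻¹ +
      Polynomial.X * Polynomial.C (D.polarBilin p b)⁻¹, fun t => by
        simp [s, -QuadraticMap.polarBilin_apply_apply]; ring⟩
  have hl := PolyCurve.line a (b - a)
  refine ⟨fun t => s t • (D.polarBilin p (a + t • (b - a)) • (a + t • (b - a)) -
    D (a + t • (b - a)) • p), ?_, fun t => ?_, ?_, ?_⟩
  · exact PolyCurve.smul hs ((PolyCurve.smul (hl _) hl).sub
      (PolyCurve.smul (PolyFun.quad D _ hl) (PolyCurve.const p)))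
  · rw [D.map_smul', hψ p hDp, mul_zero]
  · simp only [zero_smul, add_zero, ha, sub_zero, s, zero_mul, one_mul, smul_smul]
    rw [inv_mul_cancel₀ hva, one_smul]
  · simp only [one_smul, add_sub_cancel, hb, zero_smul, sub_zero, s, sub_self, zero_mul, zero_add,
      one_mul, smul_smul]
    rw [inv_mul_cancel₀ hvb, one_smul]

end QuadBasics

section QuadKernel

variable {E : Type*} [AddCommGroup E] [Module ℂ E]

theorem isProd_of_binary {D : QuadraticForm ℂ E} {a l : Dual ℂ E} {r s t : ℂ}
    (h : ∀ x, D x = r * a x ^ 2 + s * (a x * l x) + t * l x ^ 2) : IsProd D := by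
  by_cases hr : r = 0
  · exact ⟨l, s • a + t • l, fun x => by rw [h, hr]; simp; ring⟩
  obtain ⟨w, hw⟩ := IsAlgClosed.exists_pow_nat_eq (s ^ 2 - 4 * r * t) (n := 2) (by norm_num)
  refine ⟨r • a + ((s + w) / 2) • l, a + ((s - w) / (2 * r)) • l, fun x => ?_⟩
  rw [h]
  simp only [LinearMap.add_apply, LinearMap.smul_apply, smul_eq_mul]
  field_simp
  linear_combination (l x ^ 2) * hw

theorem exists_dual_extend (K : Submodule ℂ E) (a : Dual ℂ K) :
    ∃ b : Dual ℂ E, ∀ x : K, b x = a x := by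
  obtain ⟨g, hg⟩ := LinearMap.exists_extend a
  exact ⟨g, fun x => by rw [← hg]; rfl⟩

/-- A linear form vanishing where `a` and `l` do is a combination of them. -/
theorem Dual.eq_comb_of_ker {a l e : Dual ℂ E} (h : ∀ x, a x = 0 → l x = 0 → e x = 0) :
    ∃ r s : ℂ, ∀ x, e x = r * a x + s * l x := by
  obtain ⟨r, hr⟩ := Dual.eq_smul_of_ker (a := a.domRestrict (LinearMap.ker l))
    (b := e.domRestrict (LinearMap.ker l)) fun x hx => h x hx x.2
  obtain ⟨s, hs⟩ := Dual.eq_smul_of_ker (a := l) (b := e - r • a) fun x hx => by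
    have := congrArg (fun f => f ⟨x, hx⟩) hr
    simp only [LinearMap.domRestrict_apply, LinearMap.smul_apply] at this
    simp [this]
  refine ⟨r, s, fun x => ?_⟩
  have := congrArg (fun f => f x) hs
  simp only [LinearMap.sub_apply, LinearMap.smul_apply, smul_eq_mul] at this
  linear_combination this

variable [FiniteDimensional ℂ E]

theorem QuadraticForm.eq_smul_of_zeros_subset {D F : QuadraticForm ℂ E} (hD : ¬ IsProd D)
    (h : ∀ x, D x = 0 → F x = 0) : ∃ c : ℂ, ∀ x, F x = c * D x := by
  rcases QuadraticForm.of_zeros_subset D F h with h | ⟨a, b, h, -⟩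
  · exact h
  · exact absurd ⟨a, a, fun x => by rw [h, sq]⟩ hD

theorem exists_zero_dual_ne {D : QuadraticForm ℂ E} (hD : ¬ IsProd D) {l : Dual ℂ E}
    (hl : l ≠ 0) : ∃ x, D x = 0 ∧ l x ≠ 0 := by
  by_contra hcon
  push Not at hcon
  obtain ⟨c, hc⟩ := QuadraticForm.eq_smul_of_zeros_subset (F := QuadraticMap.linMulLin l l) hD
    fun x hx => by simp [hcon x hx]
  simp only [QuadraticMap.linMulLin_apply] at hc
  by_cases h0 : c = 0
  · rcases Dual.mul_eq_zero_of_forall (a := l) (b := l) fun x => by simp [hc, h0] with h | h <;>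
      exact hl h
  · exact hD ⟨c⁻¹ • l, l, fun x => by
      simp only [LinearMap.smul_apply, smul_eq_mul, mul_assoc, hc]; field_simp⟩

theorem Submodule.mul_eq_zero_on (K : Submodule ℂ E) {f g : E → ℂ} (hf : PolyFun f)
    (hg : PolyFun g) (h : ∀ x ∈ K, f x * g x = 0) :
    (∀ x ∈ K, f x = 0) ∨ ∀ x ∈ K, g x = 0 :=
  (PolyIrred.submodule K).2 f g hf hg h

/-- A polynomial function times a nonzero linear form vanishing on the zeros of a non-product. -/
theorem cancel_dual_on_zeros {D : QuadraticForm ℂ E} (hD : ¬ IsProd D) {l : Dual ℂ E}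
    (hl : l ≠ 0) {f : E → ℂ} (hf : PolyFun f) (h : ∀ x, D x = 0 → l x * f x = 0) :
    ∀ x, D x = 0 → f x = 0 := by
  rcases (PolyIrred.zeros hD).2 _ _ (PolyFun.dual l) hf h with h | h
  · obtain ⟨x, hx, hne⟩ := exists_zero_dual_ne hD hl
    exact absurd (h x hx) hne
  · exact h

theorem QuadraticForm.of_zeros_subset_on_ker (D F : QuadraticForm ℂ E) (l : Dual ℂ E)
    (h : ∀ x, l x = 0 → D x = 0 → F x = 0) :
    (∃ (c : ℂ) (b : Dual ℂ E), ∀ x, F x = c * D x + l x * b x) ∨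
      ∃ a b e e' : Dual ℂ E, (∀ x, D x = a x ^ 2 + l x * e x) ∧
        ∀ x, F x = a x * b x + l x * e' x := by
  rcases QuadraticForm.of_zeros_subset (D.comp (LinearMap.ker l).subtype)
    (F.comp (LinearMap.ker l).subtype) (fun x hx => h x x.2 hx) with ⟨c, hc⟩ | ⟨a, b, ha, hb⟩
  · left
    obtain ⟨b, hb⟩ := (F - c • D).exists_dvd_of_ker l fun x hx => by
      have := hc ⟨x, hx⟩
      simp only [QuadraticMap.comp_apply, Submodule.subtype_apply] at this
      simp [this]
    refine ⟨c, b, fun x => ?_⟩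
    have := hb x
    simp only [sub_apply, smul_apply, smul_eq_mul] at this
    linear_combination this
  · right
    obtain ⟨a', ha'⟩ := exists_dual_extend _ a
    obtain ⟨b', hb'⟩ := exists_dual_extend _ b
    obtain ⟨e, he⟩ := (D - QuadraticMap.linMulLin a' a').exists_dvd_of_ker l fun x hx => by
      have := ha ⟨x, hx⟩
      simp only [QuadraticMap.comp_apply, Submodule.subtype_apply] at this
      simp [this, ha' ⟨x, hx⟩, sq]
    obtain ⟨e', he'⟩ := (F - QuadraticMap.linMulLin a' b').exists_dvd_of_ker l fun x hx => by
      have := hb ⟨x, hx⟩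
      simp only [QuadraticMap.comp_apply, Submodule.subtype_apply] at this
      simp [this, ha' ⟨x, hx⟩, hb' ⟨x, hx⟩]
    refine ⟨a', b', e, e', fun x => ?_, fun x => ?_⟩
    · have := he x
      simp only [sub_apply, QuadraticMap.linMulLin_apply] at this
      linear_combination this
    · have := he' x
      simp only [sub_apply, QuadraticMap.linMulLin_apply] at this
      linear_combination this

/-- The case of the pencil theorem where the vertex lies on both quadrics. -/
theorem pencil_of_isotropic_vertex {ι : Type*} {s : Finset ι} {H : ι → QuadraticForm ℂ E}
    {D F : QuadraticForm ℂ E}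
    (hnp : ∀ α β : ℂ, α ≠ 0 ∨ β ≠ 0 → ¬ IsProd (α • D + β • F))
    (hcov : ∀ x, D x = 0 → F x = 0 → ∃ i ∈ s, H i x = 0)
    {p : E} (hpD : D.polarBilin p = 0) (hpF : F.polarBilin p ≠ 0) (hFp : F p = 0) :
    (∃ i ∈ s, ∃ α β : ℂ, ∀ x, H i x = α * D x + β * F x) ∨
      ∃ c d : Dual ℂ E, ∀ x, c x = 0 → d x = 0 → D x = 0 ∧ F x = 0 := by
  set l := F.polarBilin p with hl
  have hD : ¬ IsProd D := by simpa using hnp 1 0 (by simp)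
  have hDp : D p = 0 := by
    have := D.polarBilin_self' p
    rw [hpD] at this
    simpa using this.symm
  have nprod : ∀ (μ : ℂ) (b : Dual ℂ E), ¬ ∀ x, F x = μ * D x + l x * b x := fun μ b h =>
    hnp (-μ) 1 (by simp) ⟨l, b, fun x => by
      simp only [add_apply, smul_apply, smul_eq_mul, h]; ring⟩
  obtain ⟨i, hi, hHi⟩ := (PolyIrred.zeros hD).exists_of_prod s
    (f := fun i w => l w ^ 2 * H i w - l w * F w * (H i).polarBilin p w + F w ^ 2 * H i p)
    (fun i _ => ((((PolyFun.dual l).pow 2).mul (PolyFun.quad _)).sub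
      (((PolyFun.dual l).mul (PolyFun.quad F)).mul (PolyFun.dual _))).add
      (((PolyFun.quad F).pow 2).mul (PolyFun.const _)))
    (fun w hw => by
      have hw : D w = 0 := hw
      obtain ⟨i, hi, h⟩ := hcov (l w • w - F w • p)
        (by
          rw [D.map_sub_smul, D.map_smul', hw, D.polarBilin_symm, hpD, hDp]; simp)
        (by
          rw [F.map_sub_smul, F.map_smul', F.polarBilin_symm _ p, ← hl, hFp, map_smul, smul_eq_mul]
          ring)
      refine ⟨i, hi, ?_⟩
      rw [(H i).map_sub_smul, (H i).map_smul', (H i).polarBilin_symm, map_smul, smul_eq_mul] at h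
      linear_combination h)
  set h := (H i).polarBilin p with hh
  have hHi' : ∀ w, D w = 0 → l w ^ 2 * H i w - l w * F w * h w + F w ^ 2 * H i p = 0 := hHi
  clear hHi
  by_cases hHp : H i p = 0
  swap
  · have h1 : ∀ x, l x = 0 → D x = 0 → F x = 0 := fun x hx hx' => by
      have := hHi' x hx'
      rw [hx] at this
      simpa [hHp] using this
    rcases QuadraticForm.of_zeros_subset_on_ker D F l h1 with ⟨c, b, h2⟩ | ⟨a, b, e, e', h2, h3⟩
    · exact absurd h2 (nprod c b)
    · exact Or.inr ⟨a, l, fun x hx hx' => by simp [h2, h3, hx, hx']⟩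
  have h1 : ∀ x, D x = 0 → l x * H i x - F x * h x = 0 :=
    cancel_dual_on_zeros hD hpF (((PolyFun.dual l).mul (PolyFun.quad _)).sub
      ((PolyFun.quad F).mul (PolyFun.dual h))) fun x hx => by
        have := hHi' x hx
        rw [hHp] at this
        linear_combination this
  have finish : ∀ μ : ℂ, h = μ • l →
      (∃ i ∈ s, ∃ α β : ℂ, ∀ x, H i x = α * D x + β * F x) := fun μ hμ => by
    have h2 : ∀ x, D x = 0 → (H i - μ • F) x = 0 :=
      cancel_dual_on_zeros hD hpF (PolyFun.quad _) fun x hx => by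
        have := h1 x hx
        rw [hμ] at this
        simp only [LinearMap.smul_apply, smul_eq_mul] at this
        simp only [sub_apply, smul_apply, smul_eq_mul]
        linear_combination this
    obtain ⟨c, hc⟩ := QuadraticForm.eq_smul_of_zeros_subset hD h2
    refine ⟨i, hi, c, μ, fun x => ?_⟩
    have := hc x
    simp only [sub_apply, smul_apply, smul_eq_mul] at this
    linear_combination this
  by_cases hD1 : IsProd (D.comp (LinearMap.ker l).subtype)
  swap
  · rcases (PolyIrred.zeros hD1).2 (fun x => F x) (fun x => h x)
      ((PolyFun.quad F).comp (LinearMap.ker l).subtype)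
      ((PolyFun.dual h).comp (LinearMap.ker l).subtype) (fun x hx => by
        have := h1 x hx
        rw [show l x = 0 from x.2] at this
        linear_combination -this) with h2 | h2
    · exfalso
      rcases QuadraticForm.of_zeros_subset_on_ker D F l (fun x hx hx' => h2 ⟨x, hx⟩ hx')
        with ⟨c, b, h3⟩ | ⟨a, b, e, e', h3, -⟩
      · exact nprod c b h3
      · exact hD1 ⟨a.domRestrict _, a.domRestrict _, fun x => by
          simp [h3, show l x = 0 from x.2, sq]⟩
    · left
      have h3 : h.domRestrict (LinearMap.ker l) = 0 := by
        by_contra hne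
        obtain ⟨x, hx, hx'⟩ := exists_zero_dual_ne hD1 hne
        exact hx' (h2 x hx)
      obtain ⟨μ, hμ⟩ := Dual.eq_smul_of_ker (a := l) (b := h) fun x hx => by
        have := congrArg (fun f => f ⟨x, hx⟩) h3
        simpa using this
      exact finish μ hμ
  obtain ⟨a0, b0, hab⟩ := hD1
  obtain ⟨a, ha⟩ := exists_dual_extend _ a0
  obtain ⟨b, hb⟩ := exists_dual_extend _ b0
  have hab' : ∀ x, l x = 0 → D x = a x * b x := fun x hx => by
    have := hab ⟨x, hx⟩
    rw [← ha, ← hb] at this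
    exact this
  have side : ∀ a : Dual ℂ E, (∀ x, l x = 0 → a x = 0 → D x = 0) →
      (∃ c d : Dual ℂ E, ∀ x, c x = 0 → d x = 0 → D x = 0 ∧ F x = 0) ∨
        ∃ r t : ℂ, ∀ x, h x = r * a x + t * l x := fun a ha => by
    rcases Submodule.mul_eq_zero_on (LinearMap.ker l ⊓ LinearMap.ker a) (PolyFun.quad F)
      (PolyFun.dual h) (fun x hx => by
        have hlx : l x = 0 := hx.1
        have := h1 x (ha x hx.1 hx.2)
        rw [hlx] at this
        linear_combination -this) with h2 | h2
    · exact Or.inl ⟨l, a, fun x hx hx' => ⟨ha x hx hx', h2 x ⟨hx, hx'⟩⟩⟩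
    · exact Or.inr (Dual.eq_comb_of_ker fun x hx hx' => h2 x ⟨hx', hx⟩)
  rcases side a (fun x hx hx' => by rw [hab' x hx, hx', zero_mul]) with h2 | ⟨r, t, hr⟩
  · exact Or.inr h2
  rcases side b (fun x hx hx' => by rw [hab' x hx, hx', mul_zero]) with h2 | ⟨r', t', hr'⟩
  · exact Or.inr h2
  by_cases hr0 : r = 0
  · exact Or.inl (finish t (LinearMap.ext fun x => by simp [hr, hr0]))
  by_cases hr0' : r' = 0
  · exact Or.inl (finish t' (LinearMap.ext fun x => by simp [hr', hr0']))
  right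
  -- `a` and `b` agree up to scalars on the kernel of `l`
  obtain ⟨e, he⟩ := (D - (r / r') • QuadraticMap.linMulLin a a).exists_dvd_of_ker l fun x hx => by
    have e1 := hab' x hx
    have e2 := hr x
    have e3 := hr' x
    rw [hx] at e2 e3
    have e4 : b x = r / r' * a x := by field_simp; linear_combination e2 - e3
    simp only [sub_apply, smul_apply, smul_eq_mul,
      QuadraticMap.linMulLin_apply, e1, e4]
    ring
  have he' : ∀ x, D x = r / r' * a x ^ 2 + l x * e x := fun x => by
    have := he x
    simp only [sub_apply, smul_apply, smul_eq_mul,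
      QuadraticMap.linMulLin_apply] at this
    linear_combination this
  have h3 : ∀ x, D x = 0 → a x * (H i x - t * F x) * (r / r') + r * e x * F x = 0 :=
    cancel_dual_on_zeros hD hpF ((((PolyFun.dual a).mul ((PolyFun.quad _).sub
      ((PolyFun.const t).mul (PolyFun.quad F)))).mul (PolyFun.const _)).add
      (((PolyFun.const r).mul (PolyFun.dual e)).mul (PolyFun.quad F))) fun x hx => by
        have e1 := h1 x hx
        have e2 := he' x
        rw [hx] at e2
        rw [hr] at e1
        linear_combination (a x * (r / r')) * e1 - (F x * r) * e2
  rcases Submodule.mul_eq_zero_on (LinearMap.ker l ⊓ LinearMap.ker a) (PolyFun.quad F)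
      (PolyFun.dual e) (fun x hx => by
        have hlx : l x = 0 := hx.1
        have hax : a x = 0 := hx.2
        have := h3 x (by rw [he', hlx, hax]; ring)
        rw [hax] at this
        have h4 : r * (F x * e x) = 0 := by linear_combination this
        exact (mul_eq_zero.1 h4).resolve_left hr0) with h4 | h4
  · exact ⟨l, a, fun x hx hx' => ⟨by rw [he', hx, hx']; ring, h4 x ⟨hx, hx'⟩⟩⟩
  · exfalso
    obtain ⟨u, v, huv⟩ := Dual.eq_comb_of_ker (a := a) (l := l) (e := e)
      fun x hx hx' => h4 x ⟨hx', hx⟩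
    exact hD (isProd_of_binary (a := a) (l := l) (r := r / r') (s := u) (t := v) fun x => by
      rw [he', huv]; ring)

end QuadKernel

section Pencil

variable {E : Type*} [AddCommGroup E] [Module ℂ E] [FiniteDimensional ℂ E]

theorem exists_eq_sub_sq_of_norm_eq_zero {D F H : QuadraticForm ℂ E} {h : Dual ℂ E}
    (hD : ¬ IsProd D) (hh : h ≠ 0) (hn : ∀ x, D x = 0 → H x ^ 2 + F x * h x ^ 2 = 0) :
    ∃ (c : ℂ) (e : Dual ℂ E), ∀ x, F x = c * D x - e x ^ 2 := by
  have main : ∀ (c : ℂ) (e : Dual ℂ E), (∀ x, H x = c * D x + h x * e x) →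
      ∃ (c : ℂ) (e : Dual ℂ E), ∀ x, F x = c * D x - e x ^ 2 := fun c e he => by
    have h1 : ∀ x, D x = 0 → h x * (e x ^ 2 + F x) = 0 :=
      cancel_dual_on_zeros hD hh ((PolyFun.dual h).mul (((PolyFun.dual e).pow 2).add
        (PolyFun.quad F))) fun x hx => by
          have := hn x hx
          rw [he, hx] at this
          linear_combination this
    have h2 : ∀ x, D x = 0 → (QuadraticMap.linMulLin e e + F) x = 0 :=
      cancel_dual_on_zeros hD hh (PolyFun.quad _) fun x hx => by
        simpa [sq] using h1 x hx
    obtain ⟨c, hc⟩ := QuadraticForm.eq_smul_of_zeros_subset hD h2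
    refine ⟨c, e, fun x => ?_⟩
    have := hc x
    simp only [add_apply, QuadraticMap.linMulLin_apply] at this
    linear_combination this
  rcases QuadraticForm.of_zeros_subset_on_ker D H h (fun x hx hx' => by
    have := hn x hx'
    rw [hx] at this
    simpa using this) with ⟨c, e, he⟩ | ⟨a, b, g, e, hg, he⟩
  · exact main c e he
  have h1 : ∀ x, D x = 0 → -g x * b x ^ 2 + 2 * (a x * b x * e x) + h x * (e x ^ 2 + F x) = 0 :=
    cancel_dual_on_zeros hD hh ((((PolyFun.const (-1)).mul (PolyFun.dual g)).mul
      ((PolyFun.dual b).pow 2) |>.add ((PolyFun.const 2).mul (((PolyFun.dual a).mul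
        (PolyFun.dual b)).mul (PolyFun.dual e)))).add ((PolyFun.dual h).mul
        (((PolyFun.dual e).pow 2).add (PolyFun.quad F))) |> fun H => by
          simpa only [neg_one_mul] using H) fun x hx => by
        have e1 := hn x hx
        have e2 := hg x
        rw [hx] at e2
        rw [he] at e1
        linear_combination e1 + (b x ^ 2) * e2
  rcases Submodule.mul_eq_zero_on (LinearMap.ker h ⊓ LinearMap.ker a) (PolyFun.dual g)
      ((PolyFun.dual b).pow 2) (fun x hx => by
        have hlx : h x = 0 := hx.1
        have hax : a x = 0 := hx.2
        have := h1 x (by rw [hg, hlx, hax]; ring)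
        rw [hax, hlx] at this
        linear_combination -this) with h4 | h4
  · exfalso
    obtain ⟨u, v, huv⟩ := Dual.eq_comb_of_ker (a := a) (l := h) (e := g)
      fun x hx hx' => h4 x ⟨hx', hx⟩
    exact hD (isProd_of_binary (a := a) (l := h) (r := 1) (s := u) (t := v) fun x => by
      rw [hg, huv]; ring)
  · obtain ⟨u, v, huv⟩ := Dual.eq_comb_of_ker (a := a) (l := h) (e := b)
      fun x hx hx' => by simpa using h4 x ⟨hx', hx⟩
    refine main u (v • a + e - u • g) fun x => ?_
    rw [he, hg, huv]
    simp only [LinearMap.add_apply, LinearMap.sub_apply, LinearMap.smul_apply, smul_eq_mul]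
    ring

/-- The case of the pencil theorem where the vertex lies on only one of the quadrics. -/
theorem pencil_of_anisotropic_vertex {ι : Type*} {s : Finset ι} {H : ι → QuadraticForm ℂ E}
    {D F : QuadraticForm ℂ E}
    (hnp : ∀ α β : ℂ, α ≠ 0 ∨ β ≠ 0 → ¬ IsProd (α • D + β • F))
    (hcov : ∀ x, D x = 0 → F x = 0 → ∃ i ∈ s, H i x = 0)
    {p : E} (hpD : D.polarBilin p = 0) (hFp : F p = 1) :
    ∃ i ∈ s, ∃ α β : ℂ, ∀ x, H i x = α * D x + β * F x := by
  have hD : ¬ IsProd D := by simpa using hnp 1 0 (by simp)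
  have hDp : D p = 0 := by
    have := D.polarBilin_self' p
    rw [hpD] at this
    simpa using this.symm
  let m : Dual ℂ E := (2⁻¹ : ℂ) • F.polarBilin p
  have hm : ∀ x, F.polarBilin x p = 2 * m x := fun x => by
    rw [F.polarBilin_symm]
    simp only [m, LinearMap.smul_apply, smul_eq_mul]; ring
  have hmp : m p = 1 := by
    have := hm p
    rw [F.polarBilin_self', hFp] at this
    linear_combination (-1 / 2) * this
  let P : E →ₗ[ℂ] LinearMap.ker m := LinearMap.codRestrict _ (LinearMap.id - m.smulRight p)
    fun x => by simp [hmp]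
  have hP : ∀ x, (P x : E) = x - m x • p := fun x => rfl
  have hDP : ∀ x, D (P x) = D x := fun x => by
    rw [hP, D.map_sub_smul, D.polarBilin_symm, hpD, hDp]; simp
  let K := LinearMap.ker m
  have hD0 : ¬ IsProd (D.comp K.subtype) := fun ⟨c, d, h⟩ =>
    hD ⟨c.comp P, d.comp P, fun x => by rw [← hDP]; exact h (P x)⟩
  have hFm : ∀ x : E, F (P x) = F x - m x ^ 2 := fun x => by
    rw [hP, F.map_sub_smul, hm, hFp]; ring
  obtain ⟨i, hi, hHi⟩ := (PolyIrred.zeros hD0).exists_of_prod s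
    (f := fun i w => (H i - H i p • F) w ^ 2 + F w * (H i).polarBilin p w ^ 2)
    (fun i _ => (((PolyFun.quad (H i - H i p • F)).comp K.subtype).pow 2).add
      (((PolyFun.quad F).comp K.subtype).mul
        (((PolyFun.dual ((H i).polarBilin p)).comp K.subtype).pow 2)))
    (fun w hw => by
      have hw : D w = 0 := hw
      have hmw : m w = 0 := w.2
      obtain ⟨r, hr⟩ := IsAlgClosed.exists_pow_nat_eq (-F w) (n := 2) (by norm_num)
      obtain ⟨i, hi, h⟩ := hcov (w + r • p)
        (by rw [D.map_add_smul, D.polarBilin_symm, hw, hDp, hpD]; simp)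
        (by rw [F.map_add_smul, hm, hFp, hmw, hr]; ring)
      refine ⟨i, hi, ?_⟩
      rw [(H i).map_add_smul, (H i).polarBilin_symm] at h
      simp only [sub_apply, smul_apply, smul_eq_mul]
      linear_combination (H i w - H i p * F w - r * (H i).polarBilin p w) * h
        + (-(H i p) * (H i w - H i p * F w - r * (H i).polarBilin p w) +
            (H i).polarBilin p w ^ 2) * hr)
  by_cases hh : ((H i).polarBilin p).comp K.subtype = 0
  swap
  · exfalso
    obtain ⟨c, e, he⟩ := exists_eq_sub_sq_of_norm_eq_zero (F := F.comp K.subtype)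
      (H := (H i - H i p • F).comp K.subtype) hD0 hh hHi
    refine hnp (-c) 1 (by simp) ⟨m + e.comp P, m - e.comp P, fun x => ?_⟩
    have e1 : F (P x) = c * D (P x) - e (P x) ^ 2 := he (P x)
    rw [hFm, hDP] at e1
    simp only [add_apply, smul_apply, LinearMap.add_apply, LinearMap.sub_apply, smul_eq_mul,
      LinearMap.comp_apply]
    linear_combination e1
  obtain ⟨c, hc⟩ := QuadraticForm.eq_smul_of_zeros_subset (F := (H i - H i p • F).comp K.subtype)
    hD0 fun x hx => by
      have := hHi x hx
      have h0 : (H i).polarBilin p x = 0 := congrArg (fun f => f x) hh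
      rw [h0] at this
      simpa using this
  refine ⟨i, hi, c, H i p, fun x => ?_⟩
  have e1 : (H i - H i p • F) (P x) = c * D (P x) := hc (P x)
  have e2 : (H i).polarBilin p (P x) = 0 := congrArg (fun f => f (P x)) hh
  simp only [sub_apply, smul_apply, smul_eq_mul] at e1
  rw [hDP, hFm, hP, (H i).map_sub_smul, (H i).polarBilin_symm] at e1
  rw [hP, map_sub, map_smul, (H i).polarBilin_self', smul_eq_mul] at e2
  linear_combination e1 + m x * e2

theorem QuadraticForm.range_polarBilin (q : QuadraticForm ℂ E) :
    LinearMap.range q.polarBilin = (LinearMap.ker q.polarBilin).dualAnnihilator := by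
  refine Submodule.eq_of_le_of_finrank_eq ?_ ?_
  · rintro _ ⟨x, rfl⟩
    rw [Submodule.mem_dualAnnihilator]
    intro y hy
    rw [q.polarBilin_symm, LinearMap.mem_ker.1 hy]; rfl
  · have e1 := LinearMap.finrank_range_add_finrank_ker q.polarBilin
    have e2 : finrank ℂ (LinearMap.ker q.polarBilin) +
      finrank ℂ (LinearMap.ker q.polarBilin).dualAnnihilator = finrank ℂ E :=
        Subspace.finrank_add_finrank_dualAnnihilator_eq (LinearMap.ker q.polarBilin)
    exact Nat.add_left_cancel (((add_comm _ _).trans e1).trans e2.symm)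

/-- Two symmetric bilinear forms on a nonzero space: some pencil member has a radical vector
outside the radical of another member. -/
theorem exists_pencil_vertex {F G : QuadraticForm ℂ E} (hF : ¬ IsProd F) (hG : ¬ IsProd G) :
    (∃ p, G.polarBilin p = 0 ∧ F.polarBilin p ≠ 0) ∨
    ∃ (p : E) (c : ℂ), F.polarBilin p = c • G.polarBilin p ∧ G.polarBilin p ≠ 0 := by
  by_cases h1 : LinearMap.ker G.polarBilin ≤ LinearMap.ker F.polarBilin
  swap
  · left
    obtain ⟨p, hp, hp'⟩ := SetLike.not_le_iff_exists.1 h1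
    exact ⟨p, hp, hp'⟩
  right
  by_cases h2 : LinearMap.ker F.polarBilin ≤ LinearMap.ker G.polarBilin
  swap
  · obtain ⟨p, hp, hp'⟩ := SetLike.not_le_iff_exists.1 h2
    exact ⟨p, 0, by simpa using hp, hp'⟩
  -- the operator `G⁻¹ F` on the quotient by the common radical
  have hr : LinearMap.range F.polarBilin ≤ LinearMap.range G.polarBilin := by
    rw [F.range_polarBilin, G.range_polarBilin]
    exact Submodule.dualAnnihilator_anti h1
  obtain ⟨T, hT⟩ : ∃ T : E →ₗ[ℂ] E, ∀ x, G.polarBilin (T x) = F.polarBilin x := by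
    obtain ⟨T, hT⟩ := Module.projective_lifting_property G.polarBilin.rangeRestrict
      (F.polarBilin.codRestrict _ fun x => hr ⟨x, rfl⟩) G.polarBilin.surjective_rangeRestrict
    exact ⟨T, fun x => congrArg Subtype.val (LinearMap.congr_fun hT x)⟩
  let K := LinearMap.ker G.polarBilin
  let T' := K.mapQ K T fun x hx => by
    change G.polarBilin (T x) = 0
    rw [hT]
    exact h1 hx
  obtain ⟨p0, -, hp0⟩ := exists_isotropic_of_not_isProd hG
  have : Nontrivial (E ⧸ K) := Submodule.Quotient.nontrivial_iff.2 fun h =>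
    hp0 (show p0 ∈ K by rw [h]; trivial)
  obtain ⟨c, hc⟩ := Module.End.exists_eigenvalue T'
  obtain ⟨v, hv⟩ := hc.exists_hasEigenvector
  obtain ⟨p, rfl⟩ := K.mkQ_surjective v
  refine ⟨p, c, ?_, fun h => hv.2 ((Submodule.Quotient.mk_eq_zero K).2 h)⟩
  have h3 : K.mkQ (T p - c • p) = 0 := by
    have := hv.apply_eq_smul
    rw [map_sub, map_smul, ← this]
    simp [T']
  have h4 : G.polarBilin (T p - c • p) = 0 := (Submodule.Quotient.mk_eq_zero K).1 h3
  rw [map_sub, map_smul, hT, sub_eq_zero] at h4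
  exact h4

theorem pencil_of_vertex {ι : Type*} {s : Finset ι} {H : ι → QuadraticForm ℂ E}
    {D F : QuadraticForm ℂ E}
    (hnp : ∀ α β : ℂ, α ≠ 0 ∨ β ≠ 0 → ¬ IsProd (α • D + β • F))
    (hcov : ∀ x, D x = 0 → F x = 0 → ∃ i ∈ s, H i x = 0)
    {p : E} (hpD : D.polarBilin p = 0) (hpF : F.polarBilin p ≠ 0) :
    (∃ i ∈ s, ∃ α β : ℂ, ∀ x, H i x = α * D x + β * F x) ∨
      ∃ c d : Dual ℂ E, ∀ x, c x = 0 → d x = 0 → D x = 0 ∧ F x = 0 := by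
  by_cases h : F p = 0
  · exact pencil_of_isotropic_vertex hnp hcov hpD hpF h
  left
  obtain ⟨r, hr⟩ := IsAlgClosed.exists_pow_nat_eq (F p) (n := 2) (by norm_num)
  have hr0 : r ≠ 0 := by rintro rfl; exact h (by simpa using hr.symm)
  exact pencil_of_anisotropic_vertex hnp hcov (p := r⁻¹ • p) (by rw [map_smul, hpD, smul_zero])
    (by rw [F.map_smul', ← hr]; field_simp)

/-- Structure of a pair of non-product quadratic forms whose common zeros are covered by the
zero sets of finitely many quadratic forms. -/
theorem pencil_structure {ι : Type*} {s : Finset ι} {H : ι → QuadraticForm ℂ E}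
    {F G : QuadraticForm ℂ E} (hF : ¬ IsProd F) (hG : ¬ IsProd G)
    (hcov : ∀ x, F x = 0 → G x = 0 → ∃ i ∈ s, H i x = 0) :
    (∃ i ∈ s, ∃ α β : ℂ, ∀ x, H i x = α * F x + β * G x) ∨
    (∃ α β : ℂ, α ≠ 0 ∧ β ≠ 0 ∧ IsProd (α • F + β • G)) ∨
      ∃ c d : Dual ℂ E, ∀ x, c x = 0 → d x = 0 → F x = 0 ∧ G x = 0 := by
  by_cases hnp : ∃ α β : ℂ, α ≠ 0 ∧ β ≠ 0 ∧ IsProd (α • F + β • G)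
  · exact Or.inr (Or.inl hnp)
  push Not at hnp
  have smulP : ∀ {q : QuadraticForm ℂ E} {c : ℂ}, c ≠ 0 → ¬ IsProd q → ¬ IsProd (c • q) :=
    fun {q c} hc hq ⟨a, b, hab⟩ => hq ⟨c⁻¹ • a, b, fun x => by
      have := hab x
      simp only [smul_apply, LinearMap.smul_apply, smul_eq_mul] at this ⊢
      rw [mul_assoc, ← this]; field_simp⟩
  have hnp' : ∀ α β : ℂ, α ≠ 0 ∨ β ≠ 0 → ¬ IsProd (α • F + β • G) := by
    intro α β h
    by_cases hα : α = 0
    · have hβ : β ≠ 0 := by simpa [hα] using h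
      simpa [hα] using smulP hβ hG
    · by_cases hβ : β = 0
      · simpa [hβ] using smulP hα hF
      · exact hnp α β hα hβ
  rcases exists_pencil_vertex hF hG with ⟨p, hp, hp'⟩ | ⟨p, c, hp, hp'⟩
  · rcases pencil_of_vertex (D := G) (F := F)
      (fun α β h => by rw [add_comm]; exact hnp' β α h.symm) (fun x h1 h2 => hcov x h2 h1) hp hp'
      with ⟨i, hi, α, β, h⟩ | ⟨c, d, h⟩
    · exact Or.inl ⟨i, hi, β, α, fun x => by rw [h]; ring⟩
    · exact Or.inr (Or.inr ⟨c, d, fun x h1 h2 => (h x h1 h2).symm⟩)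
  · have hv : (F - c • G).polarBilin p = 0 := by
      rw [QuadraticForm.polarBilin_sub', QuadraticForm.polarBilin_smul', LinearMap.sub_apply,
        LinearMap.smul_apply, hp, sub_self]
    rcases pencil_of_vertex (D := F - c • G) (F := G)
      (fun α β h => by
        have : α • (F - c • G) + β • G = α • F + (β - α * c) • G := by module
        rw [this]
        refine hnp' _ _ ?_
        by_cases hα : α = 0
        · right; simpa [hα] using h
        · exact Or.inl hα)
      (fun x h1 h2 => hcov x (by simpa [h2] using h1) h2) hv hp'
      with ⟨i, hi, α, β, h⟩ | ⟨c', d, h⟩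
    · refine Or.inl ⟨i, hi, α, β - α * c, fun x => ?_⟩
      rw [h]; simp only [sub_apply, smul_apply, smul_eq_mul]; ring
    · refine Or.inr (Or.inr ⟨c', d, fun x h1 h2 => ?_⟩)
      obtain ⟨h3, h4⟩ := h x h1 h2
      exact ⟨by simpa [h4] using h3, h4⟩

end Pencil

/-- Approximate matrix scaling: columns can be rescaled so that the normalised rows carry weight
at least one half on every column. -/
theorem exists_column_scaling {R S : Type*} [Fintype R] [Fintype S] [DecidableEq S]
    (b : R → S → ℝ) (hb : ∀ r s, 0 ≤ b r s) (w : R → ℝ) (hw : ∀ r, 0 ≤ w r) (c : R → S)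
    (hc : ∀ r, b r (c r) = 1) (hsum : ∀ s, ∑ r with c r = s, w r = 1) :
    ∃ x : S → ℝ, (∀ s, 0 < x s) ∧
      ∀ s, 1 / 2 ≤ ∑ r, w r * (b r s * x s / ∑ s', b r s' * x s') := by
  let ρ : R → (S → ℝ) → ℝ := fun r y => ∑ s, b r s * Real.exp (y s)
  have hρge : ∀ r y, Real.exp (y (c r)) ≤ ρ r y := fun r y => by
    have := Finset.single_le_sum (f := fun s => b r s * Real.exp (y s))
      (fun s _ => mul_nonneg (hb r s) (Real.exp_pos _).le) (Finset.mem_univ (c r))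
    simpa [hc] using this
  have hρ : ∀ r y, 0 < ρ r y := fun r y => (Real.exp_pos _).trans_le (hρge r y)
  let Φ : (S → ℝ) → ℝ := fun y => ∑ r, w r * Real.log (ρ r y) - ∑ s, y s
  have hΦ : ∀ y, 0 ≤ Φ y := fun y => by
    have h1 : ∑ s, y s = ∑ r, w r * y (c r) := by
      rw [← Finset.sum_fiberwise (s := Finset.univ) (g := c) (f := fun r => w r * y (c r))]
      refine Finset.sum_congr rfl fun s _ => ?_
      rw [← one_mul (y s), ← hsum s, Finset.sum_mul]
      exact Finset.sum_congr rfl fun r hr => by rw [(Finset.mem_filter.1 hr).2]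
    have h2 : ∑ r, w r * y (c r) ≤ ∑ r, w r * Real.log (ρ r y) :=
      Finset.sum_le_sum fun r _ => mul_le_mul_of_nonneg_left
        ((Real.le_log_iff_exp_le (hρ r y)).2 (hρge r y)) (hw r)
    simp only [Φ]
    linarith
  have hρc : ∀ r, Continuous (ρ r) := fun r => by fun_prop
  have hΦc : Continuous Φ := by
    refine Continuous.sub (continuous_finsetSum _ fun r _ => ?_) (by fun_prop)
    exact continuous_const.mul ((hρc r).log fun y => (hρ r y).ne')
  set C := Φ 0 with hC
  have hC0 : 0 ≤ C := hΦ 0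
  let η : ℝ := 1 / (16 * (C + 1))
  have hη : 0 < η := by positivity
  let Ψ : (S → ℝ) → ℝ := fun y => Φ y + η * ∑ s, y s ^ 2
  have hΨc : Continuous Ψ := hΦc.add (by fun_prop)
  let rad : ℝ := 16 * (C + 1)
  have hrad : 0 ≤ rad := by positivity
  obtain ⟨y, -, hy⟩ := (isCompact_closedBall (0 : S → ℝ) rad).exists_isMinOn
    ⟨0, by simpa using hrad⟩ hΨc.continuousOn
  have hΨ0 : Ψ 0 = C := by simp [Ψ, hC]
  have hmin : ∀ z, Ψ y ≤ Ψ z := by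
    intro z
    by_cases hz : z ∈ Metric.closedBall (0 : S → ℝ) rad
    · exact hy hz
    have h0 : Ψ y ≤ Ψ 0 := hy (by simpa using hrad)
    refine h0.trans ?_
    rw [hΨ0]
    rw [mem_closedBall_zero_iff, pi_norm_le_iff_of_nonneg hrad] at hz
    push Not at hz
    obtain ⟨s, hs⟩ := hz
    have h1 : z s ^ 2 ≤ ∑ s, z s ^ 2 := Finset.single_le_sum (f := fun s => z s ^ 2)
      (fun s _ => sq_nonneg _) (Finset.mem_univ s)
    have h2 : rad ^ 2 ≤ z s ^ 2 := by
      rw [← sq_abs (z s)]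
      exact pow_le_pow_left₀ hrad hs.le 2
    have h3 : η * rad ^ 2 ≤ η * ∑ s, z s ^ 2 :=
      mul_le_mul_of_nonneg_left (h2.trans h1) hη.le
    have h4 : η * rad ^ 2 = 16 * (C + 1) := by
      simp only [η, rad]; field_simp
    have := hΦ z
    simp only [Ψ]
    linarith
  have hys : ∀ s, η * y s ≤ 1 / 4 := by
    intro s
    have h1 : y s ^ 2 ≤ ∑ s, y s ^ 2 := Finset.single_le_sum (f := fun s => y s ^ 2)
      (fun s _ => sq_nonneg _) (Finset.mem_univ s)
    have h2 : η * y s ^ 2 ≤ C := by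
      have h3 := hmin 0
      rw [hΨ0] at h3
      have h4 := mul_le_mul_of_nonneg_left h1 hη.le
      have := hΦ y
      simp only [Ψ] at h3
      linarith
    have h5 : η * C ≤ 1 / 16 := by
      simp only [η]
      rw [div_mul_eq_mul_div, div_le_div_iff₀ (by positivity) (by norm_num)]
      linarith
    have h6 : (η * y s) ^ 2 ≤ (1 / 4) ^ 2 := by
      calc (η * y s) ^ 2 = η * (η * y s ^ 2) := by ring
        _ ≤ η * C := mul_le_mul_of_nonneg_left h2 hη.le
        _ ≤ (1 / 4) ^ 2 := by linarith
    exact le_of_sq_le_sq h6 (by norm_num) 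
  refine ⟨fun s => Real.exp (y s), fun s => Real.exp_pos _, fun s => ?_⟩
  -- derivative of `Ψ` in the direction of the coordinate `s`
  have hu : ∀ s', HasDerivAt (fun t : ℝ => (y + t • (Pi.single s 1 : S → ℝ)) s')
      ((Pi.single s 1 : S → ℝ) s') 0 := fun s' => by
    have := ((hasDerivAt_id (0 : ℝ)).mul_const ((Pi.single s 1 : S → ℝ) s')).const_add (y s')
    simpa using this
  have hz : y + (0 : ℝ) • (Pi.single s 1 : S → ℝ) = y := by simp
  have hdρ : ∀ r, HasDerivAt (fun t : ℝ => ρ r (y + t • (Pi.single s 1 : S → ℝ)))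
      (b r s * Real.exp (y s)) 0 := fun r => by
    have h1 : HasDerivAt (fun t : ℝ => ρ r (y + t • (Pi.single s 1 : S → ℝ)))
        (∑ s', b r s' * (Real.exp ((y + (0 : ℝ) • (Pi.single s 1 : S → ℝ)) s') *
          (Pi.single s 1 : S → ℝ) s')) 0 :=
      HasDerivAt.fun_sum fun s' _ => ((hu s').exp).const_mul _
    rw [hz] at h1
    have h2 : ∑ s', b r s' * (Real.exp (y s') * (Pi.single s 1 : S → ℝ) s') =
        b r s * Real.exp (y s) := by
      rw [Finset.sum_eq_single s] <;> simp +contextual [Pi.single_apply]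
    rwa [h2] at h1
  have hdΨ : HasDerivAt (fun t : ℝ => Ψ (y + t • (Pi.single s 1 : S → ℝ)))
      ((∑ r, w r * (b r s * Real.exp (y s) / ρ r y) - 1) + η * (2 * y s)) 0 := by
    have h1 : HasDerivAt (fun t : ℝ => ∑ r, w r * Real.log (ρ r (y + t • (Pi.single s 1 : S → ℝ))))
        (∑ r, w r * (b r s * Real.exp (y s) / ρ r y)) 0 :=
      HasDerivAt.fun_sum fun r _ => by
        have := ((hdρ r).log (hρ r _).ne').const_mul (w r)
        rwa [hz] at this
    have h2 : HasDerivAt (fun t : ℝ => ∑ s', (y + t • (Pi.single s 1 : S → ℝ)) s') 1 0 := by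
      have := HasDerivAt.fun_sum (u := Finset.univ) fun s' _ => hu s'
      simpa [Finset.sum_pi_single'] using this
    have h3 : HasDerivAt (fun t : ℝ => ∑ s', (y + t • (Pi.single s 1 : S → ℝ)) s' ^ 2)
        (2 * y s) 0 := by
      have h4 : HasDerivAt (fun t : ℝ => ∑ s', (y + t • (Pi.single s 1 : S → ℝ)) s' ^ 2)
          (∑ s', (2 : ℕ) * (y + (0 : ℝ) • (Pi.single s 1 : S → ℝ)) s' ^ (2 - 1) *
            (Pi.single s 1 : S → ℝ) s') 0 :=
        HasDerivAt.fun_sum (u := Finset.univ) fun s' _ => (hu s').fun_pow 2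
      rw [hz] at h4
      have h5 : ∑ s', ((2 : ℕ) : ℝ) * y s' ^ (2 - 1) * (Pi.single s 1 : S → ℝ) s' = 2 * y s := by
        rw [Finset.sum_eq_single s] <;> simp +contextual [Pi.single_apply]
      rwa [h5] at h4
    exact (h1.sub h2).add (h3.const_mul η)
  have hloc : IsLocalMin (fun t : ℝ => Ψ (y + t • (Pi.single s 1 : S → ℝ))) 0 :=
    Filter.Eventually.of_forall fun t => by
      simp only [hz]
      exact hmin _
  have h0 := hloc.hasDerivAt_eq_zero hdΨ
  have := hys s
  linarith

/-- Diagonal dominance in the Frobenius sense bounds the kernel. -/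
theorem finrank_le_of_weighted_rows {R S : Type*} [Fintype R] [Fintype S] [DecidableEq S]
    (u : R → S → ℂ) (w : R → ℝ) (hw : ∀ r, 0 ≤ w r)
    (hrow : ∀ r, ∑ s, ‖u r s‖ ^ 2 = 1) (hcol : ∀ s, 1 / 2 ≤ ∑ r, w r * ‖u r s‖ ^ 2)
    (hwS : ∑ r, w r = Fintype.card S) (t : ℝ)
    (ht : ∀ s s', s ≠ s' → ∑ r with u r s ≠ 0 ∧ u r s' ≠ 0, w r ≤ t)
    (ht0 : 0 ≤ t)
    (K : Submodule ℂ (EuclideanSpace ℂ S)) (hK : ∀ z ∈ K, ∀ r, ∑ s, u r s * z s = 0) :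
    (finrank ℂ K : ℝ) ≤ 4 * t * Fintype.card S := by
  classical
  set d := finrank ℂ K with hd
  let e := stdOrthonormalBasis ℂ K
  let f : Fin d → S → ℂ := fun k s => (e k : EuclideanSpace ℂ S) s
  have hf : ∀ k r, ∑ s, u r s * f k s = 0 := fun k r => hK _ (e k).2 r
  have hort : ∀ k l, ∑ s, f l s * star (f k s) = if k = l then 1 else 0 := fun k l => by
    have := (orthonormal_iff_ite.1 e.orthonormal) k l
    rw [Submodule.coe_inner] at this
    rw [← this, PiLp.inner_apply]
    simp [f]
  let P : S → S → ℂ := fun s s' => ∑ k, f k s * star (f k s')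
  let M : S → S → ℂ := fun s s' => ∑ r, (w r : ℂ) * (star (u r s) * u r s')
  have hMP : ∑ s, ∑ s', M s s' * P s' s = 0 := by
    have h1 : ∀ s, ∑ s', M s s' * P s' s =
        ∑ r, ∑ k, (w r : ℂ) * star (u r s) * star (f k s) * ∑ s', u r s' * f k s' := fun s => by
      calc ∑ s', M s s' * P s' s = ∑ s', ∑ r, ∑ k, (w r : ℂ) * (star (u r s) * u r s') *
            (f k s' * star (f k s)) := Finset.sum_congr rfl fun s' _ => Finset.sum_mul_sum _ _ _ _
        _ = ∑ r, ∑ k, ∑ s', (w r : ℂ) * (star (u r s) * u r s') * (f k s' * star (f k s)) := by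
            rw [Finset.sum_comm]
            exact Finset.sum_congr rfl fun r _ => Finset.sum_comm
        _ = _ := by
            refine Finset.sum_congr rfl fun r _ => Finset.sum_congr rfl fun k _ => ?_
            rw [Finset.mul_sum]
            exact Finset.sum_congr rfl fun s' _ => by ring
    simp [h1, hf]
  have hMd : ∀ s, M s s = ((∑ r, w r * ‖u r s‖ ^ 2 : ℝ) : ℂ) := fun s => by
    simp only [M]
    push_cast
    refine Finset.sum_congr rfl fun r _ => ?_
    rw [← Complex.conj_mul']; rfl
  have hPd : ∀ s, P s s = ((∑ k, ‖f k s‖ ^ 2 : ℝ) : ℂ) := fun s => by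
    simp only [P]
    push_cast
    refine Finset.sum_congr rfl fun k _ => ?_
    rw [← Complex.mul_conj']; rfl
  have hPsum : ∑ s, ∑ k, ‖f k s‖ ^ 2 = (d : ℝ) := by
    have h1 : ∀ k, ∑ s, ‖f k s‖ ^ 2 = (1 : ℝ) := fun k => by
      have := hort k k
      simp only [if_true] at this
      have h2 : ((∑ s, ‖f k s‖ ^ 2 : ℝ) : ℂ) = 1 := by
        rw [← this]
        push_cast
        refine Finset.sum_congr rfl fun s _ => ?_
        rw [← Complex.mul_conj']; rfl
      exact_mod_cast h2
    rw [Finset.sum_comm]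
    simp [h1]
  have hPF : ∑ s, ∑ s', ‖P s s'‖ ^ 2 = (d : ℝ) := by
    have h1 : ((∑ s, ∑ s', ‖P s s'‖ ^ 2 : ℝ) : ℂ) = d := by
      push_cast
      calc ∑ s, ∑ s', ((‖P s s'‖ : ℂ)) ^ 2 = ∑ s, ∑ s', ∑ k, ∑ l,
            (f k s * star (f l s)) * (f l s' * star (f k s')) := by
            refine Finset.sum_congr rfl fun s _ => Finset.sum_congr rfl fun s' _ => ?_
            rw [← Complex.mul_conj']
            simp only [P, map_sum, Finset.sum_mul_sum]
            refine Finset.sum_congr rfl fun k _ => Finset.sum_congr rfl fun l _ => ?_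
            simp
            ring
        _ = ∑ k, ∑ l, (∑ s, f k s * star (f l s)) * (∑ s', f l s' * star (f k s')) := by
            simp only [Finset.sum_mul_sum]
            rw [Finset.sum_congr rfl fun s _ => Finset.sum_comm, Finset.sum_comm]
            refine Finset.sum_congr rfl fun k _ => ?_
            rw [Finset.sum_congr rfl fun s _ => Finset.sum_comm, Finset.sum_comm]
        _ = d := by simp only [hort]; simp
    exact_mod_cast h1
  have hMF : ∑ p ∈ (Finset.univ : Finset S).offDiag, ‖M p.1 p.2‖ ^ 2 ≤ t * Fintype.card S := by
    have h1 : ∀ p ∈ (Finset.univ : Finset S).offDiag, ‖M p.1 p.2‖ ^ 2 ≤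
        t * ∑ r, w r * (‖u r p.1‖ ^ 2 * ‖u r p.2‖ ^ 2) := by
      rintro ⟨s, s'⟩ hp
      have hne : s ≠ s' := by simpa using hp
      have h2 : ‖M s s'‖ ≤ ∑ r with u r s ≠ 0 ∧ u r s' ≠ 0, √(w r) *
          (√(w r) * (‖u r s‖ * ‖u r s'‖)) := by
        rw [Finset.sum_filter]
        refine (norm_sum_le _ _).trans (Finset.sum_le_sum fun r _ => ?_)
        split_ifs with h
        · have h3 : √(w r) * (√(w r) * (‖u r s‖ * ‖u r s'‖)) = w r * (‖u r s‖ * ‖u r s'‖) := by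
            rw [← mul_assoc, Real.mul_self_sqrt (hw r)]
          rw [h3]
          simp [abs_of_nonneg (hw r)]
        · simp only [not_and_or, not_not] at h
          rcases h with h | h <;> simp [h]
      calc ‖M s s'‖ ^ 2 ≤ (∑ r with u r s ≠ 0 ∧ u r s' ≠ 0, √(w r) *
          (√(w r) * (‖u r s‖ * ‖u r s'‖))) ^ 2 := pow_le_pow_left₀ (norm_nonneg _) h2 2
        _ ≤ (∑ r with u r s ≠ 0 ∧ u r s' ≠ 0, √(w r) ^ 2) *
            ∑ r with u r s ≠ 0 ∧ u r s' ≠ 0, (√(w r) * (‖u r s‖ * ‖u r s'‖)) ^ 2 :=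
          Finset.sum_mul_sq_le_sq_mul_sq _ _ _
        _ ≤ t * ∑ r, w r * (‖u r s‖ ^ 2 * ‖u r s'‖ ^ 2) := by
          refine mul_le_mul ?_ ?_ (Finset.sum_nonneg fun _ _ => sq_nonneg _) ht0
          · simpa [Real.sq_sqrt (hw _)] using ht s s' hne
          · refine (Finset.sum_le_sum_of_subset_of_nonneg (Finset.filter_subset _ _)
              fun _ _ _ => sq_nonneg _).trans (le_of_eq ?_)
            refine Finset.sum_congr rfl fun r _ => ?_
            rw [mul_pow, Real.sq_sqrt (hw r)]; ring
    refine (Finset.sum_le_sum h1).trans ?_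
    rw [← Finset.mul_sum]
    refine mul_le_mul_of_nonneg_left ?_ ht0
    calc ∑ p ∈ (Finset.univ : Finset S).offDiag, ∑ r, w r * (‖u r p.1‖ ^ 2 * ‖u r p.2‖ ^ 2)
        ≤ ∑ p : S × S, ∑ r, w r * (‖u r p.1‖ ^ 2 * ‖u r p.2‖ ^ 2) :=
          Finset.sum_le_sum_of_subset_of_nonneg (Finset.subset_univ _) fun p _ _ =>
            Finset.sum_nonneg fun r _ => mul_nonneg (hw r) (by positivity)
      _ = ∑ r, w r * ((∑ s, ‖u r s‖ ^ 2) * ∑ s, ‖u r s‖ ^ 2) := by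
          rw [Finset.sum_comm]
          refine Finset.sum_congr rfl fun r _ => ?_
          rw [← Finset.mul_sum, Finset.sum_mul_sum, Fintype.sum_prod_type]
      _ = Fintype.card S := by simp [hrow, hwS]
  have hoff : (d : ℝ) / 2 ≤ ∑ p ∈ (Finset.univ : Finset S).offDiag, ‖M p.1 p.2‖ * ‖P p.2 p.1‖ := by
    have h1 : ∑ s, M s s * P s s + ∑ p ∈ (Finset.univ : Finset S).offDiag, M p.1 p.2 * P p.2 p.1
        = 0 := by
      rw [← hMP, ← Fintype.sum_prod_type', ← Finset.univ_product_univ, ← Finset.diag_union_offDiag,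
        Finset.sum_union (Finset.disjoint_diag_offDiag _), Finset.sum_diag]
    have h2 : (d : ℝ) / 2 ≤ ∑ s, (∑ r, w r * ‖u r s‖ ^ 2) * ∑ k, ‖f k s‖ ^ 2 := by
      rw [← hPsum, Finset.sum_div]
      refine Finset.sum_le_sum fun s _ => ?_
      rw [div_eq_mul_one_div, mul_comm]
      exact mul_le_mul_of_nonneg_right (hcol s) (Finset.sum_nonneg fun _ _ => sq_nonneg _)
    have h3 : ((∑ s, (∑ r, w r * ‖u r s‖ ^ 2) * ∑ k, ‖f k s‖ ^ 2 : ℝ) : ℂ) =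
        ∑ s, M s s * P s s := by
      rw [Complex.ofReal_sum]
      refine Finset.sum_congr rfl fun s _ => ?_
      rw [hMd, hPd, Complex.ofReal_mul]
    calc (d : ℝ) / 2 ≤ ∑ s, (∑ r, w r * ‖u r s‖ ^ 2) * ∑ k, ‖f k s‖ ^ 2 := h2
      _ ≤ ‖((∑ s, (∑ r, w r * ‖u r s‖ ^ 2) * ∑ k, ‖f k s‖ ^ 2 : ℝ) : ℂ)‖ := by
        rw [Complex.norm_real]; exact le_abs_self _
      _ = ‖∑ p ∈ (Finset.univ : Finset S).offDiag, M p.1 p.2 * P p.2 p.1‖ := by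
        rw [h3, eq_neg_of_add_eq_zero_left h1, norm_neg]
      _ ≤ _ := (norm_sum_le _ _).trans (Finset.sum_le_sum fun p _ => (norm_mul _ _).le)
  have hfin : ((d : ℝ) / 2) ^ 2 ≤ (t * Fintype.card S) * d := by
    calc ((d : ℝ) / 2) ^ 2 ≤
        (∑ p ∈ (Finset.univ : Finset S).offDiag, ‖M p.1 p.2‖ * ‖P p.2 p.1‖) ^ 2 :=
          pow_le_pow_left₀ (by positivity) hoff 2
      _ ≤ _ := Finset.sum_mul_sq_le_sq_mul_sq _ _ _
      _ ≤ (t * Fintype.card S) * d := by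
        refine mul_le_mul hMF ?_ (Finset.sum_nonneg fun _ _ => sq_nonneg _) (by positivity)
        rw [← hPF, Finset.sum_comm, ← Fintype.sum_prod_type' (f := fun s s' => ‖P s' s‖ ^ 2)]
        exact Finset.sum_le_sum_of_subset_of_nonneg (Finset.subset_univ _) fun _ _ _ => sq_nonneg _
  by_cases h0 : (d : ℝ) = 0
  · rw [h0]; positivity
  · have hdpos : (0 : ℝ) < d := lt_of_le_of_ne (Nat.cast_nonneg _) (Ne.symm h0)
    nlinarith

/-- Linear dependencies forming a weighted design bound the dimension of the span. -/
theorem finrank_span_le_of_design {R S X : Type*} [Fintype R] [Fintype S] [DecidableEq S]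
    [AddCommGroup X] [Module ℂ X] (v : S → X)
    (A : R → S → ℂ) (w : R → ℝ) (hw : ∀ r, 0 ≤ w r) (c : R → S) (hc : ∀ r, A r (c r) = 1)
    (hsum : ∀ s, ∑ r with c r = s, w r = 1) (t : ℝ) (ht0 : 0 ≤ t)
    (ht : ∀ s s', s ≠ s' → ∑ r with A r s ≠ 0 ∧ A r s' ≠ 0, w r ≤ t)
    (hv : ∀ r, ∑ s, A r s • v s = 0) :
    (finrank ℂ (Submodule.span ℂ (Set.range v)) : ℝ) ≤ 4 * t * Fintype.card S := by
  classical
  obtain ⟨x, hx, hcol⟩ := exists_column_scaling (fun r s => ‖A r s‖ ^ 2) (fun _ _ => sq_nonneg _)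
    w hw c (fun r => by simp [hc]) hsum
  let ρ : R → ℝ := fun r => ∑ s, ‖A r s‖ ^ 2 * x s
  have hρ : ∀ r, 0 < ρ r := fun r =>
    Finset.sum_pos' (fun s _ => mul_nonneg (sq_nonneg _) (hx s).le)
      ⟨c r, Finset.mem_univ _, by simpa [hc] using hx (c r)⟩
  let u : R → S → ℂ := fun r s => A r s * ((√(x s) / √(ρ r) : ℝ) : ℂ)
  have hu : ∀ r s, ‖u r s‖ ^ 2 = ‖A r s‖ ^ 2 * x s / ρ r := fun r s => by
    simp only [u, norm_mul, Complex.norm_real, mul_pow, Real.norm_eq_abs, sq_abs, div_pow,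
      Real.sq_sqrt (hx s).le, Real.sq_sqrt (hρ r).le]
    ring
  have hu0 : ∀ r s, u r s ≠ 0 ↔ A r s ≠ 0 := fun r s => by
    have h1 : √(x s) ≠ 0 := (Real.sqrt_pos.2 (hx s)).ne'
    have h2 : √(ρ r) ≠ 0 := (Real.sqrt_pos.2 (hρ r)).ne'
    simp [u, h1, h2]
  let V := Submodule.span ℂ (Set.range v)
  have : FiniteDimensional ℂ V := FiniteDimensional.span_of_finite ℂ (Set.finite_range v)
  let v' : S → V := fun s => ⟨v s, Submodule.subset_span ⟨s, rfl⟩⟩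
  let L0 : Dual ℂ V →ₗ[ℂ] (S → ℂ) := LinearMap.pi fun s =>
    ((√(x s) : ℂ)⁻¹) • (Dual.eval ℂ V (v' s))
  let L : Dual ℂ V →ₗ[ℂ] EuclideanSpace ℂ S := (WithLp.linearEquiv 2 ℂ (S → ℂ)).symm ∘ₗ L0
  have hL : ∀ g s, (L g) s = (√(x s) : ℂ)⁻¹ * g (v' s) := fun g s => rfl
  have hinj : Function.Injective L := by
    rw [← LinearMap.ker_eq_bot, LinearMap.ker_eq_bot']
    intro g hg
    have h1 : ∀ s, g (v' s) = 0 := fun s => by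
      have h2 := hL g s
      rw [hg] at h2
      have h3 : (√(x s) : ℂ)⁻¹ ≠ 0 := inv_ne_zero (by
        exact_mod_cast (Real.sqrt_pos.2 (hx s)).ne')
      exact (mul_eq_zero.1 h2.symm).resolve_left h3
    ext ⟨z, hz⟩
    induction hz using Submodule.span_induction with
    | mem z hz => obtain ⟨s, rfl⟩ := hz; exact h1 s
    | zero => exact map_zero g
    | add a b ha hb h3 h4 =>
      have : (⟨a + b, Submodule.add_mem _ ha hb⟩ : V) = ⟨a, ha⟩ + ⟨b, hb⟩ := rfl
      rw [this, map_add, h3, h4]; simp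
    | smul r a ha h3 =>
      have : (⟨r • a, Submodule.smul_mem _ r ha⟩ : V) = r • ⟨a, ha⟩ := rfl
      rw [this, map_smul, h3]; simp
  have hfin := finrank_le_of_weighted_rows u w hw
    (fun r => by
      simp only [hu]
      rw [← Finset.sum_div]
      exact div_self (hρ r).ne')
    (fun s => by simpa only [hu] using hcol s)
    (by
      rw [← Finset.sum_fiberwise (s := Finset.univ) (g := c)]
      simp [hsum])
    t (fun s s' h => by simpa only [hu0] using ht s s' h) ht0 (LinearMap.range L) (by
      rintro _ ⟨g, rfl⟩ r
      have h1 : ∀ s, u r s * L g s = ((√(ρ r) : ℂ)⁻¹) * (A r s * g (v' s)) := fun s => by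
        have h3 : (√(x s) : ℂ) ≠ 0 := by exact_mod_cast (Real.sqrt_pos.2 (hx s)).ne'
        rw [hL]
        simp only [u]
        push_cast
        field_simp
      simp only [h1]
      rw [← Finset.mul_sum]
      have h2 : ∑ s, A r s * g (v' s) = g (∑ s, A r s • v' s) := by simp
      have h3 : ∑ s, A r s • v' s = 0 := Subtype.ext (by simpa [v'] using hv r)
      rw [h2, h3, map_zero, mul_zero])
  rwa [LinearMap.finrank_range_of_inj hinj, Subspace.dual_finrank_eq] at hfin

section SylvesterGallai

variable {X : Type*} [AddCommGroup X] [Module ℂ X]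

theorem LinearIndependent.of_mem_span_pair {x y z : X} (hxz : LinearIndependent ℂ ![x, z])
    (hyz : LinearIndependent ℂ ![y, z]) (h : z ∈ Submodule.span ℂ {x, y}) :
    ∃ a b : ℂ, a ≠ 0 ∧ b ≠ 0 ∧ x + a • y + b • z = 0 := by
  obtain ⟨α, β, hz⟩ := Submodule.mem_span_pair.1 h
  rw [LinearIndependent.pair_iff] at hxz hyz
  have hα : α ≠ 0 := by
    rintro rfl
    have := hyz β (-1) (by rw [← hz]; module)
    simp at this
  have hβ : β ≠ 0 := by
    rintro rfl
    have := hxz α (-1) (by rw [← hz]; module)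
    simp at this
  refine ⟨β / α, -1 / α, div_ne_zero hβ hα, div_ne_zero (by simp) hα, ?_⟩
  rw [← hz]
  match_scalars <;> field_simp <;> ring

theorem span_pair_eq_of_relation {x y z : X} {a b : ℂ} (ha : a ≠ 0) (hb : b ≠ 0)
    (h : x + a • y + b • z = 0) :
    Submodule.span ℂ {x, y} = Submodule.span ℂ {x, z} := by
  apply le_antisymm
  · rw [Submodule.span_le]
    rintro w (rfl | rfl)
    · exact Submodule.subset_span (by simp)
    · refine Submodule.mem_span_pair.2 ⟨-a⁻¹, -(a⁻¹ * b), ?_⟩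
      have : x = -(a • w) - b • z := by
        rw [← sub_eq_zero, ← h]; module
      rw [this]
      match_scalars <;> field_simp <;> ring
  · rw [Submodule.span_le]
    rintro w (rfl | rfl)
    · exact Submodule.subset_span (by simp)
    · refine Submodule.mem_span_pair.2 ⟨-b⁻¹, -(b⁻¹ * a), ?_⟩
      have : x = -(a • y) - b • w := by
        rw [← sub_eq_zero, ← h]; module
      rw [this]
      match_scalars <;> field_simp <;> ring

open Classical in
/-- The points of `A`, other than `i` and `j`, on the line through `q i` and `q j`. -/
noncomputable def thirds {ι : Type*} (q : ι → X) (A : Finset ι) (i j : ι) : Finset ι :=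
  {k ∈ A | k ≠ i ∧ k ≠ j ∧ q k ∈ Submodule.span ℂ {q i, q j}}

theorem mem_thirds {ι : Type*} {q : ι → X} {A : Finset ι} {i j k : ι} :
    k ∈ thirds q A i j ↔ k ∈ A ∧ k ≠ i ∧ k ≠ j ∧ q k ∈ Submodule.span ℂ {q i, q j} := by
  simp [thirds]

theorem thirds_comm {ι : Type*} (q : ι → X) (A : Finset ι) (i j : ι) :
    thirds q A i j = thirds q A j i := by
  ext k
  rw [mem_thirds, mem_thirds, Set.pair_comm]
  tauto

section

variable {ι : Type*} {q : ι → X}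

theorem exists_relation_of_mem_thirds
    (hq : ∀ i j, i ≠ j → LinearIndependent ℂ ![q i, q j]) {A : Finset ι} {i j k : ι}
    (hk : k ∈ thirds q A i j) :
    ∃ a b : ℂ, a ≠ 0 ∧ b ≠ 0 ∧ q i + a • q j + b • q k = 0 := by
  obtain ⟨-, hi, hj, hs⟩ := mem_thirds.1 hk
  exact LinearIndependent.of_mem_span_pair (hq _ _ hi.symm) (hq _ _ hj.symm) hs

theorem span_eq_of_mem_thirds
    (hq : ∀ i j, i ≠ j → LinearIndependent ℂ ![q i, q j]) {A : Finset ι} {i j k : ι}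
    (hk : k ∈ thirds q A i j) :
    Submodule.span ℂ {q i, q j} = Submodule.span ℂ {q i, q k} := by
  obtain ⟨a, b, ha, hb, h⟩ := exists_relation_of_mem_thirds hq hk
  exact span_pair_eq_of_relation ha hb h

theorem mem_thirds_swap
    (hq : ∀ i j, i ≠ j → LinearIndependent ℂ ![q i, q j]) {A : Finset ι} {i j k : ι}
    (hj : j ∈ A) (hij : i ≠ j) (hk : k ∈ thirds q A i j) : j ∈ thirds q A i k := by
  have h := span_eq_of_mem_thirds hq hk
  obtain ⟨-, hi', hj', hs⟩ := mem_thirds.1 hk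
  refine mem_thirds.2 ⟨hj, hij.symm, hj'.symm, ?_⟩
  rw [← h]
  exact Submodule.subset_span (by simp)

theorem card_thirds_eq
    (hq : ∀ i j, i ≠ j → LinearIndependent ℂ ![q i, q j]) {A : Finset ι} {i j k : ι}
    (hj : j ∈ A) (hij : i ≠ j) (hk : k ∈ thirds q A i j) : (thirds q A i j).card = (thirds q A i k).card := by
  classical
  have h := span_eq_of_mem_thirds hq hk
  have hj' := mem_thirds_swap hq hj hij hk
  have : (thirds q A i j).erase k = (thirds q A i k).erase j := by
    ext l
    simp only [Finset.mem_erase, mem_thirds, h]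
    tauto
  rw [← Finset.card_erase_add_one hk, ← Finset.card_erase_add_one hj', this]

end

open Classical in
/-- The points of `A` joined to `i` by a line carrying a third point of `A`. -/
noncomputable def thirdNbrs {ι : Type*} (q : ι → X) (A : Finset ι) (i : ι) : Finset ι :=
  {j ∈ A | j ≠ i ∧ (thirds q A i j).Nonempty}

theorem mem_thirdNbrs {ι : Type*} {q : ι → X} {A : Finset ι} {i j : ι} :
    j ∈ thirdNbrs q A i ↔ j ∈ A ∧ j ≠ i ∧ (thirds q A i j).Nonempty := by
  simp [thirdNbrs]

open Classical in
/-- A Sylvester–Gallai theorem relative to a linear map: points killed by the map need not lie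
on special lines. -/
theorem finrank_span_le_of_thirdNbrs {X' ι : Type*} [AddCommGroup X'] [Module ℂ X'] [Fintype ι]
    {q : ι → X} (hq : ∀ i j, i ≠ j → LinearIndependent ℂ ![q i, q j]) (f : X →ₗ[ℂ] X')
    (A : Finset ι) (d : ℝ) (hd : 0 < d)
    (hdeg : ∀ i ∈ A, f (q i) ≠ 0 → d ≤ (thirdNbrs q A i).card) :
    (finrank ℂ (Submodule.span ℂ ((fun i => f (q i)) '' A)) : ℝ) ≤ 24 * A.card / d := by
  let S : Finset ι := {i ∈ A | f (q i) ≠ 0}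
  have hS : ∀ {i}, i ∈ S ↔ i ∈ A ∧ f (q i) ≠ 0 := fun {i} => Finset.mem_filter
  let R := (i : S) × (j : thirdNbrs q A i) × (thirds q A i j)
  have hrel : ∀ r : R, ∃ ab : ℂ × ℂ,
      q r.1 + ab.1 • q r.2.1 + ab.2 • q r.2.2 = 0 := fun r => by
    obtain ⟨a, b, -, -, h⟩ := exists_relation_of_mem_thirds hq r.2.2.2
    exact ⟨(a, b), h⟩
  choose ab hab using hrel
  let B : R → ι → ℂ := fun r => Pi.single (r.1 : ι) 1 + Pi.single (r.2.1 : ι) (ab r).1 +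
    Pi.single (r.2.2 : ι) (ab r).2
  have hR : ∀ r : R, (r.1 : ι) ∈ A ∧ (r.2.1 : ι) ∈ A ∧ (r.2.2 : ι) ∈ A ∧ (r.2.1 : ι) ≠ r.1 ∧
      (r.2.2 : ι) ≠ r.1 ∧ (r.2.2 : ι) ≠ r.2.1 := fun r => by
    have h1 := mem_thirdNbrs.1 r.2.1.2
    have h2 := mem_thirds.1 r.2.2.2
    exact ⟨(hS.1 r.1.2).1, h1.1, h2.1, h1.2.1, h2.2.1, h2.2.2.1⟩
  have hB0 : ∀ r s, B r s ≠ 0 → s = r.1 ∨ s = r.2.1 ∨ s = r.2.2 := fun r s h => by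
    by_contra! h'
    exact h (by simp [B, h'.1, h'.2.1, h'.2.2])
  let w : R → ℝ := fun r =>
    1 / (((thirds q A r.1 r.2.1).card : ℝ) * (thirdNbrs q A r.1).card)
  have key := finrank_span_le_of_design (fun s : S => f (q s)) (fun r (s : S) => B r s) w
    (fun r => by positivity) (fun r => r.1)
    (fun r => by
      obtain ⟨-, -, -, h1, h2, -⟩ := hR r
      simp [B, h1.symm, h2.symm])
    (fun s => by
      rw [Finset.sum_filter, Fintype.sum_sigma, Finset.sum_eq_single s]
      · rw [Fintype.sum_sigma]
        simp only [if_true, w, Finset.sum_const, Finset.card_univ, Fintype.card_coe, nsmul_eq_mul]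
        have h1 : ∀ j : thirdNbrs q A s, ((thirds q A s j).card : ℝ) *
            (1 / ((thirds q A s j).card * (thirdNbrs q A s).card)) =
            1 / (thirdNbrs q A s).card := fun j => by
          have := (mem_thirdNbrs.1 j.2).2.2.card_pos
          have : ((thirds q A s j).card : ℝ) ≠ 0 := by exact_mod_cast this.ne'
          rw [mul_one_div, ← div_div, div_self this]
        rw [Finset.sum_congr rfl fun j _ => h1 j]
        have h2 := hS.1 s.2
        have h3 : ((thirdNbrs q A s).card : ℝ) ≠ 0 := (hd.trans_le (hdeg s h2.1 h2.2)).ne'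
        simp [h3]
      · intro s' _ h
        simp [h]
      · simp)
    (6 / d) (by positivity)
    (fun s s' hss' => by
      have hss : (s : ι) ≠ s' := fun h => hss' (Subtype.ext h)
      set m := (thirds q A s s').card with hm
      set G := Finset.univ.filter fun r : R => B r s ≠ 0 ∧ B r s' ≠ 0 with hG
      let φ : R → ι × ι × ι := fun r => (r.1, r.2.1, r.2.2)
      have hφ : Function.Injective φ := by
        rintro ⟨⟨i, hi⟩, ⟨j, hj⟩, ⟨k, hk⟩⟩ ⟨⟨i', hi'⟩, ⟨j', hj'⟩, ⟨k', hk'⟩⟩ h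
        simp only [φ, Prod.mk.injEq] at h
        obtain ⟨rfl, rfl, rfl⟩ := h
        rfl
      have hmem : ∀ r ∈ G, (∃ k ∈ thirds q A s s', φ r = (↑s, ↑s', k) ∨ φ r = (↑s', ↑s, k) ∨
          φ r = (↑s, k, ↑s') ∨ φ r = (↑s', k, ↑s) ∨ φ r = (k, ↑s, ↑s') ∨ φ r = (k, ↑s', ↑s)) ∧
          (thirds q A r.1 r.2.1).card = m := fun r hr => by
        obtain ⟨h1, h2⟩ := (Finset.mem_filter.1 hr).2
        obtain ⟨hA1, hA2, hA3, h3, h4, h5⟩ := hR r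
        have hk := r.2.2.2
        have hk1 := mem_thirds_swap hq hA2 h3.symm hk
        have hk' : (r.2.2 : ι) ∈ thirds q A r.2.1 r.1 :=
          (Finset.ext_iff.1 (thirds_comm q A r.1 r.2.1) _).1 hk
        have hk2 := mem_thirds_swap hq hA1 h3 hk'
        have e1 := card_thirds_eq hq hA2 h3.symm hk
        have e2 := card_thirds_eq hq hA1 h3 hk'
        rw [thirds_comm q A r.2.1 r.1] at e2
        rcases hB0 r s h1 with e | e | e <;> rcases hB0 r s' h2 with e' | e' | e' <;>
          first | exact absurd (e.trans e'.symm) hss | skip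
        · exact ⟨⟨r.2.2, by rw [e, e']; exact hk, by simp [φ, e, e']⟩, by rw [hm, e, e']⟩
        · exact ⟨⟨r.2.1, by rw [e, e']; exact hk1, by simp [φ, e, e']⟩, by rw [hm, e, e']; exact e1⟩
        · exact ⟨⟨r.2.2, by rw [e, e']; exact hk', by simp [φ, e, e']⟩,
            by rw [hm, e, e', thirds_comm]⟩
        · exact ⟨⟨r.1, by rw [e, e']; exact hk2, by simp [φ, e, e']⟩, by rw [hm, e, e']; exact e2⟩
        · exact ⟨⟨r.2.1, by rw [e, e', thirds_comm]; exact hk1, by simp [φ, e, e']⟩,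
            by rw [hm, e, e', thirds_comm q A r.2.2]; exact e1⟩
        · exact ⟨⟨r.1, by rw [e, e', thirds_comm]; exact hk2, by simp [φ, e, e']⟩,
            by rw [hm, e, e', thirds_comm q A r.2.2]; exact e2⟩
      have hcard : G.card ≤ 6 * m := by
        let T := thirds q A s s'
        have h1 : G.image φ ⊆ T.image (fun k => ((s : ι), (s' : ι), k)) ∪
            (T.image (fun k => ((s' : ι), (s : ι), k)) ∪
            (T.image (fun k => ((s : ι), k, (s' : ι))) ∪
            (T.image (fun k => ((s' : ι), k, (s : ι))) ∪
            (T.image (fun k => (k, (s : ι), (s' : ι))) ∪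
            T.image (fun k => (k, (s' : ι), (s : ι))))))) := by
          intro p hp
          obtain ⟨r, hr, rfl⟩ := Finset.mem_image.1 hp
          obtain ⟨⟨k, hk, h⟩, -⟩ := hmem r hr
          simp only [Finset.mem_union, Finset.mem_image]
          rcases h with h | h | h | h | h | h <;> rw [h]
          · exact Or.inl ⟨k, hk, rfl⟩
          · exact Or.inr (Or.inl ⟨k, hk, rfl⟩)
          · exact Or.inr (Or.inr (Or.inl ⟨k, hk, rfl⟩))
          · exact Or.inr (Or.inr (Or.inr (Or.inl ⟨k, hk, rfl⟩)))
          · exact Or.inr (Or.inr (Or.inr (Or.inr (Or.inl ⟨k, hk, rfl⟩))))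
          · exact Or.inr (Or.inr (Or.inr (Or.inr (Or.inr ⟨k, hk, rfl⟩))))
        rw [← Finset.card_image_of_injective G hφ]
        refine (Finset.card_le_card h1).trans ?_
        have hI : ∀ g : ι → ι × ι × ι, (T.image g).card ≤ m := fun g => Finset.card_image_le
        refine (Finset.card_union_le _ _).trans ?_
        have := hI
        calc _ ≤ m + (m + (m + (m + (m + m)))) := by
              gcongr
              · exact hI _
              refine (Finset.card_union_le _ _).trans ?_
              gcongr
              · exact hI _
              refine (Finset.card_union_le _ _).trans ?_
              gcongr
              · exact hI _
              refine (Finset.card_union_le _ _).trans ?_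
              gcongr
              · exact hI _
              refine (Finset.card_union_le _ _).trans ?_
              gcongr
              · exact hI _
              · exact hI _
          _ = 6 * m := by ring
      by_cases hm0 : m = 0
      · have : G = ∅ := Finset.card_eq_zero.1 (by omega)
        rw [this, Finset.sum_empty]
        positivity
      have hmpos : (0 : ℝ) < m := by exact_mod_cast Nat.pos_of_ne_zero hm0
      have hw : ∀ r ∈ G, w r ≤ 1 / (m * d) := fun r hr => by
        simp only [w]
        rw [(hmem r hr).2]
        have h2 := hS.1 r.1.2
        exact one_div_le_one_div_of_le (by positivity)
          (mul_le_mul_of_nonneg_left (hdeg _ h2.1 h2.2) hmpos.le)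
      refine (Finset.sum_le_card_nsmul _ _ _ hw).trans ?_
      rw [nsmul_eq_mul]
      have h6 : (G.card : ℝ) ≤ 6 * m := by exact_mod_cast hcard
      calc (G.card : ℝ) * (1 / (m * d)) ≤ 6 * m * (1 / (m * d)) :=
            mul_le_mul_of_nonneg_right h6 (by positivity)
        _ = 6 / d := by field_simp)
    (fun r => by
      have h1 : ∑ s : S, B r s • f (q s) = ∑ s, B r s • f (q s) := by
        rw [Finset.sum_coe_sort S (fun s => B r s • f (q s))]
        refine Finset.sum_subset (Finset.subset_univ _) fun s _ hs => ?_
        by_cases h : B r s = 0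
        · rw [h, zero_smul]
        · obtain ⟨hA1, hA2, hA3, -⟩ := hR r
          have hsA : s ∈ A := by
            rcases hB0 r s h with e | e | e <;> rw [e] <;> assumption
          have : f (q s) = 0 := by
            by_contra h'
            exact hs (hS.2 ⟨hsA, h'⟩)
          rw [this, smul_zero]
      rw [h1]
      have h2 := congrArg f (hab r)
      rw [map_zero] at h2
      rw [← h2]
      simp [B, add_smul, Finset.sum_add_distrib, Pi.single_apply, ite_smul])
  have hspan : Submodule.span ℂ ((fun i => f (q i)) '' A) ≤
      Submodule.span ℂ (Set.range fun s : S => f (q s)) := by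
    rw [Submodule.span_le]
    rintro _ ⟨i, hi, rfl⟩
    by_cases h : f (q i) = 0
    · simp only [h]; exact zero_mem _
    · exact Submodule.subset_span ⟨⟨i, hS.2 ⟨hi, h⟩⟩, rfl⟩
  have : FiniteDimensional ℂ (Submodule.span ℂ (Set.range fun s : S => f (q s))) :=
    FiniteDimensional.span_of_finite ℂ (Set.finite_range _)
  have h1 : (finrank ℂ (Submodule.span ℂ ((fun i => f (q i)) '' A)) : ℝ) ≤
      finrank ℂ (Submodule.span ℂ (Set.range fun s : S => f (q s))) := by
    exact_mod_cast Submodule.finrank_mono hspan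
  refine (h1.trans key).trans ?_
  rw [Fintype.card_coe]
  have h2 : (S.card : ℝ) ≤ A.card := by exact_mod_cast Finset.card_filter_le _ _
  calc 4 * (6 / d) * (S.card : ℝ) ≤ 4 * (6 / d) * A.card :=
        mul_le_mul_of_nonneg_left h2 (by positivity)
    _ = 24 * A.card / d := by ring

end SylvesterGallai

section Averaged

variable {X ι : Type*} [AddCommGroup X] [Module ℂ X] [Fintype ι] {q : ι → X}

open Classical in
/-- The pairs of `T` lying in `A` whose line carries a third point of `A`. -/
noncomputable def specialPairs (q : ι → X) (T : Finset (ι × ι)) (A : Finset ι) :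
    Finset (ι × ι) :=
  {p ∈ T | p.1 ∈ A ∧ p.2 ∈ A ∧ (thirds q A p.1 p.2).Nonempty}

open Classical in
theorem card_specialPairs_le (hq : ∀ i j, i ≠ j → LinearIndependent ℂ ![q i, q j])
    {T : Finset (ι × ι)} (hT : ∀ p ∈ T, p.1 ≠ p.2) (A : Finset ι) {i : ι} (hi : i ∈ A) :
    (specialPairs q T A).card ≤
      (specialPairs q T (A.erase i)).card + 3 * (thirdNbrs q A i).card := by
  let N := thirdNbrs q A i
  let D : Finset (ι × ι) := (specialPairs q T A \ specialPairs q T (A.erase i)).filter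
    fun p => p.1 ≠ i ∧ p.2 ≠ i
  have hD : ∀ p ∈ D, p.1 ∈ A ∧ p.2 ∈ A ∧ p.1 ≠ p.2 ∧ p.1 ≠ i ∧ p.2 ≠ i ∧
      thirds q A p.1 p.2 = {i} := fun p hp => by
    obtain ⟨h1, h2, h3⟩ := Finset.mem_filter.1 hp
    obtain ⟨h4, h5⟩ := Finset.mem_sdiff.1 h1
    obtain ⟨h6, h7, h8, h9⟩ := Finset.mem_filter.1 h4
    refine ⟨h7, h8, hT p h6, h2, h3, Finset.eq_singleton_iff_nonempty_unique_mem.2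
      ⟨h9, fun k hk => ?_⟩⟩
    by_contra hne
    refine h5 (Finset.mem_filter.2 ⟨h6, Finset.mem_erase.2 ⟨h2, h7⟩, Finset.mem_erase.2 ⟨h3, h8⟩,
      k, ?_⟩)
    rw [mem_thirds] at hk ⊢
    exact ⟨Finset.mem_erase.2 ⟨hne, hk.1⟩, hk.2⟩
  have hDN : D.card ≤ N.card := by
    refine Finset.card_le_card_of_injOn (fun p => p.1) (fun p hp => ?_) ?_
    · obtain ⟨h1, h2, h3, h4, h5, h6⟩ := hD p hp
      have hk : i ∈ thirds q A p.1 p.2 := by rw [h6]; simp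
      have := mem_thirds_swap hq h2 h3 hk
      rw [thirds_comm] at this
      exact mem_thirdNbrs.2 ⟨h1, h4, p.2, this⟩
    · rintro ⟨a, b⟩ hp ⟨a', b'⟩ hp' h
      dsimp only at h
      subst h
      obtain ⟨h1, h2, h3, h4, h5, h6⟩ := hD _ hp
      obtain ⟨k1, k2, k3, k4, k5, k6⟩ := hD _ hp'
      dsimp only at *
      have e1 := span_eq_of_mem_thirds hq (A := A) (i := a) (j := b) (k := i) (by rw [h6]; simp)
      have e2 := span_eq_of_mem_thirds hq (A := A) (i := a) (j := b') (k := i) (by rw [k6]; simp)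
      by_contra hne
      have hbb : b' ≠ b := fun h => hne (by rw [h])
      have : b' ∈ thirds q A a b := mem_thirds.2 ⟨k2, k3.symm, hbb, by
        rw [e1, ← e2]; exact Submodule.subset_span (by simp)⟩
      rw [h6] at this
      exact k5 (by simpa using this)
  have hsub : specialPairs q T A ⊆ specialPairs q T (A.erase i) ∪
      (N.image (fun j => (i, j)) ∪ (N.image (fun j => (j, i)) ∪ D)) := by
    intro p hp
    obtain ⟨h6, h7, h8, h9⟩ := Finset.mem_filter.1 hp
    by_cases hp' : p ∈ specialPairs q T (A.erase i)
    · exact Finset.mem_union_left _ hp'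
    refine Finset.mem_union_right _ ?_
    by_cases h1 : p.1 = i
    · refine Finset.mem_union_left _ (Finset.mem_image.2 ⟨p.2, ?_, by rw [← h1]⟩)
      exact mem_thirdNbrs.2 ⟨h8, by rw [← h1]; exact (hT p h6).symm, by rw [← h1]; exact h9⟩
    refine Finset.mem_union_right _ ?_
    by_cases h2 : p.2 = i
    · refine Finset.mem_union_left _ (Finset.mem_image.2 ⟨p.1, ?_, by rw [← h2]⟩)
      exact mem_thirdNbrs.2 ⟨h7, h1, by rw [← h2, thirds_comm]; exact h9⟩
    exact Finset.mem_union_right _ (Finset.mem_filter.2 ⟨Finset.mem_sdiff.2 ⟨hp, hp'⟩, h1, h2⟩)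
  have h1 := Finset.card_le_card hsub
  have h2 := Finset.card_union_le (specialPairs q T (A.erase i))
    (N.image (fun j => (i, j)) ∪ (N.image (fun j => (j, i)) ∪ D))
  have h3 := Finset.card_union_le (N.image (fun j => (i, j))) (N.image (fun j => (j, i)) ∪ D)
  have h4 := Finset.card_union_le (N.image (fun j => (j, i))) D
  have h5 : (N.image (fun j => (i, j))).card ≤ N.card := Finset.card_image_le
  have h6 : (N.image (fun j => (j, i))).card ≤ N.card := Finset.card_image_le
  change _ ≤ _ + 3 * N.card
  omega

open Classical in
/-- If a positive proportion of the pairs in `K` span a line with a third point, then a positive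
proportion of `K` lies in a space of bounded dimension. -/
theorem exists_finrank_span_le_of_special_pairs
    (hq : ∀ i j, i ≠ j → LinearIndependent ℂ ![q i, q j])
    (K : Finset ι) (T : Finset (ι × ι)) (hTK : T ⊆ K ×ˢ K)
    (hT : ∀ p ∈ T, p.1 ≠ p.2 ∧ ∃ k, k ≠ p.1 ∧ k ≠ p.2 ∧ q k ∈ Submodule.span ℂ {q p.1, q p.2})
    (M η : ℝ) (hM : Fintype.card ι ≤ M) (hM0 : 0 < M) (hη : 0 < η) (hcard : η * M ^ 2 ≤ T.card) :
    ∃ A : Finset ι, (finrank ℂ (Submodule.span ℂ (q '' A)) : ℝ) ≤ 144 / η ∧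
      η * M / 2 ≤ (K ∩ A).card := by
  let Φ : Finset ι → ℝ := fun A => (specialPairs q T A).card - η * M / 2 * A.card
  obtain ⟨A, hA⟩ := Finite.exists_max Φ
  refine ⟨A, ?_, ?_⟩
  · have hdeg : ∀ i ∈ A, η * M / 6 ≤ (thirdNbrs q A i).card := fun i hi => by
      have h1 := hA (A.erase i)
      have h2 := card_specialPairs_le hq (fun p hp => (hT p hp).1) A hi
      have h2' : ((specialPairs q T A).card : ℝ) ≤
          (specialPairs q T (A.erase i)).card + 3 * (thirdNbrs q A i).card := by exact_mod_cast h2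
      have h3 : ((A.erase i).card : ℝ) + 1 = A.card := by
        exact_mod_cast Finset.card_erase_add_one hi
      simp only [Φ] at h1
      rw [← h3] at h1
      nlinarith
    have h1 := finrank_span_le_of_thirdNbrs hq LinearMap.id A (η * M / 6) (by positivity)
      (fun i hi _ => hdeg i hi)
    refine h1.trans ?_
    have h2 : (A.card : ℝ) ≤ M := le_trans (by exact_mod_cast Finset.card_le_univ A) hM
    rw [div_le_div_iff₀ (by positivity) hη]
    nlinarith
  · have h1 := hA Finset.univ
    have h2 : specialPairs q T Finset.univ = T := by
      refine Finset.filter_true_of_mem fun p hp => ⟨Finset.mem_univ _, Finset.mem_univ _, ?_⟩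
      obtain ⟨-, k, hk1, hk2, hk3⟩ := hT p hp
      exact ⟨k, mem_thirds.2 ⟨Finset.mem_univ _, hk1, hk2, hk3⟩⟩
    simp only [Φ, h2, Finset.card_univ] at h1
    have h3 : specialPairs q T A ⊆ (K ∩ A) ×ˢ (Finset.univ : Finset ι) := fun p hp => by
      obtain ⟨h6, h7, h8, h9⟩ := Finset.mem_filter.1 hp
      exact Finset.mem_product.2 ⟨Finset.mem_inter.2 ⟨(Finset.mem_product.1 (hTK h6)).1, h7⟩,
        Finset.mem_univ _⟩
    have h4 := Finset.card_le_card h3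
    rw [Finset.card_product, Finset.card_univ] at h4
    have h5 : ((specialPairs q T A).card : ℝ) ≤ (K ∩ A).card * Fintype.card ι := by
      exact_mod_cast h4
    have h6 : ((K ∩ A).card : ℝ) * Fintype.card ι ≤ (K ∩ A).card * M :=
      mul_le_mul_of_nonneg_left hM (Nat.cast_nonneg _)
    have h7 : η * M / 2 * Fintype.card ι ≤ η * M / 2 * M :=
      mul_le_mul_of_nonneg_left hM (by positivity)
    have h8 : 0 ≤ η * M / 2 * A.card := by positivity
    have h9 : η * M / 2 * M ≤ (K ∩ A).card * M := by nlinarith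
    exact le_of_mul_le_mul_right h9 hM0

/-- The Sylvester–Gallai theorem over `ℂ` for vectors up to proportionality. -/
theorem finrank_span_le_of_third_vector (v : ι → X) (hv : ∀ i, v i ≠ 0)
    (h : ∀ i j, LinearIndependent ℂ ![v i, v j] → ∃ k, v k ∈ Submodule.span ℂ {v i, v j} ∧
      LinearIndependent ℂ ![v i, v k] ∧ LinearIndependent ℂ ![v j, v k]) :
    finrank ℂ (Submodule.span ℂ (Set.range v)) ≤ 49 := by
  classical
  have hpar : ∀ i j, LinearIndependent ℂ ![v i, v j] ↔ ∀ a : ℂ, a • v i ≠ v j := fun i j =>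
    LinearIndependent.pair_iff' (hv i)
  let s : Setoid ι :=
    { r := fun i j => ∃ a : ℂ, a • v i = v j
      iseqv := ⟨fun i => ⟨1, one_smul _ _⟩, by
        rintro i j ⟨a, ha⟩
        have ha0 : a ≠ 0 := by rintro rfl; exact hv j (by rw [← ha, zero_smul])
        exact ⟨a⁻¹, by rw [← ha, smul_smul, inv_mul_cancel₀ ha0, one_smul]⟩, by
        rintro i j k ⟨a, ha⟩ ⟨b, hb⟩
        exact ⟨b * a, by rw [← hb, ← ha, smul_smul]⟩⟩ }
  let κ := Quotient s
  let q : κ → X := fun c => v c.out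
  have : Fintype κ := Fintype.ofFinite _
  have hq : ∀ c c', c ≠ c' → LinearIndependent ℂ ![q c, q c'] := fun c c' hne => by
    rw [hpar]
    intro a ha
    apply hne
    rw [← c.out_eq, ← c'.out_eq]
    exact Quotient.sound ⟨a, ha⟩
  have hout : ∀ i, ∃ a : ℂ, a • q ⟦i⟧ = v i := fun i => Quotient.exact (Quotient.out_eq ⟦i⟧)
  have hspan : Submodule.span ℂ (Set.range v) ≤ Submodule.span ℂ (q '' (Finset.univ : Finset κ)) := by
    rw [Submodule.span_le]
    rintro _ ⟨i, rfl⟩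
    obtain ⟨a, ha⟩ := hout i
    rw [SetLike.mem_coe, ← ha]
    exact Submodule.smul_mem _ _ (Submodule.subset_span ⟨_, by simp, rfl⟩)
  have : FiniteDimensional ℂ (Submodule.span ℂ (q '' (Finset.univ : Finset κ))) :=
    FiniteDimensional.span_of_finite ℂ (Set.toFinite _)
  refine (Submodule.finrank_mono hspan).trans ?_
  by_cases hκ : Fintype.card κ ≤ 1
  · refine (finrank_span_le_card (R := ℂ) (q '' (Finset.univ : Finset κ))).trans ?_
    rw [Set.toFinset_card]
    refine le_trans (b := Fintype.card κ) ?_ (by omega)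
    rw [← Set.toFinset_card]
    simpa using Finset.card_image_le (s := (Finset.univ : Finset κ)) (f := q)
  have hdeg : ∀ c : κ, ((Fintype.card κ : ℝ) - 1) ≤ (thirdNbrs q Finset.univ c).card := fun c => by
    have : thirdNbrs q Finset.univ c = Finset.univ.erase c := by
      ext c'
      rw [mem_thirdNbrs]
      simp only [Finset.mem_univ, true_and, Finset.mem_erase, and_true, and_iff_left_iff_imp]
      intro hne
      obtain ⟨k, hk, h1, h2⟩ := h _ _ (hq c c' hne.symm)
      obtain ⟨a, ha⟩ := hout k
      have ha0 : a ≠ 0 := by rintro rfl; exact hv k (by rw [← ha, zero_smul])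
      rw [← ha] at h1 h2 hk
      have hne' : ∀ c0 : κ, LinearIndependent ℂ ![q c0, a • q ⟦k⟧] → ⟦k⟧ ≠ c0 := by
        rintro _ hli rfl
        rw [LinearIndependent.pair_iff] at hli
        have := (hli a (-1) (by module)).2
        simp at this
      refine ⟨⟦k⟧, mem_thirds.2 ⟨Finset.mem_univ _, hne' _ h1, hne' _ h2, ?_⟩⟩
      have := Submodule.smul_mem _ a⁻¹ hk
      rwa [smul_smul, inv_mul_cancel₀ ha0, one_smul] at this
    rw [this, Finset.card_erase_of_mem (Finset.mem_univ _), Finset.card_univ]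
    push_cast [Nat.cast_sub (show 1 ≤ Fintype.card κ by omega)]
    exact le_rfl
  have h2 : (2 : ℝ) ≤ Fintype.card κ := by exact_mod_cast (by omega : 2 ≤ Fintype.card κ)
  have key := finrank_span_le_of_thirdNbrs hq LinearMap.id Finset.univ _
    (by linarith : (0 : ℝ) < (Fintype.card κ : ℝ) - 1) (fun c _ _ => hdeg c)
  have h3 : 24 * ((Finset.univ : Finset κ).card : ℝ) / ((Fintype.card κ : ℝ) - 1) ≤ 49 := by
    rw [div_le_iff₀ (by linarith), Finset.card_univ]
    linarith
  exact_mod_cast key.trans h3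

end Averaged

section Radical

variable {E : Type*} [AddCommGroup E] [Module ℂ E]

/-- The radical of the polar form. -/
def QuadraticForm.rad (q : QuadraticForm ℂ E) : Submodule ℂ E := LinearMap.ker q.polarBilin

theorem QuadraticForm.polarBilin_of_mem_rad {q : QuadraticForm ℂ E} {x : E} (hx : x ∈ q.rad)
    (y : E) : q.polarBilin x y = 0 := by
  rw [LinearMap.mem_ker.1 hx]; rfl

theorem QuadraticForm.mem_rad {q : QuadraticForm ℂ E} {x : E} :
    x ∈ q.rad ↔ ∀ y, q.polarBilin x y = 0 :=
  ⟨fun h y => q.polarBilin_of_mem_rad h y, fun h => LinearMap.ext h⟩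

theorem QuadraticForm.apply_of_mem_rad {q : QuadraticForm ℂ E} {x : E} (hx : x ∈ q.rad) :
    q x = 0 := by
  have h1 := q.polarBilin_self' x
  rw [q.polarBilin_of_mem_rad hx] at h1
  linear_combination -(1 / 2 : ℂ) * h1

theorem QuadraticForm.map_add_of_mem_rad {q : QuadraticForm ℂ E} {x : E} (hx : x ∈ q.rad)
    (y : E) : q (x + y) = q y := by
  rw [q.map_add', q.apply_of_mem_rad hx, q.polarBilin_of_mem_rad hx]
  ring

theorem QuadraticForm.rad_le_smul (c : ℂ) (q : QuadraticForm ℂ E) : q.rad ≤ (c • q).rad :=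
  fun x hx => QuadraticForm.mem_rad.2 fun y => by
    rw [QuadraticForm.polarBilin_smul', LinearMap.smul_apply, LinearMap.smul_apply,
      QuadraticForm.polarBilin_of_mem_rad hx, smul_zero]

theorem QuadraticForm.rad_inf_le_add (q r : QuadraticForm ℂ E) : q.rad ⊓ r.rad ≤ (q + r).rad :=
  fun x hx => QuadraticForm.mem_rad.2 fun y => by
    rw [QuadraticForm.polarBilin_add', LinearMap.add_apply, LinearMap.add_apply,
      QuadraticForm.polarBilin_of_mem_rad hx.1, QuadraticForm.polarBilin_of_mem_rad hx.2, add_zero]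

theorem QuadraticForm.mem_rad_of_forall_add {q : QuadraticForm ℂ E} {x : E}
    (h : ∀ y, q (x + y) = q y) : x ∈ q.rad := by
  refine QuadraticForm.mem_rad.2 fun y => ?_
  have h1 := h y
  have h2 := h 0
  rw [add_zero, map_zero] at h2
  rw [q.map_add', h2] at h1
  linear_combination h1

theorem IsProd.ker_inf_ker_le_rad {q : QuadraticForm ℂ E} {c d : Dual ℂ E}
    (h : ∀ x, q x = c x * d x) : LinearMap.ker c ⊓ LinearMap.ker d ≤ q.rad := fun x hx => by
  have h1 : c x = 0 := hx.1
  have h2 : d x = 0 := hx.2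
  refine QuadraticForm.mem_rad_of_forall_add fun y => ?_
  rw [h, h, map_add, map_add, h1, h2]; ring

theorem IsProd.smul {q : QuadraticForm ℂ E} (h : IsProd q) (c : ℂ) : IsProd (c • q) := by
  obtain ⟨a, b, h⟩ := h
  exact ⟨c • a, b, fun x => by simp [smul_apply, h, mul_assoc]⟩

theorem not_isProd_smul {q : QuadraticForm ℂ E} (h : ¬ IsProd q) {c : ℂ} (hc : c ≠ 0) :
    ¬ IsProd (c • q) := fun h' => h (by
  have := h'.smul c⁻¹
  rwa [smul_smul, inv_mul_cancel₀ hc, one_smul] at this)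

/-- The square of a linear form as a quadratic form. -/
noncomputable def dualSq (e : Dual ℂ E) : QuadraticForm ℂ E := QuadraticMap.linMulLin e e

@[simp] theorem dualSq_apply (e : Dual ℂ E) (x : E) : dualSq e x = e x ^ 2 := by
  simp [dualSq, sq]

theorem polarBilin_dualSq (e : Dual ℂ E) (x y : E) :
    (dualSq e).polarBilin x y = 2 * (e x * e y) := by
  rw [QuadraticMap.polarBilin_apply_apply]
  simp only [QuadraticMap.polar, dualSq_apply, map_add]
  ring

theorem ker_le_rad_dualSq (e : Dual ℂ E) : LinearMap.ker e ≤ (dualSq e).rad := fun x hx =>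
  QuadraticForm.mem_rad.2 fun y => by
    rw [polarBilin_dualSq, LinearMap.mem_ker.1 hx]; ring

/-- A product form splits off the square of the polar at an anisotropic vector. -/
theorem IsProd.eq_sq_add_sq {h : QuadraticForm ℂ E} (hh : IsProd h) {x : E} (hx : h x ≠ 0) :
    ∃ (k : ℂ) (e : Dual ℂ E), ∀ z, h z = h.polarBilin x z ^ 2 / (4 * h x) + k * e z ^ 2 := by
  obtain ⟨c, d, hcd⟩ := hh
  have hB : ∀ z, h.polarBilin x z = c x * d z + d x * c z := fun z => by
    have := h.map_add' x z
    rw [hcd, hcd, hcd, map_add, map_add] at this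
    linear_combination -this
  rw [hcd] at hx
  have hc : c x ≠ 0 := left_ne_zero_of_mul hx
  have hd : d x ≠ 0 := right_ne_zero_of_mul hx
  refine ⟨-1 / (4 * (c x * d x)), c x • d - d x • c, fun z => ?_⟩
  rw [hB, hcd, hcd]
  simp only [LinearMap.sub_apply, LinearMap.smul_apply, smul_eq_mul]
  field_simp
  ring

theorem IsProd.eq_sq_add_sq_of_orthogonal {h : QuadraticForm ℂ E} (hh : IsProd h) {x y : E}
    (hx : h x ≠ 0) (hy : h y ≠ 0) (hxy : h.polarBilin x y = 0) (z : E) :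
    h z = h.polarBilin x z ^ 2 / (4 * h x) + h.polarBilin y z ^ 2 / (4 * h y) := by
  obtain ⟨c, d, hcd⟩ := hh
  have hB : ∀ x z, h.polarBilin x z = c x * d z + d x * c z := fun x z => by
    have := h.map_add' x z
    rw [hcd, hcd, hcd, map_add, map_add] at this
    linear_combination -this
  rw [hcd] at hx hy
  have hc : c x ≠ 0 := left_ne_zero_of_mul hx
  have hd : d x ≠ 0 := right_ne_zero_of_mul hx
  have hc' : c y ≠ 0 := left_ne_zero_of_mul hy
  have hd' : d y ≠ 0 := right_ne_zero_of_mul hy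
  rw [hB] at hxy
  rw [hB, hB, hcd x, hcd y, hcd z]
  field_simp
  linear_combination (-(c x * c y * d z ^ 2) - d x * d y * c z ^ 2) * hxy

/-- Adding a multiple of the square of a linear form outside the support to get a product is only
possible for (scaled) squares. -/
theorem eq_sq_of_isProd_sub {D h : QuadraticForm ℂ E} {k : ℂ} {e : Dual ℂ E} (hk : k ≠ 0)
    (hh : IsProd h) (hD : ∀ z, D z = k * e z ^ 2 + h z) {x : E} (hx : x ∈ D.rad) (hex : e x ≠ 0) :
    ∃ (k' : ℂ) (e' : Dual ℂ E), ∀ z, D z = k' * e' z ^ 2 := by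
  have h0 : h x = -(k * e x ^ 2) := by
    have := hD x
    rw [D.apply_of_mem_rad hx] at this
    linear_combination -this
  have hB : ∀ z, h.polarBilin x z = -(2 * k * e x * e z) := fun z => by
    have h1 := hD (x + z)
    rw [D.map_add_of_mem_rad hx, hD z, h.map_add', map_add, h0] at h1
    linear_combination -h1
  obtain ⟨k', e', h'⟩ := hh.eq_sq_add_sq (x := x) (by rw [h0]; simp [hk, hex])
  refine ⟨k', e', fun z => ?_⟩
  rw [hD, h' z, hB, h0]
  field_simp
  ring

/-- Orthogonalisation against one or two anisotropic vectors. -/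
theorem exists_three_orthogonal {q : QuadraticForm ℂ E} (hq : ¬ IsProd q) :
    ∃ x y z : E, q x ≠ 0 ∧ q y ≠ 0 ∧ q z ≠ 0 ∧ q.polarBilin x y = 0 ∧ q.polarBilin x z = 0 ∧
      q.polarBilin y z = 0 := by
  have h1 : ∃ x, q x ≠ 0 := by
    by_contra! h
    exact hq ⟨0, 0, fun x => by simp [h]⟩
  obtain ⟨x, hx⟩ := h1
  have h2 : ∃ y, q y - q.polarBilin x y ^ 2 / (4 * q x) ≠ 0 := by
    by_contra! h
    exact hq (IsProd.of_eq_smul_sq (c := 1 / (4 * q x)) (a := q.polarBilin x) fun y => by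
      linear_combination h y)
  obtain ⟨y', hy'⟩ := h2
  obtain ⟨y, hyx, hy⟩ : ∃ y, q.polarBilin x y = 0 ∧ q y ≠ 0 := by
    refine ⟨y' - (q.polarBilin x y' / (2 * q x)) • x, ?_, ?_⟩
    · rw [map_sub, map_smul, q.polarBilin_self', smul_eq_mul]
      field_simp
      ring
    · rw [q.map_sub_smul, q.polarBilin_symm y' x]
      convert hy' using 1
      field_simp
      ring
  have h3 : ∃ z, q z - q.polarBilin x z ^ 2 / (4 * q x) - q.polarBilin y z ^ 2 / (4 * q y) ≠ 0 := by
    by_contra! h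
    exact hq (isProd_of_binary (a := q.polarBilin x) (l := q.polarBilin y) (r := 1 / (4 * q x))
      (s := 0) (t := 1 / (4 * q y)) fun y => by linear_combination h y)
  obtain ⟨z', hz'⟩ := h3
  have hxy := q.polarBilin_symm x y
  refine ⟨x, y, z' - (q.polarBilin x z' / (2 * q x)) • x - (q.polarBilin y z' / (2 * q y)) • y,
    hx, hy, ?_, hyx, ?_, ?_⟩
  · rw [q.map_sub_smul, q.map_sub_smul, LinearMap.map_sub₂, LinearMap.map_smul₂, hyx,
      q.polarBilin_symm z' x, q.polarBilin_symm z' y]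
    convert hz' using 1
    simp only [smul_zero, sub_zero]
    field_simp
    ring
  · rw [map_sub, map_sub, map_smul, map_smul, q.polarBilin_self', hyx, smul_eq_mul, smul_eq_mul]
    field_simp
    ring
  · rw [map_sub, map_sub, map_smul, map_smul, q.polarBilin_self', ← hxy, hyx, smul_eq_mul,
      smul_eq_mul]
    field_simp
    ring

/-- A pencil through a non-product form contains at most three products. -/
theorem exists_finset_of_isProd_sub {A B : QuadraticForm ℂ E} (hB : ¬ IsProd B) :
    ∃ R : Finset ℂ, R.card ≤ 3 ∧ ∀ μ : ℂ, IsProd (A - μ • B) → μ ∈ R := by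
  obtain ⟨x, y, z, hx, hy, hz, hxy, hxz, hyz⟩ := exists_three_orthogonal hB
  let v : Fin 3 → E := ![x, y, z]
  have hv : ∀ i, B (v i) ≠ 0 := by
    intro i; fin_cases i <;> assumption
  have hyx := (B.polarBilin_symm y x).trans hxy
  have hzx := (B.polarBilin_symm z x).trans hxz
  have hzy := (B.polarBilin_symm z y).trans hyz
  have hort : ∀ i j, B.polarBilin (v i) (v j) = if i = j then 2 * B (v i) else 0 := by
    intro i j
    have hs := B.polarBilin_self'
    fin_cases i <;> fin_cases j <;>
      simp only [v, Fin.zero_eta, Fin.mk_one, Fin.reduceFinMk, Matrix.cons_val, Fin.isValue] <;>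
      simp [-QuadraticMap.polarBilin_apply_apply, *]
  let G : Matrix (Fin 3) (Fin 3) ℂ := Matrix.of fun i j => A.polarBilin (v i) (v j) / (2 * B (v i))
  refine ⟨G.charpoly.roots.toFinset, ?_, fun μ ⟨c, d, hcd⟩ => ?_⟩
  · refine (Multiset.toFinset_card_le _).trans ((Polynomial.card_roots' _).trans ?_)
    rw [Matrix.charpoly_natDegree_eq_dim]; simp
  · have hC : ∀ x z, A.polarBilin x z - μ * B.polarBilin x z = c x * d z + d x * c z :=
      fun x z => by
      have h1 := (A - μ • B).map_add' x z
      rw [hcd, hcd, hcd, map_add, map_add, QuadraticForm.polarBilin_sub',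
        QuadraticForm.polarBilin_smul'] at h1
      simp only [LinearMap.sub_apply, LinearMap.smul_apply, smul_eq_mul] at h1
      linear_combination -h1
    rw [Multiset.mem_toFinset, Polynomial.mem_roots G.charpoly_monic.ne_zero,
      Polynomial.IsRoot.def, Matrix.eval_charpoly]
    have hG : Matrix.scalar (Fin 3) μ - G = Matrix.of fun i j =>
        -(1 / (2 * B (v i))) * (c (v i) * d (v j) + d (v i) * c (v j)) := by
      ext i j
      have h1 := hC (v i) (v j)
      rw [hort] at h1
      have := hv i
      simp only [Matrix.sub_apply, Matrix.scalar_apply, Matrix.diagonal_apply, G, Matrix.of_apply]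
      rw [← h1]
      split_ifs <;> field_simp <;> ring
    rw [hG, Matrix.det_fin_three]
    simp only [Matrix.of_apply]
    ring

end Radical

section Fiber

variable {E : Type*} [AddCommGroup E] [Module ℂ E] [FiniteDimensional ℂ E]

/-- At most two directions of linear forms divide a nonzero quadratic form. -/
theorem not_three_dvd {D : QuadraticForm ℂ E} (hD : ∃ x, D x ≠ 0) {a b c : Dual ℂ E}
    (hab : LinearIndependent ℂ ![a, b]) (hac : LinearIndependent ℂ ![a, c])
    (hbc : LinearIndependent ℂ ![b, c]) (ha : ∃ g : Dual ℂ E, ∀ x, D x = a x * g x)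
    (hb : ∃ g : Dual ℂ E, ∀ x, D x = b x * g x) (hc : ∃ g : Dual ℂ E, ∀ x, D x = c x * g x) :
    False := by
  obtain ⟨g, hg⟩ := ha
  have hpar : ∀ b : Dual ℂ E, LinearIndependent ℂ ![a, b] →
      (∃ g : Dual ℂ E, ∀ x, D x = b x * g x) → ∃ k : ℂ, g = k • b := by
    rintro b hab ⟨g', hg'⟩
    rcases Submodule.mul_eq_zero_on (LinearMap.ker b) (PolyFun.dual a) (PolyFun.dual g)
      (fun x hx => by rw [← hg, hg', LinearMap.mem_ker.1 hx, zero_mul]) with h | h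
    · obtain ⟨k, hk⟩ := Dual.eq_smul_of_ker (a := b) (b := a) h
      rw [LinearIndependent.pair_iff] at hab
      have := (hab 1 (-k) (by rw [hk]; module)).1
      simp at this
    · exact Dual.eq_smul_of_ker h
  obtain ⟨k, hk⟩ := hpar b hab hb
  obtain ⟨k', hk'⟩ := hpar c hac hc
  rw [LinearIndependent.pair_iff] at hbc
  have h0 := (hbc k (-k') (by rw [← hk, neg_smul, ← hk']; simp)).1
  obtain ⟨x, hx⟩ := hD
  exact hx (by rw [hg, hk, h0]; simp)

/-- The number of directions of linear forms modulo which two given forms are proportional. -/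
theorem card_le_six_of_fiber {κ : Type*} {A B : QuadraticForm ℂ E} (hB : ¬ IsProd B)
    (hAB : ∀ c : ℂ, A ≠ c • B) (S : Finset κ) (f : κ → Dual ℂ E)
    (hf : ∀ i ∈ S, ∀ j ∈ S, i ≠ j → LinearIndependent ℂ ![f i, f j])
    (h : ∀ i ∈ S, ∃ (μ : ℂ) (g : Dual ℂ E), ∀ x, A x = μ * B x + f i x * g x) : S.card ≤ 6 := by
  classical
  obtain ⟨R, hR, hmem⟩ := exists_finset_of_isProd_sub (A := A) hB
  have h' : ∀ i, ∃ μ : ℂ, i ∈ S → ∃ g : Dual ℂ E, ∀ x, A x = μ * B x + f i x * g x := fun i => by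
    by_cases hi : i ∈ S
    · obtain ⟨μ, hμ⟩ := h i hi
      exact ⟨μ, fun _ => hμ⟩
    · exact ⟨0, fun h => absurd h hi⟩
  choose μ hμ using h'
  have h1 := Finset.card_le_mul_card_image_of_maps_to (s := S) (t := R) (f := μ) (fun i hi => by
    obtain ⟨g, hg⟩ := hμ i hi
    exact hmem _ ⟨f i, g, fun x => by
      simp only [sub_apply, smul_apply, smul_eq_mul]; rw [hg]; ring⟩) 2 (fun r _ => by
    by_contra! hlt
    obtain ⟨i, hi, j, hj, k, hk, hij, hik, hjk⟩ := Finset.two_lt_card.1 hlt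
    rw [Finset.mem_filter] at hi hj hk
    have hD : ∃ x, (A - r • B) x ≠ 0 := by
      by_contra! hD
      exact hAB r (QuadraticForm.ext_iff'.2 fun x => by
        have := hD x
        rw [sub_apply] at this
        linear_combination this)
    have hd : ∀ i, i ∈ S ∧ μ i = r → ∃ g : Dual ℂ E, ∀ x, (A - r • B) x = f i x * g x := by
      rintro l ⟨hl, hr⟩
      obtain ⟨g, hg⟩ := hμ l hl
      exact ⟨g, fun x => by simp only [sub_apply, smul_apply, smul_eq_mul]; rw [hg, hr]; ring⟩
    exact not_three_dvd hD (hf i hi.1 j hj.1 hij) (hf i hi.1 k hk.1 hik) (hf j hj.1 k hk.1 hjk)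
      (hd i hi) (hd j hj) (hd k hk))
  omega

end Fiber

section Codim

variable {E : Type*} [AddCommGroup E] [Module ℂ E] [FiniteDimensional ℂ E]

/-- The subspace `N` has codimension at most `C`. -/
def CodimLE (N : Submodule ℂ E) (C : ℕ) : Prop := finrank ℂ E ≤ finrank ℂ N + C

theorem CodimLE.mono {N N' : Submodule ℂ E} {C C' : ℕ} (h : CodimLE N C) (hN : N ≤ N')
    (hC : C ≤ C') : CodimLE N' C' := by
  have h1 := Submodule.finrank_mono hN
  unfold CodimLE at *
  omega

theorem CodimLE.inf {N N' : Submodule ℂ E} {C C' : ℕ} (h : CodimLE N C) (h' : CodimLE N' C') :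
    CodimLE (N ⊓ N') (C + C') := by
  have h1 := Submodule.finrank_sup_add_finrank_inf_eq N N'
  have h2 := Submodule.finrank_le (N ⊔ N')
  unfold CodimLE at *
  omega

theorem codimLE_ker (l : Dual ℂ E) : CodimLE (LinearMap.ker l) 1 := by
  have h1 : finrank ℂ (LinearMap.range l) + finrank ℂ (LinearMap.ker l) = finrank ℂ E :=
    LinearMap.finrank_range_add_finrank_ker l
  have h2 : finrank ℂ (LinearMap.range l) ≤ 1 := by
    have := Submodule.finrank_le (LinearMap.range l)
    rwa [finrank_self] at this
  unfold CodimLE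
  omega

theorem codimLE_top : CodimLE (⊤ : Submodule ℂ E) 0 := by
  unfold CodimLE
  rw [finrank_top]; omega

theorem IsProd.codimLE_rad {q : QuadraticForm ℂ E} (h : IsProd q) : CodimLE q.rad 2 := by
  obtain ⟨c, d, h⟩ := h
  exact ((codimLE_ker c).inf (codimLE_ker d)).mono (IsProd.ker_inf_ker_le_rad h) le_rfl

/-- The common kernel of finitely spanned linear forms. -/
theorem codimLE_dualCoannihilator (U : Submodule ℂ (Dual ℂ E)) :
    CodimLE U.dualCoannihilator (finrank ℂ U) := by
  have := Subspace.finrank_add_finrank_dualCoannihilator_eq U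
  unfold CodimLE
  omega

/-- The quadratic forms vanishing on a subspace. -/
def vanSub (N : Submodule ℂ E) : Submodule ℂ (QuadraticForm ℂ E) where
  carrier := {q | ∀ x ∈ N, q x = 0}
  zero_mem' := fun x _ => rfl
  add_mem' := fun {a b} ha hb x hx => by rw [add_apply, ha x hx, hb x hx, add_zero]
  smul_mem' := fun c a ha x hx => by rw [smul_apply, ha x hx, smul_zero]

theorem mem_vanSub {N : Submodule ℂ E} {q : QuadraticForm ℂ E} :
    q ∈ vanSub N ↔ ∀ x ∈ N, q x = 0 := Iff.rfl

theorem vanSub_mono {N N' : Submodule ℂ E} (h : N ≤ N') : vanSub N' ≤ vanSub N :=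
  fun _ hq x hx => hq x (h hx)

end Codim

section Irr

variable {E : Type*} [AddCommGroup E] [Module ℂ E]

/-- The form `q` is not a product on the kernel of `l`. -/
def IrrOn (q : QuadraticForm ℂ E) (l : Dual ℂ E) : Prop :=
  ¬ IsProd (q.comp (LinearMap.ker l).subtype)

theorem IrrOn.of_forall {q : QuadraticForm ℂ E} {l : Dual ℂ E}
    (h : ∀ c d : Dual ℂ E, ¬ ∀ x, l x = 0 → q x = c x * d x) : IrrOn q l := by
  rintro ⟨c, d, hcd⟩
  obtain ⟨c', hc⟩ := exists_dual_extend _ c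
  obtain ⟨d', hd⟩ := exists_dual_extend _ d
  exact h c' d' fun x hx => by
    have := hcd ⟨x, hx⟩
    rw [← hc, ← hd] at this
    simpa using this

theorem IrrOn.not_forall {q : QuadraticForm ℂ E} {l : Dual ℂ E} (h : IrrOn q l)
    (c d : Dual ℂ E) : ¬ ∀ x, l x = 0 → q x = c x * d x := fun hcd =>
  h ⟨c.domRestrict _, d.domRestrict _, fun x => hcd x x.2⟩

theorem IrrOn.of_mem_rad {q : QuadraticForm ℂ E} (hq : ¬ IsProd q) {l : Dual ℂ E} {x : E}
    (hx : x ∈ q.rad) (hl : l x ≠ 0) : IrrOn q l := by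
  refine IrrOn.of_forall fun c d hcd => hq ⟨c - (c x / l x) • l, d - (d x / l x) • l, fun y => ?_⟩
  have h1 := hcd (-(l y / l x) • x + y) (by simp [hl])
  rw [QuadraticForm.map_add_of_mem_rad (Submodule.smul_mem _ _ hx)] at h1
  rw [h1]
  simp only [map_add, map_smul, LinearMap.sub_apply, LinearMap.smul_apply, smul_eq_mul]
  ring

variable [FiniteDimensional ℂ E]

theorem IrrOn.of_codim {q : QuadraticForm ℂ E} (hq : ¬ CodimLE q.rad 4) (l : Dual ℂ E) :
    IrrOn q l := by
  refine IrrOn.of_forall fun c d hcd => hq ?_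
  obtain ⟨g, hg⟩ := QuadraticForm.exists_dvd_of_ker (q - QuadraticMap.linMulLin c d) l
    fun x hx => by simp [hcd x hx]
  have hg' : ∀ x, q x = c x * d x + l x * g x := fun x => by
    have := hg x
    simp only [sub_apply, QuadraticMap.linMulLin_apply] at this
    linear_combination this
  refine (((codimLE_ker c).inf (codimLE_ker d)).inf ((codimLE_ker l).inf (codimLE_ker g))).mono
    (fun x hx => ?_) le_rfl
  have h1 : c x = 0 := hx.1.1
  have h2 : d x = 0 := hx.1.2
  have h3 : l x = 0 := hx.2.1
  have h4 : g x = 0 := hx.2.2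
  exact QuadraticForm.mem_rad_of_forall_add fun y => by simp [hg', h1, h2, h3, h4]

theorem IrrOn.exists_of_cover {ι κ : Type*} [Finite ι] [Finite κ] {q : QuadraticForm ℂ E}
    {l : Dual ℂ E} (h : IrrOn q l) {H : ι → QuadraticForm ℂ E} {f : κ → Dual ℂ E} (P : ι → Prop)
    (R : κ → Prop)
    (hcov : ∀ x, q x = 0 → l x = 0 → (∃ i, P i ∧ H i x = 0) ∨ ∃ j, R j ∧ f j x = 0) :
    (∃ i, P i ∧ ∃ (μ : ℂ) (g : Dual ℂ E), ∀ x, H i x = μ * q x + l x * g x) ∨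
      ∃ j, R j ∧ ∃ a : ℂ, f j = a • l := by
  classical
  cases nonempty_fintype ι
  cases nonempty_fintype κ
  let K := LinearMap.ker l
  let F : ι ⊕ κ → K → ℂ := Sum.elim (fun i x => H i x) (fun j x => f j x)
  let s : Finset (ι ⊕ κ) := Finset.univ.filter (Sum.elim P R)
  obtain ⟨i, hi, h1⟩ := (PolyIrred.zeros h).exists_of_prod s (f := F)
    (fun i _ => by
      rcases i with i | j
      · exact (PolyFun.quad ((H i).comp K.subtype) :)
      · exact (PolyFun.dual ((f j).domRestrict K) :))
    (fun x hx => by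
      rcases hcov x (by simpa using hx) x.2 with ⟨i, hi, h1⟩ | ⟨j, hj, h1⟩
      · exact ⟨Sum.inl i, by simp [s, hi], h1⟩
      · exact ⟨Sum.inr j, by simp [s, hj], h1⟩)
  rcases i with i | j
  · left
    refine ⟨i, by simpa [s] using hi, ?_⟩
    obtain ⟨μ, hμ⟩ := QuadraticForm.eq_smul_of_zeros_subset (F := (H i).comp K.subtype) h
      fun x hx => h1 x hx
    obtain ⟨g, hg⟩ := QuadraticForm.exists_dvd_of_ker (H i - μ • q) l fun x hx => by
      have := hμ ⟨x, hx⟩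
      simp only [sub_apply, smul_apply, smul_eq_mul]
      simp only [QuadraticMap.comp_apply, Submodule.subtype_apply] at this
      rw [this, sub_self]
    exact ⟨μ, g, fun x => by
      have := hg x
      simp only [sub_apply, smul_apply, smul_eq_mul] at this
      linear_combination this⟩
  · right
    refine ⟨j, by simpa [s] using hi, ?_⟩
    apply Dual.eq_smul_of_ker
    intro x hx
    by_contra hne
    obtain ⟨y, hy, hne'⟩ := exists_zero_dual_ne h (l := (f j).domRestrict K) (fun h0 => hne (by
      have := LinearMap.congr_fun h0 ⟨x, hx⟩
      simpa using this))
    exact hne' (h1 y hy)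

end Irr

/-- Non-product quadratic forms and linear forms such that every two of their zero sets intersect
inside the union of the others. -/
structure SGConfig (E ι κ : Type*) [AddCommGroup E] [Module ℂ E] where
  /-- the non-product quadratic forms -/
  q : ι → QuadraticForm ℂ E
  /-- the linear forms -/
  f : κ → Dual ℂ E
  not_prod : ∀ i, ¬ IsProd (q i)
  q_indep : ∀ i j, i ≠ j → LinearIndependent ℂ ![q i, q j]
  f_ne : ∀ k, f k ≠ 0
  f_indep : ∀ i j, i ≠ j → LinearIndependent ℂ ![f i, f j]
  cover_qq : ∀ i j, i ≠ j → ∀ x, q i x = 0 → q j x = 0 →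
    (∃ k, (k ≠ i ∧ k ≠ j) ∧ q k x = 0) ∨ ∃ k, f k x = 0
  cover_qf : ∀ i j x, q i x = 0 → f j x = 0 →
    (∃ k, k ≠ i ∧ q k x = 0) ∨ ∃ k, k ≠ j ∧ f k x = 0
  cover_ff : ∀ i j, i ≠ j → ∀ x, f i x = 0 → f j x = 0 →
    (∃ k, q k x = 0) ∨ ∃ k, (k ≠ i ∧ k ≠ j) ∧ f k x = 0

section Config

theorem LinearIndependent.ne_smul {X : Type*} [AddCommGroup X] [Module ℂ X] {x y : X}
    (h : LinearIndependent ℂ ![x, y]) (c : ℂ) : x ≠ c • y := by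
  rintro rfl
  rw [LinearIndependent.pair_iff] at h
  have := (h 1 (-c) (by module)).1
  simp at this

variable {E ι κ : Type*} [AddCommGroup E] [Module ℂ E] (S : SGConfig E ι κ)

theorem SGConfig.eq_of_smul {i j : ι} {c : ℂ} (h : S.q i = c • S.q j) : i = j := by
  by_contra hne
  exact (S.q_indep i j hne).ne_smul c h

theorem SGConfig.eq_of_forall {i j : ι} {c : ℂ} (h : ∀ x, S.q i x = c * S.q j x) : i = j :=
  S.eq_of_smul (c := c) (QuadraticForm.ext_iff'.2 fun x => by rw [h, smul_apply, smul_eq_mul])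

variable [FiniteDimensional ℂ E] [Finite ι] [Finite κ]

theorem SGConfig.exists_of_irrOn {i j : ι} (hij : i ≠ j) {l : Dual ℂ E} (h : IrrOn (S.q i) l)
    (hj : ∀ x, S.q i x = 0 → l x = 0 → S.q j x = 0) :
    (∃ k, (k ≠ i ∧ k ≠ j) ∧ ∃ (μ : ℂ) (g : Dual ℂ E), ∀ x, S.q k x = μ * S.q i x + l x * g x) ∨
      ∃ k, ∃ a : ℂ, S.f k = a • l := by
  rcases h.exists_of_cover (H := S.q) (f := S.f) (fun k => k ≠ i ∧ k ≠ j) (fun _ => True)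
    (fun x hx hl => by simpa using S.cover_qq i j hij x hx (hj x hx hl)) with h | ⟨k, -, h⟩
  · exact Or.inl h
  · exact Or.inr ⟨k, h⟩

theorem SGConfig.exists_of_irrOn_f {i : ι} {j : κ} (h : IrrOn (S.q i) (S.f j)) :
    ∃ k, k ≠ i ∧ ∃ (μ : ℂ) (g : Dual ℂ E), ∀ x, S.q k x = μ * S.q i x + S.f j x * g x := by
  rcases h.exists_of_cover (H := S.q) (f := S.f) (fun k => k ≠ i) (fun k => k ≠ j)
    (fun x hx hl => S.cover_qf i j x hx hl) with h | ⟨k, hk, a, h⟩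
  · exact h
  · exact absurd h ((S.f_indep k j hk).ne_smul a)

open Classical in
theorem SGConfig.card_irrOn_le [Fintype ι] [Fintype κ] (i : ι) :
    (Finset.univ.filter fun j => IrrOn (S.q i) (S.f j)).card ≤ 6 * Fintype.card ι := by
  have h' : ∀ j, ∃ k, IrrOn (S.q i) (S.f j) → k ≠ i ∧ ∃ (μ : ℂ) (g : Dual ℂ E),
      ∀ x, S.q k x = μ * S.q i x + S.f j x * g x := fun j => by
    by_cases hj : IrrOn (S.q i) (S.f j)
    · obtain ⟨k, hk⟩ := S.exists_of_irrOn_f hj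
      exact ⟨k, fun _ => hk⟩
    · exact ⟨i, fun h => absurd h hj⟩
  choose k hk using h'
  have := Finset.card_le_mul_card_image_of_maps_to
    (s := Finset.univ.filter fun j => IrrOn (S.q i) (S.f j)) (t := Finset.univ) (f := k)
    (fun _ _ => Finset.mem_univ _) 6 (fun r _ => by
      by_cases hr : r = i
      · rw [Finset.filter_false_of_mem]
        · simp
        · intro j hj h
          exact (hk j (Finset.mem_filter.1 hj).2).1 (h.trans hr)
      · refine card_le_six_of_fiber (A := S.q r) (S.not_prod i)
          (fun c hc => hr (S.eq_of_smul hc)) _ S.f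
          (fun _ _ _ _ hne => S.f_indep _ _ hne) fun j hj => ?_
        obtain ⟨h1, h2⟩ := Finset.mem_filter.1 hj
        have := (hk j (Finset.mem_filter.1 h1).2).2
        rwa [h2] at this)
  simpa using this

end Config

section SquareFamily

variable {E : Type*} [AddCommGroup E] [Module ℂ E] [FiniteDimensional ℂ E]

theorem dualSq_neg (e : Dual ℂ E) : dualSq (-e) = dualSq e :=
  QuadraticForm.ext_iff'.2 fun x => by simp

theorem Dual.eq_or_eq_neg_of_sq_on (K : Submodule ℂ E) {a b : Dual ℂ E}
    (h : ∀ x ∈ K, a x ^ 2 = b x ^ 2) : (∀ x ∈ K, a x = b x) ∨ ∀ x ∈ K, a x = -b x := by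
  rcases Submodule.mul_eq_zero_on K (PolyFun.dual (a - b)) (PolyFun.dual (a + b))
    (fun x hx => by
      simp only [LinearMap.sub_apply, LinearMap.add_apply]
      linear_combination h x hx) with h | h
  · exact Or.inl fun x hx => by
      have := h x hx
      simp only [LinearMap.sub_apply] at this
      linear_combination this
  · exact Or.inr fun x hx => by
      have := h x hx
      simp only [LinearMap.add_apply] at this
      linear_combination this

theorem linearIndependent_prod_one {a b : Dual ℂ E} (h : a ≠ b) :
    LinearIndependent ℂ ![(a, (1 : ℂ)), (b, (1 : ℂ))] := by
  rw [LinearIndependent.pair_iff]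
  intro s t hst
  have h1 : s • a + t • b = 0 := congrArg Prod.fst hst
  have h2 : s + t = 0 := by simpa using congrArg Prod.snd hst
  have h3 : t = -s := by linear_combination h2
  subst h3
  have h4 : s • (a - b) = 0 := by rw [← h1]; module
  rcases smul_eq_zero.1 h4 with h5 | h5
  · simp [h5]
  · exact absurd (sub_eq_zero.1 h5) h

theorem linearIndependent_prod_zero {a b : Dual ℂ E} (h : b ≠ 0) :
    LinearIndependent ℂ ![(a, (1 : ℂ)), (b, (0 : ℂ))] := by
  rw [LinearIndependent.pair_iff]
  intro s t hst
  have h1 : s • a + t • b = 0 := congrArg Prod.fst hst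
  have h2 : s = 0 := by simpa using congrArg Prod.snd hst
  subst h2
  have h4 : t • b = 0 := by rw [← h1]; module
  exact ⟨rfl, (smul_eq_zero.1 h4).resolve_right h⟩

theorem linearIndependent_prod_zero_zero {a b : Dual ℂ E} (h : LinearIndependent ℂ ![a, b]) :
    LinearIndependent ℂ ![(a, (0 : ℂ)), (b, (0 : ℂ))] := by
  rw [LinearIndependent.pair_iff] at h ⊢
  intro s t hst
  exact h s t (congrArg Prod.fst hst)

variable {ι κ : Type*} (S : SGConfig E ι κ)

theorem SGConfig.sq_unique {w : QuadraticForm ℂ E} {i : ι} {s t : ℂ} {a b : Dual ℂ E}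
    (h : s • S.q i = w + dualSq a) (h' : t • S.q i = w + dualSq b) : a = b ∨ a = -b := by
  have h1 : (s - t) • S.q i = dualSq a - dualSq b := by
    rw [sub_smul, h, h']; abel
  have hst : s - t = 0 := by
    by_contra hne
    refine not_isProd_smul (S.not_prod i) hne ⟨a - b, a + b, fun x => ?_⟩
    rw [h1]
    simp only [sub_apply, dualSq_apply, LinearMap.sub_apply, LinearMap.add_apply]
    ring
  rw [hst, zero_smul] at h1
  have h2 : ∀ x, a x ^ 2 = b x ^ 2 := fun x => by
    have := QuadraticForm.ext_iff'.1 h1 x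
    simp only [sub_apply, dualSq_apply, zero_apply] at this
    linear_combination -this
  rcases Dual.eq_or_eq_neg_of_sq_on ⊤ (fun x _ => h2 x) with h | h
  · exact Or.inl (LinearMap.ext fun x => h x trivial)
  · exact Or.inr (LinearMap.ext fun x => by simpa using h x trivial)

theorem SGConfig.eq_of_sq {w : QuadraticForm ℂ E} {i j : ι} {s t : ℂ} {a : Dual ℂ E} (hs : s ≠ 0)
    (h : s • S.q i = w + dualSq a) (h' : t • S.q j = w + dualSq a) : i = j := by
  apply S.eq_of_smul (c := s⁻¹ * t)
  rw [mul_smul, h', ← h, smul_smul, inv_mul_cancel₀ hs, one_smul]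

open Classical in
/-- The points of the pencil of squares through `w`, together with the directions at infinity. -/
theorem SGConfig.exists_square_family [Fintype ι] [Fintype κ]
    (w : QuadraticForm ℂ E) (i₀ : ι) :
    ∃ V : Finset (Dual ℂ E × ℂ), V.card ≤ 8 * Fintype.card ι ∧
      (∀ (i : ι) (s : ℂ) (a : Dual ℂ E), s ≠ 0 → s • S.q i = w + dualSq a → (a, (1 : ℂ)) ∈ V) ∧
      (∀ j, IrrOn (S.q i₀) (S.f j) → (S.f j, (0 : ℂ)) ∈ V) ∧
      ∀ v ∈ V, ∀ v' ∈ V, v ≠ v' → LinearIndependent ℂ ![v, v'] := by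
  have hex : ∀ i, ∃ b : Dual ℂ E, ∀ (s : ℂ) (a : Dual ℂ E), s • S.q i = w + dualSq a →
      a = b ∨ a = -b := fun i => by
    by_cases h : ∃ (s : ℂ) (a : Dual ℂ E), s • S.q i = w + dualSq a
    · obtain ⟨s, b, hb⟩ := h
      exact ⟨b, fun t a ha => S.sq_unique ha hb⟩
    · push Not at h
      exact ⟨0, fun s a ha => absurd ha (h s a)⟩
  choose b hb using hex
  let L := Finset.univ.filter fun j => IrrOn (S.q i₀) (S.f j)
  refine ⟨(Finset.univ.image fun i => (b i, (1 : ℂ))) ∪ (Finset.univ.image fun i => (-b i, (1 : ℂ))) ∪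
    L.image fun j => (S.f j, (0 : ℂ)), ?_, ?_, ?_, ?_⟩
  · have h1 := S.card_irrOn_le i₀
    have h2 := Finset.card_union_le ((Finset.univ.image fun i => (b i, (1 : ℂ))) ∪
      (Finset.univ.image fun i => (-b i, (1 : ℂ)))) (L.image fun j => (S.f j, (0 : ℂ)))
    have h3 := Finset.card_union_le (Finset.univ.image fun i => (b i, (1 : ℂ)))
      (Finset.univ.image fun i => (-b i, (1 : ℂ)))
    have h4 := Finset.card_image_le (s := Finset.univ) (f := fun i => (b i, (1 : ℂ)))
    have h5 := Finset.card_image_le (s := Finset.univ) (f := fun i => (-b i, (1 : ℂ)))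
    have h6 := Finset.card_image_le (s := L) (f := fun j => (S.f j, (0 : ℂ)))
    rw [Finset.card_univ] at h4 h5
    have h7 : L.card ≤ 6 * Fintype.card ι := h1
    omega
  · intro i s a _ h
    rcases hb i s a h with rfl | rfl <;> simp
  · intro j hj
    simp only [Finset.mem_union, Finset.mem_image]
    exact Or.inr ⟨j, by simpa [L] using hj, rfl⟩
  · have hV : ∀ v ∈ (Finset.univ.image fun i => (b i, (1 : ℂ))) ∪
        (Finset.univ.image fun i => (-b i, (1 : ℂ))) ∪ L.image (fun j => (S.f j, (0 : ℂ))),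
        (∃ a : Dual ℂ E, v = (a, 1)) ∨ ∃ j, v = (S.f j, 0) := by
      intro v hv
      simp only [Finset.mem_union, Finset.mem_image] at hv
      rcases hv with (⟨i, -, rfl⟩ | ⟨i, -, rfl⟩) | ⟨j, -, rfl⟩
      · exact Or.inl ⟨_, rfl⟩
      · exact Or.inl ⟨_, rfl⟩
      · exact Or.inr ⟨_, rfl⟩
    intro v hv v' hv' hne
    rcases hV v hv with ⟨a, rfl⟩ | ⟨j, rfl⟩ <;> rcases hV v' hv' with ⟨a', rfl⟩ | ⟨j', rfl⟩
    · exact linearIndependent_prod_one fun h => hne (by rw [h])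
    · exact linearIndependent_prod_zero (S.f_ne j')
    · exact (LinearIndependent.pair_symm_iff).1 (linearIndependent_prod_zero (S.f_ne j))
    · exact linearIndependent_prod_zero_zero (S.f_indep _ _ fun h => hne (by rw [h]))

/-- A form of the square pencil in the pencil of `q k` and a product by `a k - a l` gives a third
point on the line of `a k` and `a l`. -/
theorem SGConfig.exists_third_of_sq {w : QuadraticForm ℂ E} {i k : ι} {s t : ℂ}
    {a b l : Dual ℂ E} (hk : t • S.q k = w + dualSq b)
    (hi : s • S.q i = w + dualSq a) (hirr : IrrOn (S.q k) l) {μ : ℂ} {g : Dual ℂ E}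
    (h : ∀ x, S.q i x = μ * S.q k x + l x * g x) :
    ∃ (a' : Dual ℂ E) (c : ℂ), s • S.q i = w + dualSq a' ∧ a' = b + c • l := by
  have hk' : ∀ x, t * S.q k x = w x + b x ^ 2 := fun x => by
    have := QuadraticForm.ext_iff'.1 hk x
    simpa using this
  have hi' : ∀ x, s * S.q i x = w x + a x ^ 2 := fun x => by
    have := QuadraticForm.ext_iff'.1 hi x
    simpa using this
  have hc : s * μ = t := by
    by_contra hne
    have hne' : t - s * μ ≠ 0 := sub_ne_zero.2 (Ne.symm hne)
    refine hirr.not_forall ((t - s * μ)⁻¹ • (b - a)) (b + a) fun x hx => ?_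
    simp only [LinearMap.smul_apply, LinearMap.add_apply, LinearMap.sub_apply, smul_eq_mul]
    field_simp
    have h1 := h x
    rw [hx] at h1
    linear_combination hk' x - hi' x + s * h1
  have hsq : ∀ x ∈ LinearMap.ker l, a x ^ 2 = b x ^ 2 := fun x hx => by
    have h1 := h x
    rw [LinearMap.mem_ker.1 hx] at h1
    linear_combination hk' x - hi' x + s * h1 + S.q k x * hc
  rcases Dual.eq_or_eq_neg_of_sq_on _ hsq with h1 | h1
  · obtain ⟨c, hc⟩ := Dual.eq_smul_of_ker (a := l) (b := a - b) fun x hx => by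
      simp [h1 x hx]
    exact ⟨a, c, hi, by rw [← hc]; abel⟩
  · obtain ⟨c, hc⟩ := Dual.eq_smul_of_ker (a := l) (b := -a - b) fun x hx => by
      simp [h1 x hx]
    exact ⟨-a, c, by rw [hi, dualSq_neg], by rw [← hc]; abel⟩

end SquareFamily

section Capture

variable {E ι κ : Type*} [AddCommGroup E] [Module ℂ E] [FiniteDimensional ℂ E] [Fintype ι]
  (S : SGConfig E ι κ)

open Classical in
/-- A proportion `δ` of all the quadratic forms lies in `K` and in the sum of a space of dimension
at most `C` and the forms vanishing on a subspace of codimension at most `C`. -/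
def SGConfig.Captured (K : Finset ι) (C : ℕ) (δ : ℝ) : Prop :=
  ∃ (W : Submodule ℂ (QuadraticForm ℂ E)) (N : Submodule ℂ E), FiniteDimensional ℂ W ∧
    finrank ℂ W ≤ C ∧ CodimLE N C ∧
    δ * Fintype.card ι ≤ (K.filter fun k => S.q k ∈ W ⊔ vanSub N).card

variable {S}

theorem SGConfig.Captured.mono {K K' : Finset ι} {C C' : ℕ} {δ δ' : ℝ} (h : S.Captured K C δ)
    (hK : K ⊆ K') (hC : C ≤ C') (hδ : δ' ≤ δ) : S.Captured K' C' δ' := by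
  classical
  obtain ⟨W, N, h0, h1, h2, h3⟩ := h
  refine ⟨W, N, h0, h1.trans hC, h2.mono le_rfl hC, ?_⟩
  have h4 : ((K.filter fun k => S.q k ∈ W ⊔ vanSub N).card : ℝ) ≤
      (K'.filter fun k => S.q k ∈ W ⊔ vanSub N).card := by
    exact_mod_cast Finset.card_le_card (Finset.filter_subset_filter _ hK)
  have h5 : δ' * Fintype.card ι ≤ δ * Fintype.card ι :=
    mul_le_mul_of_nonneg_right hδ (Nat.cast_nonneg _)
  convert h5.trans (h3.trans ?_)
  convert h4

theorem SGConfig.captured_of_sq {K K' : Finset ι} {w : QuadraticForm ℂ E} {s : ι → ℂ}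
    {e : ι → Dual ℂ E} (hK : K' ⊆ K)
    (hs : ∀ k ∈ K', s k ≠ 0 ∧ s k • S.q k = w + dualSq (e k)) {N : Submodule ℂ E} {C : ℕ}
    (hN : CodimLE N C) (he : ∀ k ∈ K', ∀ x ∈ N, e k x = 0) {δ : ℝ}
    (hδ : δ * Fintype.card ι ≤ K'.card) : S.Captured K (C + 1) δ := by
  classical
  refine ⟨Submodule.span ℂ {w}, N, inferInstance, ?_, hN.mono le_rfl (Nat.le_succ _), ?_⟩
  · exact ((finrank_span_le_card ({w} : Set _)).trans (by simp)).trans (Nat.le_add_left _ _)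
  · refine hδ.trans ?_
    have h4 : K'.card ≤ (K.filter fun k => S.q k ∈ Submodule.span ℂ {w} ⊔ vanSub N).card := by
      refine Finset.card_le_card fun k hk => ?_
      rw [Finset.mem_filter]
      refine ⟨hK hk, ?_⟩
      obtain ⟨h0, h1⟩ := hs k hk
      have h2 : S.q k = (s k)⁻¹ • (w + dualSq (e k)) := by
        rw [← h1, smul_smul, inv_mul_cancel₀ h0, one_smul]
      rw [h2]
      refine Submodule.smul_mem _ _ (Submodule.add_mem_sup (Submodule.mem_span_singleton_self w) ?_)
      intro x hx
      rw [dualSq_apply, he k hk x hx]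
      ring
    exact_mod_cast h4

variable [Fintype κ]

open Classical in
theorem SGConfig.captured_of_many_thirds {K : Finset ι} {w : QuadraticForm ℂ E} {s : ι → ℂ}
    {e : ι → Dual ℂ E} (hs : ∀ k ∈ K, s k ≠ 0 ∧ s k • S.q k = w + dualSq (e k))
    {V : Finset (Dual ℂ E × ℂ)} (hV : V.card ≤ 8 * Fintype.card ι)
    (hVmem : ∀ k ∈ K, (e k, (1 : ℂ)) ∈ V)
    (hVli : ∀ v ∈ V, ∀ v' ∈ V, v ≠ v' → LinearIndependent ℂ ![v, v'])
    (T : Finset (ι × ι)) (hTK : T ⊆ K ×ˢ K)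
    (hT : ∀ p ∈ T, p.1 ≠ p.2 ∧ ∃ v ∈ V, v ≠ (e p.1, 1) ∧ v ≠ (e p.2, 1) ∧
      v ∈ Submodule.span ℂ {(e p.1, (1 : ℂ)), (e p.2, (1 : ℂ))})
    {ε : ℝ} (hε : 0 < ε) (hm : 0 < Fintype.card ι)
    (hcard : ε ^ 2 / 4 * (Fintype.card ι : ℝ) ^ 2 ≤ T.card) :
    S.Captured K (⌊144 * 256 / ε ^ 2⌋₊ + 1) (ε ^ 2 / 64) := by
  have hinj : ∀ k ∈ K, ∀ l ∈ K, e k = e l → k = l := fun k hk l hl h => by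
    have h1 := (hs k hk).2
    rw [h] at h1
    exact S.eq_of_sq (hs k hk).1 h1 (hs l hl).2
  have hne : K.Nonempty := by
    by_contra h
    rw [Finset.not_nonempty_iff_eq_empty] at h
    subst h
    have h1 : T.card = 0 := by
      rw [Finset.card_eq_zero]
      exact Finset.subset_empty.1 (by simpa using hTK)
    rw [h1] at hcard
    have : 0 < ε ^ 2 / 4 * (Fintype.card ι : ℝ) ^ 2 := by positivity
    simp at hcard
    linarith
  obtain ⟨k₁, hk₁⟩ := hne
  let v : ι → V := fun k => if hk : k ∈ K then ⟨(e k, 1), hVmem k hk⟩ else ⟨(e k₁, 1), hVmem k₁ hk₁⟩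
  have hv : ∀ k ∈ K, (v k : Dual ℂ E × ℂ) = (e k, 1) := fun k hk => by simp [v, hk]
  have hvinj : ∀ k ∈ K, ∀ l ∈ K, v k = v l → k = l := fun k hk l hl h => by
    have h1 := congrArg (Subtype.val) h
    rw [hv k hk, hv l hl] at h1
    exact hinj k hk l hl (congrArg Prod.fst h1)
  let q' : V → Dual ℂ E × ℂ := Subtype.val
  have hM0 : (0 : ℝ) < 8 * Fintype.card ι := by positivity
  obtain ⟨A, hA1, hA2⟩ := exists_finrank_span_le_of_special_pairs (q := q')
    (fun i j hij => hVli i i.2 j j.2 fun h => hij (Subtype.ext h)) (K.image v)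
    (T.image fun p => (v p.1, v p.2))
    (by
      intro p hp
      obtain ⟨p', hp', rfl⟩ := Finset.mem_image.1 hp
      have := Finset.mem_product.1 (hTK hp')
      exact Finset.mem_product.2 ⟨Finset.mem_image_of_mem _ this.1, Finset.mem_image_of_mem _ this.2⟩)
    (by
      intro p hp
      obtain ⟨p', hp', rfl⟩ := Finset.mem_image.1 hp
      have hK := Finset.mem_product.1 (hTK hp')
      obtain ⟨h1, u, hu, h2, h3, h4⟩ := hT p' hp'
      refine ⟨fun h => h1 (hvinj _ hK.1 _ hK.2 h), ⟨u, hu⟩, ?_, ?_, ?_⟩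
      · intro h
        exact h2 ((congrArg Subtype.val h).trans (hv _ hK.1))
      · intro h
        exact h3 ((congrArg Subtype.val h).trans (hv _ hK.2))
      · simp only [q', hv _ hK.1, hv _ hK.2]
        exact h4)
    (8 * Fintype.card ι) (ε ^ 2 / 256) (by simpa using (by exact_mod_cast hV)) hM0 (by positivity)
    (by
      rw [Finset.card_image_of_injOn]
      · refine le_trans (le_of_eq ?_) hcard
        ring
      · intro p hp p' hp' h
        have hK := Finset.mem_product.1 (hTK hp)
        have hK' := Finset.mem_product.1 (hTK hp')
        simp only [Prod.mk.injEq] at h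
        exact Prod.ext (hvinj _ hK.1 _ hK'.1 h.1) (hvinj _ hK.2 _ hK'.2 h.2))
  let U : Submodule ℂ (Dual ℂ E) := (Submodule.span ℂ (q' '' A)).map (LinearMap.fst ℂ _ _)
  have hU : finrank ℂ U ≤ ⌊144 * 256 / ε ^ 2⌋₊ := by
    have h1 : finrank ℂ U ≤ finrank ℂ (Submodule.span ℂ (q' '' A)) := Submodule.finrank_map_le _ _
    refine h1.trans (Nat.le_floor (hA1.trans (le_of_eq ?_)))
    field_simp
  refine S.captured_of_sq (K' := K.filter fun k => v k ∈ A) (Finset.filter_subset _ _)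
    (fun k hk => hs k (Finset.mem_filter.1 hk).1)
    ((codimLE_dualCoannihilator U).mono le_rfl hU) ?_ ?_
  · intro k hk x hx
    obtain ⟨hk1, hk2⟩ := Finset.mem_filter.1 hk
    rw [Submodule.mem_dualCoannihilator] at hx
    refine hx _ ⟨(e k, 1), Submodule.subset_span ⟨v k, hk2, hv k hk1⟩, rfl⟩
  · have h1 : ((K.image v) ∩ A).card ≤ (K.filter fun k => v k ∈ A).card := by
      have h2 : (K.image v) ∩ A ⊆ (K.filter fun k => v k ∈ A).image v := by
        intro u hu
        obtain ⟨hu1, hu2⟩ := Finset.mem_inter.1 hu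
        obtain ⟨k, hk, rfl⟩ := Finset.mem_image.1 hu1
        exact Finset.mem_image_of_mem _ (Finset.mem_filter.2 ⟨hk, hu2⟩)
      exact (Finset.card_le_card h2).trans Finset.card_image_le
    have h3 : (((K.image v) ∩ A).card : ℝ) ≤ (K.filter fun k => v k ∈ A).card := by
      exact_mod_cast h1
    refine le_trans (le_trans (le_of_eq ?_) hA2) (le_trans (le_of_eq ?_) h3)
    · ring
    · congr!

/-- If a form outside the square pencil is linked to many forms of the pencil, these are captured. -/
theorem SGConfig.exists_codim_of_center {K : Finset ι} {w : QuadraticForm ℂ E} {s : ι → ℂ}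
    {e : ι → Dual ℂ E} (hs : ∀ k ∈ K, s k ≠ 0 ∧ s k • S.q k = w + dualSq (e k)) {i : ι}
    (hi : ∀ (t : ℂ) (a : Dual ℂ E), t ≠ 0 → t • S.q i ≠ w + dualSq a)
    (h : ∀ k ∈ K, ∃ (μ : ℂ) (l g : Dual ℂ E), ∀ x, S.q i x = μ * S.q k x + l x * g x) :
    ∃ N : Submodule ℂ E, CodimLE N 6 ∧ ∀ k ∈ K, ∀ x ∈ N, e k x = 0 := by
  have key : ∀ k ∈ K, ∃ μ : ℂ, CodimLE (S.q i - μ • w).rad 3 ∧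
      ∀ x ∈ (S.q i - μ • w).rad, e k x = 0 := by
    intro k hk
    obtain ⟨hs0, hs1⟩ := hs k hk
    obtain ⟨μ, l, g, hμ⟩ := h k hk
    have hk' : ∀ x, s k * S.q k x = w x + e k x ^ 2 := fun x => by
      have := QuadraticForm.ext_iff'.1 hs1 x
      simpa using this
    have hμ0 : μ ≠ 0 := by
      rintro rfl
      exact S.not_prod i ⟨l, g, fun x => by rw [hμ]; ring⟩
    have hD : ∀ z, (S.q i - (μ / s k) • w) z = μ / s k * e k z ^ 2 +
        (QuadraticMap.linMulLin l g) z := fun z => by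
      simp only [sub_apply, smul_apply, smul_eq_mul, QuadraticMap.linMulLin_apply, hμ]
      field_simp
      linear_combination hk' z * μ
    refine ⟨μ / s k, ?_, ?_⟩
    · refine (((codimLE_ker (e k)).inf (codimLE_ker l)).inf (codimLE_ker g)).mono ?_ le_rfl
      intro x hx
      have h1 : e k x = 0 := hx.1.1
      have h2 : l x = 0 := hx.1.2
      have h3 : g x = 0 := hx.2
      refine QuadraticForm.mem_rad_of_forall_add fun y => ?_
      rw [hD, hD]
      simp [h1, h2, h3]
    · intro x hx
      by_contra hne
      obtain ⟨k', e', he'⟩ := eq_sq_of_isProd_sub (div_ne_zero hμ0 hs0) ⟨l, g, fun x => rfl⟩ hD hx hne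
      obtain ⟨r, hr⟩ := IsAlgClosed.exists_pow_nat_eq (k' * (s k / μ)) (n := 2) (by norm_num)
      refine hi (s k / μ) (r • e') (div_ne_zero hs0 hμ0) (QuadraticForm.ext_iff'.2 fun z => ?_)
      have h1 := he' z
      simp only [sub_apply, smul_apply, smul_eq_mul] at h1
      simp only [add_apply, smul_apply, smul_eq_mul, dualSq_apply, LinearMap.smul_apply, mul_pow, hr]
      field_simp
      field_simp at h1
      linear_combination h1
  choose! μ h1 h2 using key
  by_cases hall : ∀ k ∈ K, ∀ k' ∈ K, μ k = μ k'
  · rcases K.eq_empty_or_nonempty with rfl | ⟨k, hk⟩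
    · exact ⟨⊤, codimLE_top.mono le_rfl (by norm_num), by simp⟩
    · refine ⟨_, (h1 k hk).mono le_rfl (by norm_num), fun k' hk' x hx => ?_⟩
      rw [hall k hk k' hk'] at hx
      exact h2 k' hk' x hx
  · push Not at hall
    obtain ⟨k, hk, k', hk', hne⟩ := hall
    refine ⟨_, (h1 k hk).inf (h1 k' hk'), fun j hj x hx => h2 j hj x ?_⟩
    have hw : ∀ y, w.polarBilin x y = 0 ∧ (S.q i).polarBilin x y = 0 := fun y => by
      have h3 := QuadraticForm.polarBilin_of_mem_rad hx.1 y
      have h4 := QuadraticForm.polarBilin_of_mem_rad hx.2 y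
      simp only [QuadraticForm.polarBilin_sub', QuadraticForm.polarBilin_smul', LinearMap.sub_apply,
        LinearMap.smul_apply, smul_eq_mul] at h3 h4
      have h5 : w.polarBilin x y = 0 := by
        have : (μ k - μ k') * w.polarBilin x y = 0 := by linear_combination h4 - h3
        exact (mul_eq_zero.1 this).resolve_left (sub_ne_zero.2 hne)
      rw [h5] at h3
      exact ⟨h5, by linear_combination h3⟩
    refine QuadraticForm.mem_rad.2 fun y => ?_
    simp only [QuadraticForm.polarBilin_sub', QuadraticForm.polarBilin_smul', LinearMap.sub_apply,
        LinearMap.smul_apply, smul_eq_mul]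
    rw [(hw y).1, (hw y).2]; ring

theorem SGConfig.captured_of_card_eq_zero (K : Finset ι) (C : ℕ) (δ : ℝ)
    (h : Fintype.card ι = 0) : S.Captured K C δ :=
  ⟨⊥, ⊤, inferInstance, by simp, codimLE_top.mono le_rfl (Nat.zero_le _), by simp [h]⟩

open Classical in
/-- Many forms in a pencil of squares are captured. -/
theorem SGConfig.captured_of_sq_pencil {K : Finset ι} {w : QuadraticForm ℂ E} {s : ι → ℂ}
    {e : ι → Dual ℂ E} (hs : ∀ k ∈ K, s k ≠ 0 ∧ s k • S.q k = w + dualSq (e k))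
    {N : Submodule ℂ E} {C : ℕ} (hN : CodimLE N C)
    (hirr : ∀ k ∈ K, ∀ l : Dual ℂ E, (∃ x ∈ N, e k x = 0 ∧ l x ≠ 0) → IrrOn (S.q k) l)
    {ε : ℝ} (hε : 0 < ε) (hcard : ε * Fintype.card ι ≤ K.card) :
    S.Captured K (C + 10 + ⌊144 * 256 / ε ^ 2⌋₊) (ε ^ 2 / 64) := by
  rcases Nat.eq_zero_or_pos (Fintype.card ι) with hm | hm
  · exact S.captured_of_card_eq_zero _ _ _ hm
  have hm' : (0 : ℝ) < Fintype.card ι := by exact_mod_cast hm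
  set m : ℝ := (Fintype.card ι : ℝ) with hmdef
  have hKm : (K.card : ℝ) ≤ m := by rw [hmdef]; exact_mod_cast Finset.card_le_univ K
  have hε1 : ε ≤ 1 := by
    by_contra! h
    nlinarith
  have hε2 : ε ^ 2 ≤ ε := by nlinarith
  have hKpos : 0 < K.card := by
    have : (0 : ℝ) < K.card := lt_of_lt_of_le (by positivity) hcard
    exact_mod_cast this
  obtain ⟨k₀, hk₀⟩ := Finset.card_pos.1 hKpos
  obtain ⟨V, hV, hVsq, hVf, hVli⟩ := S.exists_square_family w k₀
  let good : ι → ι → Prop := fun k l => ∃ x ∈ N, e k x = 0 ∧ e k₀ x = 0 ∧ e l x ≠ 0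
  by_cases hbad : ∃ k ∈ K, ε / 4 * m ≤ (K.filter fun l => ¬ good k l).card
  · obtain ⟨k, hk, hbad⟩ := hbad
    refine (S.captured_of_sq (K' := K.filter fun l => ¬ good k l) (Finset.filter_subset _ _)
      (fun l hl => hs l (Finset.mem_filter.1 hl).1)
      ((hN.inf (codimLE_ker (e k))).inf (codimLE_ker (e k₀))) ?_ hbad).mono subset_rfl (by omega)
      (by linarith)
    intro l hl x hx
    by_contra hne
    exact (Finset.mem_filter.1 hl).2 ⟨x, hx.1.1, hx.1.2, hx.2, hne⟩
  push Not at hbad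
  let G : Finset (ι × ι) := (K ×ˢ K).filter fun p => good p.1 p.2
  have hG : 3 / 4 * ε ^ 2 * m ^ 2 ≤ G.card := by
    have h1 : ((K ×ˢ K).filter fun p => ¬ good p.1 p.2).card =
        ∑ k ∈ K, (K.filter fun l => ¬ good k l).card := by
      rw [Finset.card_filter, Finset.sum_product]
      exact Finset.sum_congr rfl fun k _ => by rw [Finset.card_filter]
    have h2 : (((K ×ˢ K).filter fun p => ¬ good p.1 p.2).card : ℝ) ≤ K.card * (ε / 4 * m) := by
      rw [h1]
      push_cast
      refine (Finset.sum_le_sum fun k hk => (hbad k hk).le).trans ?_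
      simp
    have h3 := Finset.card_filter_add_card_filter_not (s := K ×ˢ K) (fun p => good p.1 p.2)
    have h4 : (G.card : ℝ) + ((K ×ˢ K).filter fun p => ¬ good p.1 p.2).card = K.card * K.card := by
      rw [Finset.card_product] at h3
      exact_mod_cast h3
    have h5 : 0 ≤ ((K.card : ℝ) - ε * m) * (K.card + 3 / 4 * (ε * m)) :=
      mul_nonneg (by linarith) (by positivity)
    nlinarith
  let SG : ι × ι → Prop := fun p => ∃ v ∈ V, v ≠ (e p.1, 1) ∧ v ≠ (e p.2, 1) ∧
    v ∈ Submodule.span ℂ {(e p.1, (1 : ℂ)), (e p.2, (1 : ℂ))}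
  have hGK : ∀ p ∈ G, p.1 ∈ K ∧ p.2 ∈ K ∧ good p.1 p.2 := fun p hp => by
    have := Finset.mem_filter.1 hp
    exact ⟨(Finset.mem_product.1 this.1).1, (Finset.mem_product.1 this.1).2, this.2⟩
  have hGne : ∀ p ∈ G, e p.1 ≠ e p.2 := fun p hp h => by
    obtain ⟨-, -, x, -, h1, -, h2⟩ := hGK p hp
    exact h2 (by rw [← h, h1])
  by_cases hT : ε ^ 2 / 4 * m ^ 2 ≤ (G.filter SG).card
  · refine (S.captured_of_many_thirds hs hV
      (fun k hk => hVsq k (s k) (e k) (hs k hk).1 (hs k hk).2) hVli (G.filter SG)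
      (fun p hp => Finset.mem_product.2 ?_) (fun p hp => ⟨?_, (Finset.mem_filter.1 hp).2⟩) hε hm
      hT).mono subset_rfl (by omega) le_rfl
    · have := hGK p (Finset.mem_filter.1 hp).1
      exact ⟨this.1, this.2.1⟩
    · intro h
      exact hGne p (Finset.mem_filter.1 hp).1 (by rw [h])
  push Not at hT
  let R := G.filter fun p => ¬ SG p
  have hR : ε ^ 2 / 2 * m ^ 2 ≤ R.card := by
    have h3 := Finset.card_filter_add_card_filter_not (s := G) SG
    have h4 : ((G.filter SG).card : ℝ) + R.card = G.card := by exact_mod_cast h3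
    nlinarith
  have hcenter : ∀ p ∈ R, ∃ i, (∀ (t : ℂ) (a : Dual ℂ E), t ≠ 0 → t • S.q i ≠ w + dualSq a) ∧
      ∃ (μ : ℂ) (g : Dual ℂ E), ∀ x, S.q i x = μ * S.q p.1 x + (e p.1 - e p.2) x * g x := by
    intro p hp
    obtain ⟨hpG, hpS⟩ := Finset.mem_filter.1 hp
    obtain ⟨hk, hl, x, hxN, hx1, hx0, hx2⟩ := hGK p hpG
    have hne := hGne p hpG
    have hlx : (e p.1 - e p.2) x ≠ 0 := by simpa [hx1] using hx2
    have hirr1 := hirr p.1 hk (e p.1 - e p.2) ⟨x, hxN, hx1, hlx⟩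
    obtain ⟨hs1, hs1'⟩ := hs p.1 hk
    obtain ⟨hs2, hs2'⟩ := hs p.2 hl
    rcases S.exists_of_irrOn (i := p.1) (j := p.2) (fun h => hne (by rw [h])) hirr1
      (fun y hy hly => by
        have h1 := QuadraticForm.ext_iff'.1 hs1' y
        have h2 := QuadraticForm.ext_iff'.1 hs2' y
        simp only [smul_apply, add_apply, dualSq_apply, smul_eq_mul, LinearMap.sub_apply] at h1 h2 hly
        have h3 : s p.2 * S.q p.2 y = 0 := by
          rw [hy] at h1
          linear_combination h2 - h1 - (e p.1 y + e p.2 y) * hly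
        exact (mul_eq_zero.1 h3).resolve_left hs2) with ⟨i, hi, μ, g, hg⟩ | ⟨j, a, hj⟩
    · refine ⟨i, fun t a ht hta => hpS ?_, μ, g, hg⟩
      obtain ⟨a', c, ha', hc⟩ := S.exists_third_of_sq hs1' hta hirr1 hg
      refine ⟨(a', 1), hVsq i t a' ht ha', ?_, ?_, ?_⟩
      · intro h
        rw [show a' = _ from congrArg Prod.fst h] at ha'
        exact hi.1 (S.eq_of_sq ht ha' hs1')
      · intro h
        rw [show a' = _ from congrArg Prod.fst h] at ha'
        exact hi.2 (S.eq_of_sq ht ha' hs2')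
      · refine Submodule.mem_span_pair.2 ⟨1 + c, -c, ?_⟩
        rw [hc]
        refine Prod.ext ?_ ?_
        · simp only [Prod.smul_mk, Prod.mk_add_mk]
          module
        · simp
    · refine absurd ⟨(S.f j, 0), hVf j (hirr k₀ hk₀ _ ⟨x, hxN, hx0, ?_⟩), ?_, ?_, ?_⟩ hpS
      · rw [hj, LinearMap.smul_apply, smul_eq_mul]
        refine mul_ne_zero ?_ hlx
        rintro rfl
        exact S.f_ne j (by rw [hj, zero_smul])
      · intro h
        simpa using congrArg Prod.snd h
      · intro h
        simpa using congrArg Prod.snd h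
      · refine Submodule.mem_span_pair.2 ⟨a, -a, ?_⟩
        rw [hj]
        refine Prod.ext ?_ ?_
        · simp only [Prod.smul_mk, Prod.mk_add_mk]
          module
        · simp
  have : Nonempty ι := ⟨k₀⟩
  choose! c hc1 hc2 using hcenter
  let Φ : ι × ι → ι × ι := fun p => (c p, p.1)
  have hfib : R.card ≤ 6 * (R.image Φ).card := by
    refine Finset.card_le_mul_card_image R 6 fun b hb => ?_
    obtain ⟨p₀, hp₀, rfl⟩ := Finset.mem_image.1 hb
    refine card_le_six_of_fiber (A := S.q (c p₀)) (S.not_prod p₀.1) ?_ _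
      (fun p => e p.1 - e p.2) ?_ ?_
    · intro r hr
      have hp := (hGK p₀ (Finset.mem_filter.1 hp₀).1).1
      have hi := S.eq_of_smul hr
      refine hc1 p₀ hp₀ (s p₀.1) (e p₀.1) (hs p₀.1 hp).1 ?_
      rw [hi]
      exact (hs p₀.1 hp).2
    · intro p hp p' hp' hne
      simp only [Finset.mem_filter, Φ, Prod.mk.injEq] at hp hp'
      obtain ⟨hp, hp1, hp2⟩ := hp
      obtain ⟨hp', hp1', hp2'⟩ := hp'
      have h12 : p.1 = p'.1 := hp2.trans hp2'.symm
      have hG1 := Finset.mem_filter.1 hp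
      have hG2 := Finset.mem_filter.1 hp'
      by_contra hdep
      rw [LinearIndependent.pair_iff' (sub_ne_zero.2 (hGne p hG1.1))] at hdep
      push Not at hdep
      obtain ⟨a, ha⟩ := hdep
      refine hG1.2 ⟨(e p'.2, 1), ?_, ?_, ?_, ?_⟩
      · have h3 := hs p'.2 (hGK p' hG2.1).2.1
        exact hVsq p'.2 _ _ h3.1 h3.2
      · intro h
        exact hGne p' hG2.1 (by rw [← h12]; exact (congrArg Prod.fst h).symm)
      · intro h
        have h3 := hs p'.2 (hGK p' hG2.1).2.1
        have h4 := hs p.2 (hGK p hG1.1).2.1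
        have h5 : e p'.2 = e p.2 := congrArg Prod.fst h
        rw [h5] at h3
        exact hne (Prod.ext h12 (S.eq_of_sq h4.1 h4.2 h3.2))
      · refine Submodule.mem_span_pair.2 ⟨1 - a, a, ?_⟩
        refine Prod.ext ?_ ?_
        · simp only [Prod.smul_mk, Prod.mk_add_mk]
          rw [← h12] at ha
          have : e p'.2 = e p.1 - a • (e p.1 - e p.2) := by rw [ha]; abel
          rw [this]
          module
        · simp
    · intro p hp
      simp only [Finset.mem_filter, Φ, Prod.mk.injEq] at hp
      have := hc2 p hp.1
      rw [hp.2.1, hp.2.2] at this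
      simpa only [hp.2.2] using this
  obtain ⟨i, -, hi⟩ := Finset.exists_le_card_fiber_of_nsmul_le_card_of_maps_to
    (s := R.image Φ) (t := Finset.univ) (f := Prod.fst) (b := ε ^ 2 / 12 * m)
    (fun _ _ => Finset.mem_univ _) ⟨k₀, Finset.mem_univ _⟩ (by
      have h1 : (R.card : ℝ) ≤ 6 * (R.image Φ).card := by exact_mod_cast hfib
      rw [nsmul_eq_mul, Finset.card_univ, ← hmdef]
      nlinarith)
  let K' := ((R.image Φ).filter fun p => p.1 = i).image Prod.snd
  have hK' : ∀ k ∈ K', ∃ p ∈ R, c p = i ∧ p.1 = k := by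
    intro k hk
    obtain ⟨p, hp, rfl⟩ := Finset.mem_image.1 hk
    obtain ⟨hp1, hp2⟩ := Finset.mem_filter.1 hp
    obtain ⟨p', hp', rfl⟩ := Finset.mem_image.1 hp1
    exact ⟨p', hp', hp2, rfl⟩
  have hK'K : K' ⊆ K := fun k hk => by
    obtain ⟨p, hp, -, rfl⟩ := hK' k hk
    exact (hGK p (Finset.mem_filter.1 hp).1).1
  have hK'card : ε ^ 2 / 12 * m ≤ K'.card := by
    rw [Finset.card_image_of_injOn]
    · exact hi
    · intro p hp p' hp' h
      have h1 := (Finset.mem_filter.1 hp).2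
      have h2 := (Finset.mem_filter.1 hp').2
      exact Prod.ext (h1.trans h2.symm) h
  have hK'ne : K'.Nonempty := by
    rw [← Finset.card_pos]
    have : (0 : ℝ) < K'.card := lt_of_lt_of_le (by positivity) hK'card
    exact_mod_cast this
  obtain ⟨k₁, hk₁⟩ := hK'ne
  obtain ⟨p₁, hp₁, hc₁, -⟩ := hK' k₁ hk₁
  obtain ⟨N', hN', hN'e⟩ := S.exists_codim_of_center (K := K') (i := i)
    (fun k hk => hs k (hK'K hk)) (by rw [← hc₁]; exact hc1 p₁ hp₁) (fun k hk => by
      obtain ⟨p, hp, h1, rfl⟩ := hK' k hk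
      obtain ⟨μ, g, h2⟩ := hc2 p hp
      exact ⟨μ, _, g, by rw [← h1]; exact h2⟩)
  exact (S.captured_of_sq hK'K (fun k hk => hs k (hK'K hk)) hN' hN'e hK'card).mono subset_rfl
    (by omega) (by nlinarith [sq_nonneg ε])

end Capture

section Loop

variable {E : Type*} [AddCommGroup E] [Module ℂ E] [FiniteDimensional ℂ E]

/-- A combination of `g` and `g'` with nonzero coefficients is a product; if `w` is nonzero, then
the combination must cancel `w` in `w + g` and `w + g'`. -/
def CombProd (w g g' : QuadraticForm ℂ E) : Prop :=
  ∃ α β : ℂ, α ≠ 0 ∧ β ≠ 0 ∧ (w ≠ 0 → α + β = 0) ∧ IsProd (α • g + β • g')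

theorem exists_mem_rad_ne_zero {N : Submodule ℂ E} {g g' : QuadraticForm ℂ E}
    (hsup : N ≤ (g.rad ⊓ N) ⊔ (g'.rad ⊓ N)) {z : E} (hz : z ∈ N) :
    ∃ x ∈ g'.rad ⊓ N, g x = g z ∧ ∀ y, g.polarBilin x y = g.polarBilin z y := by
  obtain ⟨a, ha, b, hb, rfl⟩ := Submodule.mem_sup.1 (hsup hz)
  refine ⟨b, hb, (QuadraticForm.map_add_of_mem_rad ha.1 b).symm, fun y => ?_⟩
  rw [map_add, LinearMap.add_apply, QuadraticForm.polarBilin_of_mem_rad ha.1, zero_add]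

/-- The form `g` minus the square splitting off the anisotropic vector `z`. -/
noncomputable def splitOff (g : QuadraticForm ℂ E) (z : E) : QuadraticForm ℂ E :=
  g - (4 * g z)⁻¹ • dualSq (g.polarBilin z)

theorem splitOff_apply (g : QuadraticForm ℂ E) (z x : E) :
    splitOff g z x = g x - g.polarBilin z x ^ 2 / (4 * g z) := by
  simp [splitOff, -QuadraticMap.polarBilin_apply_apply]
  ring

theorem rad_le_rad_splitOff (g : QuadraticForm ℂ E) (z : E) : g.rad ≤ (splitOff g z).rad := by
  intro x hx
  refine QuadraticForm.mem_rad_of_forall_add fun y => ?_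
  rw [splitOff_apply, splitOff_apply, QuadraticForm.map_add_of_mem_rad hx, map_add,
    g.polarBilin_symm z x, QuadraticForm.polarBilin_of_mem_rad hx, zero_add]

theorem CombProd.exists_splitOff {w g g' : QuadraticForm ℂ E} (h : CombProd w g g')
    {N : Submodule ℂ E} (hsup : N ≤ (g.rad ⊓ N) ⊔ (g'.rad ⊓ N)) {z z' : E} (hz : z ∈ N)
    (hgz : g z ≠ 0) (hz' : z' ∈ N) (hgz' : g' z' ≠ 0) :
    N ≤ (splitOff g z).rad ∧ ∃ (c : ℂ) (e : Dual ℂ E), c ≠ 0 ∧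
      c • (w + g') = w + splitOff g z + dualSq e := by
  obtain ⟨α, β, hα, hβ, hw, hp⟩ := h
  obtain ⟨x, hx, hx1, hx2⟩ := exists_mem_rad_ne_zero hsup hz
  obtain ⟨y, hy, hy1, hy2⟩ := exists_mem_rad_ne_zero (g := g') (g' := g) (hsup.trans_eq (sup_comm _ _)) hz'
  have hBx : ∀ t, (α • g + β • g').polarBilin x t = α * g.polarBilin z t := fun t => by
    rw [QuadraticForm.polarBilin_add', QuadraticForm.polarBilin_smul',
      QuadraticForm.polarBilin_smul']
    simp only [LinearMap.add_apply, LinearMap.smul_apply, smul_eq_mul, hx2,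
      QuadraticForm.polarBilin_of_mem_rad hx.1]
    ring
  have hBy : ∀ t, (α • g + β • g').polarBilin y t = β * g'.polarBilin z' t := fun t => by
    rw [QuadraticForm.polarBilin_add', QuadraticForm.polarBilin_smul',
      QuadraticForm.polarBilin_smul']
    simp only [LinearMap.add_apply, LinearMap.smul_apply, smul_eq_mul, hy2,
      QuadraticForm.polarBilin_of_mem_rad hy.1]
    ring
  have hhx : (α • g + β • g') x = α * g z := by
    simp only [add_apply, smul_apply, smul_eq_mul, hx1, QuadraticForm.apply_of_mem_rad hx.1]
    ring
  have hhy : (α • g + β • g') y = β * g' z' := by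
    simp only [add_apply, smul_apply, smul_eq_mul, hy1, QuadraticForm.apply_of_mem_rad hy.1]
    ring
  have key := hp.eq_sq_add_sq_of_orthogonal (x := x) (y := y) (by rw [hhx]; positivity)
    (by rw [hhy]; positivity) (by
      rw [hBx, ← hx2, g.polarBilin_symm, QuadraticForm.polarBilin_of_mem_rad hy.1, mul_zero])
  have hsplit : ∀ t, α * splitOff g z t = -β * splitOff g' z' t := fun t => by
    have := key t
    rw [hBx, hBy, hhx, hhy] at this
    simp only [add_apply, smul_apply, smul_eq_mul] at this
    rw [splitOff_apply, splitOff_apply]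
    field_simp at this ⊢
    linear_combination this
  have hsplit' : splitOff g z = (-β / α) • splitOff g' z' := QuadraticForm.ext_iff'.2 fun t => by
    rw [smul_apply, smul_eq_mul]
    field_simp
    linear_combination hsplit t
  refine ⟨hsup.trans (sup_le (inf_le_left.trans (rad_le_rad_splitOff g z)) (inf_le_left.trans ?_)),
    -β / α, ?_⟩
  · rw [hsplit']
    exact (rad_le_rad_splitOff g' z').trans (QuadraticForm.rad_le_smul _ _)
  · obtain ⟨r, hr⟩ := IsAlgClosed.exists_pow_nat_eq (-β / α * (4 * g' z')⁻¹) (n := 2) (by norm_num)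
    refine ⟨r • g'.polarBilin z', div_ne_zero (neg_ne_zero.2 hβ) hα,
      QuadraticForm.ext_iff'.2 fun t => ?_⟩
    have hw' : (-β / α) * w t = w t := by
      by_cases hw0 : w = 0
      · simp [hw0]
      · have : -β / α = 1 := by
          rw [div_eq_one_iff_eq hα]
          linear_combination -hw hw0
        rw [this, one_mul]
    simp only [smul_apply, add_apply, smul_eq_mul, dualSq_apply, LinearMap.smul_apply, mul_pow, hr]
    rw [mul_add, hw', hsplit', smul_apply, splitOff_apply, smul_eq_mul]
    ring

end Loop

open Classical in
theorem SGConfig.captured_of_combProd (D : ℕ) : ∀ (ε : ℝ) (C : ℕ), 0 < ε →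
    ∃ (δ : ℝ) (C' : ℕ) (θ : ℝ), 0 < δ ∧ 0 < θ ∧
      ∀ (E ι κ : Type) [AddCommGroup E] [Module ℂ E] [FiniteDimensional ℂ E] [Fintype ι]
        [Fintype κ] (S : SGConfig E ι κ) (K : Finset ι) (N : Submodule ℂ E)
        (w : QuadraticForm ℂ E) (s : ι → ℂ) (g : ι → QuadraticForm ℂ E),
        ε * Fintype.card ι ≤ K.card → CodimLE N C →
        (∀ k ∈ K, s k ≠ 0 ∧ s k • S.q k = w + g k) →
        (∀ k ∈ K, finrank ℂ N ≤ finrank ℂ ((g k).rad ⊓ N : Submodule ℂ E) + D) →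
        ((((K ×ˢ K).filter fun p => ¬ CombProd w (g p.1) (g p.2)).card : ℝ) ≤
          θ * (Fintype.card ι : ℝ) ^ 2) →
        (w = 0 ∨ ∀ k ∈ K, ∀ l, IrrOn (S.q k) l) → S.Captured K C' δ := by
  induction D with
  | zero =>
    intro ε C hε
    refine ⟨ε, C + 1, 1, hε, one_pos, ?_⟩
    intro E ι κ _ _ _ _ _ S K N w s g hK hN hs hD _ _
    refine ⟨Submodule.span ℂ {w}, N, inferInstance, ?_, hN.mono le_rfl (Nat.le_succ _), ?_⟩
    · exact ((finrank_span_le_card ({w} : Set _)).trans (by simp)).trans (Nat.le_add_left 1 C)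
    · rw [Finset.filter_true_of_mem]
      · exact hK
      · intro k hk
        have h1 : N ≤ (g k).rad := by
          have := Submodule.eq_of_le_of_finrank_le (inf_le_right : (g k).rad ⊓ N ≤ N) (hD k hk)
          exact inf_eq_right.1 this
        obtain ⟨h0, h2⟩ := hs k hk
        have h3 : S.q k = (s k)⁻¹ • (w + g k) := by
          rw [← h2, smul_smul, inv_mul_cancel₀ h0, one_smul]
        rw [h3]
        exact Submodule.smul_mem _ _ (Submodule.add_mem_sup (Submodule.mem_span_singleton_self w)
          fun x hx => QuadraticForm.apply_of_mem_rad (h1 hx))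
  | succ D ih =>
    intro ε C hε
    obtain ⟨δ₁, C₁, θ₁, hδ₁, hθ₁, h₁⟩ := ih (ε / 8) (C + (D + 1)) (by positivity)
    refine ⟨min (ε / 2) (min δ₁ ((ε / 4) ^ 2 / 64)),
      max (C + 1) (max C₁ (C + 10 + ⌊144 * 256 / (ε / 4) ^ 2⌋₊)), min θ₁ (ε ^ 2 / 16),
      by positivity, by positivity, ?_⟩
    intro E ι κ _ _ _ _ _ S K N w s g hK hN hs hD hθ hw
    rcases Nat.eq_zero_or_pos (Fintype.card ι) with hm | hm
    · exact S.captured_of_card_eq_zero _ _ _ hm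
    have hm' : (0 : ℝ) < Fintype.card ι := by exact_mod_cast hm
    set m : ℝ := (Fintype.card ι : ℝ) with hmdef
    by_cases hA : ε / 2 * m ≤ (K.filter fun k => g k ∈ vanSub N).card
    · refine SGConfig.Captured.mono (C := C + 1) (δ := ε / 2) (K := K) ?_ subset_rfl
        (le_max_left _ _) (min_le_left _ _)
      refine ⟨Submodule.span ℂ {w}, N, inferInstance, ?_, hN.mono le_rfl (Nat.le_succ _), ?_⟩
      · exact ((finrank_span_le_card ({w} : Set _)).trans (by simp)).trans (Nat.le_add_left 1 C)
      · refine hA.trans ?_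
        have : (K.filter fun k => g k ∈ vanSub N) ⊆
            K.filter fun k => S.q k ∈ Submodule.span ℂ {w} ⊔ vanSub N := by
          intro k hk
          obtain ⟨hk, hk2⟩ := Finset.mem_filter.1 hk
          refine Finset.mem_filter.2 ⟨hk, ?_⟩
          obtain ⟨h0, h2⟩ := hs k hk
          have h3 : S.q k = (s k)⁻¹ • (w + g k) := by
            rw [← h2, smul_smul, inv_mul_cancel₀ h0, one_smul]
          rw [h3]
          exact Submodule.smul_mem _ _ (Submodule.add_mem_sup (Submodule.mem_span_singleton_self w)
            hk2)
        exact_mod_cast Finset.card_le_card this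
    push Not at hA
    set K' := K.filter fun k => g k ∉ vanSub N with hK'def
    have hK' : ε / 2 * m ≤ K'.card := by
      have h3 := Finset.card_filter_add_card_filter_not (s := K) (fun k => g k ∈ vanSub N)
      have h4 : ((K.filter fun k => g k ∈ vanSub N).card : ℝ) + K'.card = K.card := by
        exact_mod_cast h3
      linarith
    have hK'K : K' ⊆ K := Finset.filter_subset _ _
    by_cases hB : ∃ j ∈ K', ε / 8 * m ≤
        (K'.filter fun l => ¬ N ≤ ((g j).rad ⊓ N) ⊔ ((g l).rad ⊓ N)).card
    · obtain ⟨j, hj, hB⟩ := hB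
      set L := K'.filter fun l => ¬ N ≤ ((g j).rad ⊓ N) ⊔ ((g l).rad ⊓ N)
      have hLK : L ⊆ K := (Finset.filter_subset _ _).trans hK'K
      refine SGConfig.Captured.mono (h₁ E ι κ S L ((g j).rad ⊓ N) w s g hB ?_
        (fun k hk => hs k (hLK hk)) ?_ ?_ ?_) hLK ((le_max_left _ _).trans (le_max_right _ _))
        ((min_le_right _ _).trans (min_le_left _ _))
      · have h1 := hD j (hK'K hj)
        unfold CodimLE at *
        omega
      · intro k hk
        have h1 := hD j (hK'K hj)
        have h2 := hD k (hLK hk)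
        have h3 := Submodule.finrank_sup_add_finrank_inf_eq ((g j).rad ⊓ N) ((g k).rad ⊓ N)
        have h4 : finrank ℂ (((g j).rad ⊓ N) ⊔ ((g k).rad ⊓ N) : Submodule ℂ E) < finrank ℂ N := by
          refine Submodule.finrank_lt_finrank_of_lt (lt_of_le_of_ne (sup_le inf_le_right inf_le_right) ?_)
          intro h
          exact (Finset.mem_filter.1 hk).2 h.ge
        have h5 : ((g j).rad ⊓ N) ⊓ ((g k).rad ⊓ N) = (g k).rad ⊓ ((g j).rad ⊓ N) := by
          ext x
          simp only [Submodule.mem_inf]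
          tauto
        rw [h5] at h3
        omega
      · have : ((L ×ˢ L).filter fun p => ¬ CombProd w (g p.1) (g p.2)).card ≤
            ((K ×ˢ K).filter fun p => ¬ CombProd w (g p.1) (g p.2)).card :=
          Finset.card_le_card (Finset.filter_subset_filter _ (Finset.product_subset_product hLK hLK))
        have h2 : (((L ×ˢ L).filter fun p => ¬ CombProd w (g p.1) (g p.2)).card : ℝ) ≤
            ((K ×ˢ K).filter fun p => ¬ CombProd w (g p.1) (g p.2)).card := by exact_mod_cast this
        refine h2.trans (hθ.trans ?_)
        gcongr
        exact min_le_left _ _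
      · exact hw.imp_right fun h k hk => h k (hLK hk)
    push Not at hB
    have hK'pos : (0 : ℝ) < K'.card := lt_of_lt_of_le (by positivity) hK'
    have hC : ∃ j ∈ K', ((K'.filter fun l => ¬ CombProd w (g j) (g l)).card : ℝ) ≤ ε / 8 * m := by
      by_contra! hcon
      have h1 : ((K' ×ˢ K').filter fun p => ¬ CombProd w (g p.1) (g p.2)).card =
          ∑ k ∈ K', (K'.filter fun l => ¬ CombProd w (g k) (g l)).card := by
        rw [Finset.card_filter, Finset.sum_product]
        exact Finset.sum_congr rfl fun k _ => by rw [Finset.card_filter]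
      have h2 : K'.card * (ε / 8 * m) <
          (((K' ×ˢ K').filter fun p => ¬ CombProd w (g p.1) (g p.2)).card : ℝ) := by
        rw [h1]
        push_cast
        refine lt_of_eq_of_lt ?_ (Finset.sum_lt_sum_of_nonempty (Finset.card_pos.1 (by
          exact_mod_cast hK'pos)) hcon)
        simp
      have h3 : ((K' ×ˢ K').filter fun p => ¬ CombProd w (g p.1) (g p.2)).card ≤
            ((K ×ˢ K).filter fun p => ¬ CombProd w (g p.1) (g p.2)).card :=
          Finset.card_le_card (Finset.filter_subset_filter _
            (Finset.product_subset_product hK'K hK'K))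
      have h4 : (((K' ×ˢ K').filter fun p => ¬ CombProd w (g p.1) (g p.2)).card : ℝ) ≤
            ((K ×ˢ K).filter fun p => ¬ CombProd w (g p.1) (g p.2)).card := by exact_mod_cast h3
      have h5 : min θ₁ (ε ^ 2 / 16) * m ^ 2 ≤ ε ^ 2 / 16 * m ^ 2 := by
        gcongr
        exact min_le_right _ _
      have h6 : ε / 2 * m * (ε / 8 * m) ≤ K'.card * (ε / 8 * m) := by gcongr
      nlinarith
    obtain ⟨j, hj, hj2⟩ := hC
    have hj3 := hB j hj
    set L := K'.filter fun l => N ≤ ((g j).rad ⊓ N) ⊔ ((g l).rad ⊓ N) ∧ CombProd w (g j) (g l)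
      with hLdef
    have hLK : L ⊆ K := (Finset.filter_subset _ _).trans hK'K
    have hL : ε / 4 * m ≤ L.card := by
      have h1 : K' ⊆ L ∪ ((K'.filter fun l => ¬ N ≤ ((g j).rad ⊓ N) ⊔ ((g l).rad ⊓ N)) ∪
          K'.filter fun l => ¬ CombProd w (g j) (g l)) := by
        intro l hl
        simp only [Finset.mem_union, hLdef, Finset.mem_filter]
        tauto
      have h2 : (K'.card : ℝ) ≤ L.card +
          ((K'.filter fun l => ¬ N ≤ ((g j).rad ⊓ N) ⊔ ((g l).rad ⊓ N)).card +
          (K'.filter fun l => ¬ CombProd w (g j) (g l)).card) := by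
        have := (Finset.card_le_card h1).trans (Finset.card_union_le _ _)
        have h3 := Finset.card_union_le
          (K'.filter fun l => ¬ N ≤ ((g j).rad ⊓ N) ⊔ ((g l).rad ⊓ N))
          (K'.filter fun l => ¬ CombProd w (g j) (g l))
        exact_mod_cast this.trans (Nat.add_le_add_left h3 _)
      linarith
    have hex : ∀ k ∈ K', ∃ z ∈ N, g k z ≠ 0 := fun k hk => by
      have := (Finset.mem_filter.1 hk).2
      rw [mem_vanSub] at this
      push Not at this
      exact this
    obtain ⟨z, hz, hgz⟩ := hex j hj
    have hLsq : ∀ l ∈ L, N ≤ (splitOff (g j) z).rad ∧ ∃ (c : ℂ) (e : Dual ℂ E), c ≠ 0 ∧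
        c • (w + g l) = w + splitOff (g j) z + dualSq e := fun l hl => by
      obtain ⟨hl1, hl2, hl3⟩ := Finset.mem_filter.1 hl
      obtain ⟨z', hz', hgz'⟩ := hex l hl1
      exact hl3.exists_splitOff hl2 hz hgz hz' hgz'
    choose! hNrad c e hc hce using hLsq
    have hfin : S.Captured L (C + 10 + ⌊144 * 256 / (ε / 4) ^ 2⌋₊) ((ε / 4) ^ 2 / 64) := by
      have hsq : ∀ l ∈ L, c l * s l ≠ 0 ∧
          (c l * s l) • S.q l = w + splitOff (g j) z + dualSq (e l) := fun l hl => by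
        obtain ⟨h0, h2⟩ := hs l (hLK hl)
        exact ⟨mul_ne_zero (hc l hl) h0, by rw [mul_smul, h2, hce l hl]⟩
      refine S.captured_of_sq_pencil (w := w + splitOff (g j) z) (s := fun l => c l * s l)
        (e := e) hsq hN ?_ (by positivity) hL
      rintro l hl a ⟨x, hxN, hex, hax⟩
      rcases hw with hw | hw
      · obtain ⟨h0, h2⟩ := hsq l hl
        have h3 : S.q l = (c l * s l)⁻¹ • (splitOff (g j) z + dualSq (e l)) := by
          rw [hw, zero_add] at h2
          rw [← h2, smul_smul, inv_mul_cancel₀ h0, one_smul]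
        refine IrrOn.of_mem_rad (S.not_prod l) (x := x) ?_ hax
        rw [h3]
        exact QuadraticForm.rad_le_smul _ _ (QuadraticForm.rad_inf_le_add _ _
          ⟨hNrad l hl hxN, ker_le_rad_dualSq _ hex⟩)
      · exact hw l (hLK hl) a
    exact hfin.mono hLK ((le_max_right _ _).trans (le_max_right _ _))
      ((min_le_right _ _).trans (min_le_right _ _))

section Trichotomy

variable {E : Type*} [AddCommGroup E] [Module ℂ E]

theorem QuadraticForm.exists_eq_of_ker_pair (F : QuadraticForm ℂ E) (c d : Dual ℂ E)
    (h : ∀ x, c x = 0 → d x = 0 → F x = 0) :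
    ∃ a b : Dual ℂ E, ∀ x, F x = c x * a x + d x * b x := by
  obtain ⟨a, ha⟩ := QuadraticForm.exists_dvd_of_ker (F.comp (LinearMap.ker d).subtype)
    (c.domRestrict _) fun x hx => h x hx x.2
  obtain ⟨a', ha'⟩ := exists_dual_extend _ a
  obtain ⟨b, hb⟩ := QuadraticForm.exists_dvd_of_ker (F - QuadraticMap.linMulLin c a') d
    fun x hx => by
      have h1 := ha ⟨x, hx⟩
      rw [← ha'] at h1
      simp only [QuadraticMap.comp_apply, Submodule.subtype_apply, LinearMap.domRestrict_apply] at h1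
      simp [h1]
  refine ⟨a', b, fun x => ?_⟩
  have := hb x
  simp only [sub_apply, QuadraticMap.linMulLin_apply] at this
  linear_combination this

theorem QuadraticForm.rad_le_of_vanish {F : QuadraticForm ℂ E} (hF : ¬ IsProd F) {c d : Dual ℂ E}
    (h : ∀ x, c x = 0 → d x = 0 → F x = 0) : F.rad ≤ LinearMap.ker c ⊓ LinearMap.ker d := by
  obtain ⟨a, b, hab⟩ := F.exists_eq_of_ker_pair c d h
  have key : ∀ {c d a b : Dual ℂ E}, (∀ x, F x = c x * a x + d x * b x) → ∀ x ∈ F.rad, c x = 0 := by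
    intro c d a b hab x hx
    by_contra hne
    refine hF ⟨d - (d x / c x) • c, b - (b x / c x) • c, fun y => ?_⟩
    have h1 := QuadraticForm.map_add_of_mem_rad (Submodule.smul_mem _ (-(c y / c x)) hx) y
    rw [← h1, hab]
    have h2 : c (-(c y / c x) • x + y) = 0 := by simp [hne]
    rw [h2]
    simp only [map_add, map_smul, LinearMap.sub_apply, LinearMap.smul_apply, smul_eq_mul]
    ring
  exact fun x hx => ⟨key hab x hx, key (c := d) (d := c) (a := b) (b := a)
    (fun y => by rw [hab]; ring) x hx⟩

variable [FiniteDimensional ℂ E]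

theorem QuadraticForm.codimLE_rad_of_vanish {F : QuadraticForm ℂ E} {c d : Dual ℂ E}
    (h : ∀ x, c x = 0 → d x = 0 → F x = 0) : CodimLE F.rad 4 := by
  obtain ⟨a, b, hab⟩ := F.exists_eq_of_ker_pair c d h
  refine (((codimLE_ker c).inf (codimLE_ker d)).inf ((codimLE_ker a).inf (codimLE_ker b))).mono
    (fun x hx => ?_) le_rfl
  have h1 : c x = 0 := hx.1.1
  have h2 : d x = 0 := hx.1.2
  have h3 : a x = 0 := hx.2.1
  have h4 : b x = 0 := hx.2.2
  exact QuadraticForm.mem_rad_of_forall_add fun y => by simp [hab, h1, h2, h3, h4]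

/-- Some nontrivial combination of the two forms is a product. -/
def PairProd (F G : QuadraticForm ℂ E) : Prop :=
  ∃ α β : ℂ, α ≠ 0 ∧ β ≠ 0 ∧ IsProd (α • F + β • G)

/-- The two forms vanish on a common subspace of codimension two. -/
def PairVanish (F G : QuadraticForm ℂ E) : Prop :=
  ∃ c d : Dual ℂ E, ∀ x, c x = 0 → d x = 0 → F x = 0 ∧ G x = 0

theorem pairProd_self (F : QuadraticForm ℂ E) : PairProd F F :=
  ⟨1, -1, one_ne_zero, neg_ne_zero.2 one_ne_zero, 0, 0, fun x => by simp⟩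

variable {ι κ : Type*} [Finite ι] [Finite κ] (S : SGConfig E ι κ)

theorem SGConfig.trichotomy {i j : ι} (hij : i ≠ j) :
    (∃ k, k ≠ i ∧ k ≠ j ∧ S.q k ∈ Submodule.span ℂ {S.q i, S.q j}) ∨ PairProd (S.q i) (S.q j) ∨
      PairVanish (S.q i) (S.q j) := by
  classical
  cases nonempty_fintype ι
  cases nonempty_fintype κ
  rcases pencil_structure (F := S.q i) (G := S.q j)
    (H := (Sum.elim S.q fun k => dualSq (S.f k) : ι ⊕ κ → QuadraticForm ℂ E))
    (s := Finset.univ.filter (Sum.elim (fun k => k ≠ i ∧ k ≠ j) fun _ => True))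
    (S.not_prod i) (S.not_prod j) (fun x hx hx' => by
      rcases S.cover_qq i j hij x hx hx' with ⟨k, hk, h⟩ | ⟨k, h⟩
      · exact ⟨Sum.inl k, by simpa using hk, h⟩
      · exact ⟨Sum.inr k, by simp, by simp [h]⟩) with ⟨k, hk, α, β, h⟩ | h | h
  · rcases k with k | k
    · have hk' : k ≠ i ∧ k ≠ j := by simpa using hk
      refine Or.inl ⟨k, hk'.1, hk'.2, Submodule.mem_span_pair.2 ⟨α, β, ?_⟩⟩
      exact QuadraticForm.ext_iff'.2 fun x => by simpa using (h x).symm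
    · right; left
      have hp : IsProd (α • S.q i + β • S.q j) := ⟨S.f k, S.f k, fun x => by
        have := h x
        simp only [Sum.elim_inr, dualSq_apply] at this
        simp only [add_apply, smul_apply, smul_eq_mul, ← this, sq]⟩
      have hne : α • S.q i + β • S.q j ≠ 0 := by
        intro h0
        refine S.f_ne k (LinearMap.ext fun x => ?_)
        have h1 := h x
        have h2 := QuadraticForm.ext_iff'.1 h0 x
        simp only [Sum.elim_inr, dualSq_apply] at h1
        simp only [add_apply, smul_apply, smul_eq_mul, zero_apply] at h2
        rw [h2] at h1
        simpa using h1
      refine ⟨α, β, ?_, ?_, hp⟩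
      · rintro rfl
        rw [zero_smul, zero_add] at hp hne
        exact not_isProd_smul (S.not_prod j) (fun h => hne (by rw [h, zero_smul])) hp
      · rintro rfl
        rw [zero_smul, add_zero] at hp hne
        exact not_isProd_smul (S.not_prod i) (fun h => hne (by rw [h, zero_smul])) hp
  · exact Or.inr (Or.inl h)
  · exact Or.inr (Or.inr h)

end Trichotomy

theorem exists_card_filter_le {ι : Type*} (K : Finset ι) (P : ι → ι → Prop)
    [∀ i j, Decidable (P i j)] {a : ℝ} (hK : K.Nonempty)
    (h : (((K ×ˢ K).filter fun p => P p.1 p.2).card : ℝ) ≤ K.card * a) :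
    ∃ j ∈ K, ((K.filter fun l => P j l).card : ℝ) ≤ a := by
  by_contra! hcon
  have h1 : ((K ×ˢ K).filter fun p => P p.1 p.2).card = ∑ k ∈ K, (K.filter fun l => P k l).card := by
    rw [Finset.card_filter, Finset.sum_product]
    exact Finset.sum_congr rfl fun k _ => by rw [Finset.card_filter]
  have h2 : K.card * a < (((K ×ˢ K).filter fun p => P p.1 p.2).card : ℝ) := by
    rw [h1]
    push_cast
    refine lt_of_eq_of_lt ?_ (Finset.sum_lt_sum_of_nonempty hK hcon)
    simp
  linarith

theorem card_filter_product_le {ι : Type*} (K : Finset ι) (P : ι → ι → Prop)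
    [∀ i j, Decidable (P i j)] {a : ℝ} (h : ∀ j ∈ K, ((K.filter fun l => P j l).card : ℝ) ≤ a) :
    (((K ×ˢ K).filter fun p => P p.1 p.2).card : ℝ) ≤ K.card * a := by
  have h1 : ((K ×ˢ K).filter fun p => P p.1 p.2).card = ∑ k ∈ K, (K.filter fun l => P k l).card := by
    rw [Finset.card_filter, Finset.sum_product]
    exact Finset.sum_congr rfl fun k _ => by rw [Finset.card_filter]
  rw [h1]
  push_cast
  refine (Finset.sum_le_sum h).trans ?_
  simp

open Classical in
/-- Every subfamily of positive proportion has a captured part of positive proportion. -/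
theorem SGConfig.exists_captured (ε : ℝ) (hε : 0 < ε) : ∃ (δ : ℝ) (C : ℕ), 0 < δ ∧
    ∀ (E ι κ : Type) [AddCommGroup E] [Module ℂ E] [FiniteDimensional ℂ E] [Fintype ι]
      [Fintype κ] (S : SGConfig E ι κ) (K : Finset ι), ε * Fintype.card ι ≤ K.card →
      S.Captured K C δ := by
  obtain ⟨δ₁, C₁, θ₁, hδ₁, hθ₁, h₁⟩ := SGConfig.captured_of_combProd 8 (ε / 2) 0 (by positivity)
  obtain ⟨δ₂, C₂, θ₂, hδ₂, hθ₂, h₂⟩ := SGConfig.captured_of_combProd 2 (ε / 2) 0 (by positivity)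
  set η := min (min (θ₁ / 2) (θ₂ / 2)) (ε ^ 2 / 4) with hηdef
  have hη : 0 < η := by positivity
  have hη1 : 2 * η ≤ θ₁ := by
    have : η ≤ θ₁ / 2 := (min_le_left _ _).trans (min_le_left _ _)
    linarith
  have hη2 : 2 * η ≤ θ₂ := by
    have : η ≤ θ₂ / 2 := (min_le_left _ _).trans (min_le_right _ _)
    linarith
  have hη3 : η ≤ ε ^ 2 / 4 := min_le_right _ _
  refine ⟨min (min δ₁ δ₂) (η / 2), max (max C₁ C₂) (max ⌊144 / η⌋₊ 4), by positivity, ?_⟩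
  intro E ι κ _ _ _ _ _ S K hK
  rcases Nat.eq_zero_or_pos (Fintype.card ι) with hm | hm
  · exact S.captured_of_card_eq_zero _ _ _ hm
  have hm' : (0 : ℝ) < Fintype.card ι := by exact_mod_cast hm
  set m : ℝ := (Fintype.card ι : ℝ) with hmdef
  have hKm : (K.card : ℝ) ≤ m := by rw [hmdef]; exact_mod_cast Finset.card_le_univ K
  have hKpos : (0 : ℝ) < K.card := lt_of_lt_of_le (by positivity) hK
  have hKne : K.Nonempty := Finset.card_pos.1 (by exact_mod_cast hKpos)
  let T1 : ι → ι → Prop := fun i j => i ≠ j ∧ ∃ k, k ≠ i ∧ k ≠ j ∧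
    S.q k ∈ Submodule.span ℂ {S.q i, S.q j}
  by_cases hT1 : η * m ^ 2 ≤ ((K ×ˢ K).filter fun p => T1 p.1 p.2).card
  · obtain ⟨A, hA1, hA2⟩ := exists_finrank_span_le_of_special_pairs S.q_indep K
      ((K ×ˢ K).filter fun p => T1 p.1 p.2) (Finset.filter_subset _ _)
      (fun p hp => (Finset.mem_filter.1 hp).2) m η le_rfl hm' hη hT1
    refine SGConfig.Captured.mono (C := ⌊144 / η⌋₊) (δ := η / 2) (K := K) ?_ subset_rfl
      ((le_max_left _ _).trans (le_max_right _ _)) (min_le_right _ _)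
    refine ⟨Submodule.span ℂ (S.q '' A), ⊤,
      FiniteDimensional.span_of_finite ℂ (A.finite_toSet.image _), Nat.le_floor hA1,
      codimLE_top.mono le_rfl (Nat.zero_le _), ?_⟩
    refine le_trans (le_trans (le_of_eq (by ring)) hA2) ?_
    have : K ∩ A ⊆ K.filter fun k => S.q k ∈ Submodule.span ℂ (S.q '' A) ⊔ vanSub ⊤ := by
      intro k hk
      obtain ⟨hk, hkA⟩ := Finset.mem_inter.1 hk
      exact Finset.mem_filter.2 ⟨hk, Submodule.mem_sup_left (Submodule.subset_span ⟨k, hkA, rfl⟩)⟩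
    exact_mod_cast Finset.card_le_card this
  push Not at hT1
  by_cases hT3 : ∃ i ∈ K, η * m ≤ (K.filter fun j => PairVanish (S.q i) (S.q j)).card
  · obtain ⟨i, hi, hT3⟩ := hT3
    have hne : (K.filter fun j => PairVanish (S.q i) (S.q j)).Nonempty := by
      rw [← Finset.card_pos]
      have : (0 : ℝ) < (K.filter fun j => PairVanish (S.q i) (S.q j)).card :=
        lt_of_lt_of_le (by positivity) hT3
      exact_mod_cast this
    obtain ⟨j₀, hj₀⟩ := hne
    obtain ⟨c, d, hcd⟩ := (Finset.mem_filter.1 hj₀).2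
    refine SGConfig.Captured.mono (C := 4) (δ := η / 2) (K := K) ?_ subset_rfl
      ((le_max_right _ _).trans (le_max_right _ _)) (min_le_right _ _)
    refine ⟨⊥, (S.q i).rad, inferInstance, by simp,
      QuadraticForm.codimLE_rad_of_vanish fun x hx hx' => (hcd x hx hx').1, ?_⟩
    refine le_trans (le_trans ?_ hT3) ?_
    · gcongr; linarith
    have : (K.filter fun j => PairVanish (S.q i) (S.q j)) ⊆
        K.filter fun k => S.q k ∈ ⊥ ⊔ vanSub (S.q i).rad := by
      intro k hk
      obtain ⟨hk, c, d, hcd⟩ := Finset.mem_filter.1 hk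
      refine Finset.mem_filter.2 ⟨hk, Submodule.mem_sup_right fun x hx => ?_⟩
      have := QuadraticForm.rad_le_of_vanish (S.not_prod i) (fun x hx hx' => (hcd x hx hx').1) hx
      exact (hcd x this.1 this.2).2
    exact_mod_cast Finset.card_le_card this
  push Not at hT3
  have hT2 : (((K ×ˢ K).filter fun p => ¬ PairProd (S.q p.1) (S.q p.2)).card : ℝ) ≤
      2 * η * m ^ 2 := by
    have h1 : ((K ×ˢ K).filter fun p => ¬ PairProd (S.q p.1) (S.q p.2)) ⊆
        ((K ×ˢ K).filter fun p => T1 p.1 p.2) ∪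
          (K ×ˢ K).filter fun p => PairVanish (S.q p.1) (S.q p.2) := by
      intro p hp
      obtain ⟨hp, hp2⟩ := Finset.mem_filter.1 hp
      have hne : p.1 ≠ p.2 := fun h => hp2 (h ▸ pairProd_self _)
      rw [Finset.mem_union, Finset.mem_filter, Finset.mem_filter]
      rcases S.trichotomy hne with h | h | h
      · exact Or.inl ⟨hp, hne, h⟩
      · exact absurd h hp2
      · exact Or.inr ⟨hp, h⟩
    have h2 := card_filter_product_le K (fun i j => PairVanish (S.q i) (S.q j))
      (fun i hi => (hT3 i hi).le)
    have h3 : (((K ×ˢ K).filter fun p => ¬ PairProd (S.q p.1) (S.q p.2)).card : ℝ) ≤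
        ((K ×ˢ K).filter fun p => T1 p.1 p.2).card +
          ((K ×ˢ K).filter fun p => PairVanish (S.q p.1) (S.q p.2)).card := by
      exact_mod_cast (Finset.card_le_card h1).trans (Finset.card_union_le _ _)
    have h4 : (K.card : ℝ) * (η * m) ≤ m * (η * m) := by gcongr
    nlinarith
  obtain ⟨i, hi, hi2⟩ := exists_card_filter_le K (fun i j => ¬ PairProd (S.q i) (S.q j))
    (a := ε / 2 * m) hKne (by
      have h1 : ε * m * (ε / 2 * m) ≤ K.card * (ε / 2 * m) := by gcongr
      have h2 : η * m ^ 2 ≤ ε ^ 2 / 4 * m ^ 2 := by gcongr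
      nlinarith)
  set L := K.filter fun j => PairProd (S.q i) (S.q j) with hLdef
  have hLK : L ⊆ K := Finset.filter_subset _ _
  have hL : ε / 2 * m ≤ L.card := by
    have h3 := Finset.card_filter_add_card_filter_not (s := K) (fun j => PairProd (S.q i) (S.q j))
    have h4 : (L.card : ℝ) + (K.filter fun j => ¬ PairProd (S.q i) (S.q j)).card = K.card := by
      exact_mod_cast h3
    linarith
  have hT2L : (((L ×ˢ L).filter fun p => ¬ PairProd (S.q p.1) (S.q p.2)).card : ℝ) ≤
      2 * η * m ^ 2 := by
    refine le_trans ?_ hT2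
    exact_mod_cast Finset.card_le_card
      (Finset.filter_subset_filter _ (Finset.product_subset_product hLK hLK))
  have hLp : ∀ j ∈ L, ∃ (s : ℂ) (p : QuadraticForm ℂ E), s ≠ 0 ∧ IsProd p ∧
      s • S.q j = S.q i + p := fun j hj => by
    obtain ⟨α, β, hα, hβ, hp⟩ := (Finset.mem_filter.1 hj).2
    refine ⟨-β / α, (-1 / α) • (α • S.q i + β • S.q j), div_ne_zero (neg_ne_zero.2 hβ) hα,
      hp.smul _, QuadraticForm.ext_iff'.2 fun x => ?_⟩
    simp only [smul_apply, add_apply, smul_eq_mul]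
    field_simp
    ring
  choose! s p hs hp hsp using hLp
  have hsp' : ∀ j ∈ L, S.q j = (s j)⁻¹ • (S.q i + p j) := fun j hj => by
    rw [← hsp j hj, smul_smul, inv_mul_cancel₀ (hs j hj), one_smul]
  by_cases hlow : CodimLE (S.q i).rad 6
  · refine SGConfig.Captured.mono (h₁ E ι κ S L ⊤ 0 1 S.q hL codimLE_top ?_ ?_ ?_ (Or.inl rfl)) hLK
      ((le_max_left _ _).trans (le_max_left _ _)) ((min_le_left _ _).trans (min_le_left _ _))
    · intro k _
      exact ⟨one_ne_zero, by rw [Pi.one_apply, one_smul, zero_add]⟩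
    · intro k hk
      rw [inf_top_eq, finrank_top]
      refine (hlow.inf (hp k hk).codimLE_rad).mono ?_ le_rfl
      rw [hsp' k hk]
      exact (QuadraticForm.rad_inf_le_add _ _).trans (QuadraticForm.rad_le_smul _ _)
    · refine le_trans (le_trans ?_ hT2L) (by gcongr)
      have : ((L ×ˢ L).filter fun p => ¬ CombProd 0 (S.q p.1) (S.q p.2)) ⊆
          (L ×ˢ L).filter fun p => ¬ PairProd (S.q p.1) (S.q p.2) := by
        intro p hp
        obtain ⟨hp, hp2⟩ := Finset.mem_filter.1 hp
        refine Finset.mem_filter.2 ⟨hp, fun ⟨α, β, h1, h2, h3⟩ =>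
          hp2 ⟨α, β, h1, h2, fun h => absurd rfl h, h3⟩⟩
      exact_mod_cast Finset.card_le_card this
  · have hhigh : ∀ k ∈ L, ∀ l, IrrOn (S.q k) l := by
      intro k hk l
      refine IrrOn.of_codim (fun h => hlow ?_) l
      refine (h.inf (hp k hk).codimLE_rad).mono ?_ le_rfl
      have h1 : S.q i = s k • S.q k + (-1 : ℂ) • p k := by rw [hsp k hk]; module
      rw [h1]
      exact (inf_le_inf (QuadraticForm.rad_le_smul _ _) (QuadraticForm.rad_le_smul _ _)).trans
        (QuadraticForm.rad_inf_le_add _ _)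
    refine SGConfig.Captured.mono (h₂ E ι κ S L ⊤ (S.q i) s p hL codimLE_top
      (fun k hk => ⟨hs k hk, hsp k hk⟩) ?_ ?_ (Or.inr hhigh)) hLK
      ((le_max_right _ _).trans (le_max_left _ _)) ((min_le_left _ _).trans (min_le_right _ _))
    · intro k hk
      rw [inf_top_eq, finrank_top]
      exact (hp k hk).codimLE_rad
    · refine le_trans (le_trans ?_ hT2L) (by gcongr)
      have : ((L ×ˢ L).filter fun r => ¬ CombProd (S.q i) (p r.1) (p r.2)) ⊆
          (L ×ˢ L).filter fun p => ¬ PairProd (S.q p.1) (S.q p.2) := by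
        intro r hr
        obtain ⟨hr, hr2⟩ := Finset.mem_filter.1 hr
        obtain ⟨hr1, hr1'⟩ := Finset.mem_product.1 hr
        refine Finset.mem_filter.2 ⟨hr, fun ⟨α, β, h1, h2, h3⟩ => hr2 ?_⟩
        have hne1 := hs r.1 hr1
        have hne2 := hs r.2 hr1'
        set a := α / s r.1 with ha
        set b := β / s r.2 with hb
        have ha0 : a ≠ 0 := div_ne_zero h1 hne1
        have hb0 : b ≠ 0 := div_ne_zero h2 hne2
        have heq : α • S.q r.1 + β • S.q r.2 = (a + b) • S.q i + (a • p r.1 + b • p r.2) := by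
          rw [hsp' r.1 hr1, hsp' r.2 hr1', smul_smul, smul_smul, ← div_eq_mul_inv,
            ← div_eq_mul_inv, ← ha, ← hb]
          module
        have hab : a + b = 0 := by
          by_contra hab
          refine hlow ?_
          have h5 : S.q i = (a + b)⁻¹ • ((α • S.q r.1 + β • S.q r.2) +
              ((-a) • p r.1 + (-b) • p r.2)) := by
            rw [heq, show (a + b) • S.q i + (a • p r.1 + b • p r.2) + (-a • p r.1 + -b • p r.2) =
              (a + b) • S.q i by module, smul_smul, inv_mul_cancel₀ hab, one_smul]
          rw [h5]
          refine (h3.codimLE_rad.inf ((hp r.1 hr1).codimLE_rad.inf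
            (hp r.2 hr1').codimLE_rad)).mono ?_ le_rfl
          refine le_trans ?_ (QuadraticForm.rad_le_smul _ _)
          refine le_trans (inf_le_inf le_rfl ?_) (QuadraticForm.rad_inf_le_add _ _)
          exact (inf_le_inf (QuadraticForm.rad_le_smul _ _) (QuadraticForm.rad_le_smul _ _)).trans
            (QuadraticForm.rad_inf_le_add _ _)
        rw [heq, hab, zero_smul, zero_add] at h3
        exact ⟨a, b, ha0, hb0, fun _ => hab, h3⟩
      exact_mod_cast Finset.card_le_card this

theorem vanSub_inf_left {E : Type*} [AddCommGroup E] [Module ℂ E] [FiniteDimensional ℂ E]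
    (W W' : Submodule ℂ (QuadraticForm ℂ E)) (N N' : Submodule ℂ E) :
    W ⊔ vanSub N ≤ (W ⊔ W') ⊔ vanSub (N ⊓ N') :=
  sup_le_sup le_sup_left (vanSub_mono inf_le_left)

theorem vanSub_inf_right {E : Type*} [AddCommGroup E] [Module ℂ E] [FiniteDimensional ℂ E]
    (W W' : Submodule ℂ (QuadraticForm ℂ E)) (N N' : Submodule ℂ E) :
    W' ⊔ vanSub N' ≤ (W ⊔ W') ⊔ vanSub (N ⊓ N') :=
  sup_le_sup le_sup_right (vanSub_mono inf_le_right)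

open Classical in
theorem SGConfig.exists_absorbing (ε : ℝ) (hε : 0 < ε) : ∃ C : ℕ,
    ∀ (E ι κ : Type) [AddCommGroup E] [Module ℂ E] [FiniteDimensional ℂ E] [Fintype ι]
      [Fintype κ] (S : SGConfig E ι κ), ∃ (W : Submodule ℂ (QuadraticForm ℂ E))
      (N : Submodule ℂ E), FiniteDimensional ℂ W ∧ finrank ℂ W ≤ C ∧ CodimLE N C ∧
      ((Finset.univ.filter fun k => S.q k ∉ W ⊔ vanSub N).card : ℝ) ≤ ε * Fintype.card ι := by
  obtain ⟨δ, C, hδ, h⟩ := SGConfig.exists_captured ε hε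
  have key : ∀ t : ℕ, ∀ (E ι κ : Type) [AddCommGroup E] [Module ℂ E] [FiniteDimensional ℂ E]
      [Fintype ι] [Fintype κ] (S : SGConfig E ι κ), ∃ (W : Submodule ℂ (QuadraticForm ℂ E))
      (N : Submodule ℂ E), FiniteDimensional ℂ W ∧ finrank ℂ W ≤ t * C ∧ CodimLE N (t * C) ∧
      (((Finset.univ.filter fun k => S.q k ∉ W ⊔ vanSub N).card : ℝ) ≤ ε * Fintype.card ι ∨
        t * δ * Fintype.card ι ≤ (Finset.univ.filter fun k => S.q k ∈ W ⊔ vanSub N).card) := by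
    intro t
    induction t with
    | zero =>
      intro E ι κ _ _ _ _ _ S
      exact ⟨⊥, ⊤, inferInstance, by simp, codimLE_top.mono le_rfl (Nat.zero_le _),
        Or.inr (by simp)⟩
    | succ t ih =>
      intro E ι κ _ _ _ _ _ S
      obtain ⟨W, N, h0, h1, h2, h3⟩ := ih E ι κ S
      rcases le_or_gt ((Finset.univ.filter fun k => S.q k ∉ W ⊔ vanSub N).card : ℝ)
        (ε * Fintype.card ι) with hc | hc
      · exact ⟨W, N, h0, h1.trans (Nat.mul_le_mul_right _ t.le_succ),
          h2.mono le_rfl (Nat.mul_le_mul_right _ t.le_succ), Or.inl hc⟩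
      have h3 := h3.resolve_left (not_le.2 hc)
      obtain ⟨W', N', h0', h1', h2', h3'⟩ := h E ι κ S _ hc.le
      refine ⟨W ⊔ W', N ⊓ N', inferInstance, ?_, ?_, Or.inr ?_⟩
      · refine (Submodule.finrank_add_le_finrank_add_finrank W W').trans ?_
        rw [Nat.succ_mul]; omega
      · exact (h2.inf h2').mono le_rfl (by rw [Nat.succ_mul])
      · set A := Finset.univ.filter fun k => S.q k ∈ W ⊔ vanSub N with hA
        set B := (Finset.univ.filter fun k => S.q k ∉ W ⊔ vanSub N).filter
          fun k => S.q k ∈ W' ⊔ vanSub N' with hB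
        have hd : Disjoint A B := by
          rw [Finset.disjoint_left]
          intro k hk hk'
          simp only [hA, hB, Finset.mem_filter] at hk hk'
          exact hk'.1.2 hk.2
        have hs : A ∪ B ⊆ Finset.univ.filter fun k =>
            S.q k ∈ (W ⊔ W') ⊔ vanSub (N ⊓ N') := by
          intro k hk
          simp only [hA, hB, Finset.mem_union, Finset.mem_filter, Finset.mem_univ,
            true_and] at hk ⊢
          rcases hk with hk | hk
          · exact vanSub_inf_left _ _ _ _ hk
          · exact vanSub_inf_right _ _ _ _ hk.2
        have hc := Finset.card_le_card hs
        rw [Finset.card_union_of_disjoint hd] at hc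
        have hc' : (A.card : ℝ) + B.card ≤ (Finset.univ.filter fun k =>
          S.q k ∈ (W ⊔ W') ⊔ vanSub (N ⊓ N')).card := by exact_mod_cast hc
        have h4 : δ * Fintype.card ι ≤ B.card := by convert h3'
        push_cast
        nlinarith
  obtain ⟨t, ht⟩ := exists_nat_gt (1 / δ)
  rw [div_lt_iff₀ hδ] at ht
  refine ⟨t * C, fun E ι κ _ _ _ _ _ S => ?_⟩
  obtain ⟨W, N, h0, h1, h2, h3⟩ := key t E ι κ S
  refine ⟨W, N, h0, h1, h2, h3.elim id fun h3 => ?_⟩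
  have h4 := Finset.card_filter_add_card_filter_not (s := Finset.univ)
    (fun k => S.q k ∈ W ⊔ vanSub N)
  rw [Finset.card_univ] at h4
  have h5 : ((Finset.univ.filter fun k => S.q k ∈ W ⊔ vanSub N).card : ℝ) +
    (Finset.univ.filter fun k => S.q k ∉ W ⊔ vanSub N).card = Fintype.card ι := by
    exact_mod_cast h4
  have h6 : (0 : ℝ) ≤ Fintype.card ι := Nat.cast_nonneg _
  have h7 : (0 : ℝ) ≤ ((Finset.univ.filter fun k => S.q k ∉ W ⊔ vanSub N).card : ℝ) :=
    Nat.cast_nonneg _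
  have h8 : 0 ≤ ε * Fintype.card ι := by positivity
  nlinarith

section Sym

variable {E : Type*} [AddCommGroup E] [Module ℂ E]

/-- The linear map sending a quadratic form to its polar bilinear form. -/
def polarLin (E : Type*) [AddCommGroup E] [Module ℂ E] :
    QuadraticForm ℂ E →ₗ[ℂ] (E →ₗ[ℂ] E →ₗ[ℂ] ℂ) where
  toFun q := q.polarBilin
  map_add' p q := by ext x y; simp [QuadraticMap.polar_add]
  map_smul' c q := by ext x y; simp [QuadraticMap.polar_smul]

theorem polarLin_injective : Function.Injective (polarLin E) := by
  intro p q h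
  refine QuadraticForm.ext_iff'.2 fun x => ?_
  have h1 := LinearMap.congr_fun₂ h x x
  have h2 := QuadraticForm.polarBilin_self' p x
  have h3 := QuadraticForm.polarBilin_self' q x
  have h4 : p.polarBilin x x = q.polarBilin x x := h1
  rw [h2, h3] at h4
  exact mul_left_cancel₀ two_ne_zero h4

instance QuadraticForm.finiteDimensional [FiniteDimensional ℂ E] :
    FiniteDimensional ℂ (QuadraticForm ℂ E) :=
  FiniteDimensional.of_injective (polarLin E) polarLin_injective

theorem QuadraticForm.finrank_le [FiniteDimensional ℂ E] :
    finrank ℂ (QuadraticForm ℂ E) ≤ finrank ℂ E ^ 2 := by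
  refine (LinearMap.finrank_le_finrank_of_injective polarLin_injective).trans ?_
  rw [finrank_linearMap, finrank_linearMap, finrank_self, mul_one, sq]

/-- The quadratic forms whose radical contains `N`. -/
def symSub (N : Submodule ℂ E) : Submodule ℂ (QuadraticForm ℂ E) where
  carrier := {q | N ≤ q.rad}
  zero_mem' := fun x _ => QuadraticForm.mem_rad_of_forall_add fun y => by simp
  add_mem' := fun {a b} ha hb => (le_inf ha hb).trans (QuadraticForm.rad_inf_le_add a b)
  smul_mem' := fun c a ha => ha.trans (QuadraticForm.rad_le_smul c a)

theorem mem_symSub {N : Submodule ℂ E} {q : QuadraticForm ℂ E} : q ∈ symSub N ↔ N ≤ q.rad := Iff.rfl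

theorem symSub_le_vanSub [FiniteDimensional ℂ E] (N : Submodule ℂ E) : symSub N ≤ vanSub N :=
  fun _ hq _ hx => QuadraticForm.apply_of_mem_rad (hq hx)

theorem dualProd_mem_symSub {N : Submodule ℂ E} {c d : Dual ℂ E} {q : QuadraticForm ℂ E}
    (hq : ∀ x, q x = c x * d x) (hc : ∀ x ∈ N, c x = 0) (hd : ∀ x ∈ N, d x = 0) :
    q ∈ symSub N := fun _ hx =>
  IsProd.ker_inf_ker_le_rad hq ⟨hc _ hx, hd _ hx⟩

theorem finrank_symSub_le [FiniteDimensional ℂ E] {N : Submodule ℂ E} {C : ℕ} (h : CodimLE N C) :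
    finrank ℂ (symSub N) ≤ C ^ 2 := by
  obtain ⟨M, hM⟩ := Submodule.exists_isCompl N
  let f : symSub N →ₗ[ℂ] QuadraticForm ℂ M :=
    { toFun := fun q => (q : QuadraticForm ℂ E).comp M.subtype
      map_add' := fun p q => by ext x; simp
      map_smul' := fun c q => by ext x; simp }
  have hf : Function.Injective f := by
    intro p q hpq
    refine Subtype.ext (QuadraticForm.ext_iff'.2 fun x => ?_)
    have hx : x ∈ N ⊔ M := by rw [hM.sup_eq_top]; trivial
    obtain ⟨y, hy, z, hz, rfl⟩ := Submodule.mem_sup.1 hx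
    rw [QuadraticForm.map_add_of_mem_rad (p.2 hy), QuadraticForm.map_add_of_mem_rad (q.2 hy)]
    exact congrArg (fun g : QuadraticForm ℂ M => g ⟨z, hz⟩) hpq
  refine (LinearMap.finrank_le_finrank_of_injective hf).trans (QuadraticForm.finrank_le.trans ?_)
  have h1 := Submodule.finrank_add_eq_of_isCompl hM
  unfold CodimLE at h
  gcongr
  omega

end Sym

section Reg

variable {E : Type*} [AddCommGroup E] [Module ℂ E] [FiniteDimensional ℂ E]

theorem QuadraticForm.codimLE_rad_of_mem_vanSub {q : QuadraticForm ℂ E} {N : Submodule ℂ E} {C : ℕ}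
    (hN : CodimLE N C) (hq : q ∈ vanSub N) : CodimLE q.rad (2 * C) := by
  obtain ⟨M, hM⟩ := Submodule.exists_isCompl N
  have h1 := Submodule.finrank_add_eq_of_isCompl hM
  let g : E →ₗ[ℂ] (M →ₗ[ℂ] ℂ) := (LinearMap.lcomp ℂ ℂ M.subtype) ∘ₗ q.polarBilin
  have h2 : CodimLE (LinearMap.ker g) C := by
    have h3 := LinearMap.finrank_range_add_finrank_ker g
    have h4 := Submodule.finrank_le (LinearMap.range g)
    rw [finrank_linearMap, finrank_self, mul_one] at h4
    unfold CodimLE at hN ⊢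
    omega
  refine (hN.inf h2).mono (fun x hx => ?_) (by omega)
  obtain ⟨hx1, hx2⟩ := hx
  refine QuadraticForm.mem_rad.2 fun y => ?_
  have hy : y ∈ N ⊔ M := by rw [hM.sup_eq_top]; trivial
  obtain ⟨z, hz, w, hw, rfl⟩ := Submodule.mem_sup.1 hy
  have h5 : q.polarBilin x w = 0 := LinearMap.congr_fun hx2 ⟨w, hw⟩
  have h6 : q.polarBilin x z = 0 := by
    simp [QuadraticMap.polar, hq _ hx1, hq _ hz, hq _ (N.add_mem hx1 hz)]
  rw [map_add, h5, h6, add_zero]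

/-- No nonzero form of `W` vanishes on a subspace of codimension at most `R` of `N`. -/
def RegPair (W : Submodule ℂ (QuadraticForm ℂ E)) (N : Submodule ℂ E) (R : ℕ) : Prop :=
  ∀ w ∈ W, ∀ T : Submodule ℂ E, CodimLE T R → (∀ x ∈ N, x ∈ T → w x = 0) → w = 0

theorem RegPair.mono {W : Submodule ℂ (QuadraticForm ℂ E)} {N : Submodule ℂ E} {R R' : ℕ}
    (h : RegPair W N R) (hR : R' ≤ R) : RegPair W N R' :=
  fun w hw T hT => h w hw T (hT.mono le_rfl hR)

theorem exists_regPair (R D C : ℕ) : ∃ C' : ℕ, ∀ (E : Type) [AddCommGroup E] [Module ℂ E]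
    [FiniteDimensional ℂ E] (W : Submodule ℂ (QuadraticForm ℂ E)) (N : Submodule ℂ E),
    finrank ℂ W ≤ D → CodimLE N C → ∃ (W' : Submodule ℂ (QuadraticForm ℂ E)) (N' : Submodule ℂ E),
      N' ≤ N ∧ W ≤ W' ⊔ symSub N' ∧ finrank ℂ W' ≤ D ∧ CodimLE N' C' ∧ RegPair W' N' R := by
  induction D generalizing C with
  | zero =>
    refine ⟨C, fun E _ _ _ W N hW hN => ⟨W, N, le_rfl, le_sup_left, hW, hN, ?_⟩⟩
    intro w hw _ _ _
    rw [Nat.le_zero, Submodule.finrank_eq_zero] at hW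
    rw [hW] at hw
    exact (Submodule.mem_bot ℂ).1 hw
  | succ D ih =>
    obtain ⟨C', hC'⟩ := ih (C + 2 * (C + R))
    refine ⟨max C C', fun E _ _ _ W N hW hN => ?_⟩
    by_cases hreg : RegPair W N R
    · exact ⟨W, N, le_rfl, le_sup_left, hW, hN.mono le_rfl (le_max_left _ _), hreg⟩
    unfold RegPair at hreg
    push Not at hreg
    obtain ⟨w, hw, T, hT, hwT, hw0⟩ := hreg
    have hrad : CodimLE w.rad (2 * (C + R)) :=
      QuadraticForm.codimLE_rad_of_mem_vanSub (hN.inf hT) fun x hx => hwT x hx.1 hx.2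
    obtain ⟨V, hV⟩ := Submodule.exists_isCompl (Submodule.span ℂ {w})
    have hWle : W ≤ (W ⊓ V) ⊔ Submodule.span ℂ {w} := by
      intro v hv
      have : v ∈ Submodule.span ℂ {w} ⊔ V := by rw [hV.sup_eq_top]; trivial
      obtain ⟨y, hy, z, hz, rfl⟩ := Submodule.mem_sup.1 this
      have hyW : y ∈ W := (Submodule.span_singleton_le_iff_mem w W).2 hw hy
      have hzW : z ∈ W := by simpa using W.sub_mem hv hyW
      rw [sup_comm]
      exact Submodule.add_mem_sup hy ⟨hzW, hz⟩
    have hlt : W ⊓ V < W := lt_of_le_of_ne inf_le_left fun h => hw0 (by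
      have h1 : w ∈ V := (inf_eq_left.1 h) hw
      exact (Submodule.mem_bot ℂ).1 (hV.inf_eq_bot ▸ ⟨Submodule.mem_span_singleton_self w, h1⟩))
    have hfr := Submodule.finrank_lt_finrank_of_lt hlt
    obtain ⟨W', N', h1, h2, h3, h4, h5⟩ := hC' E (W ⊓ V) (N ⊓ w.rad) (by omega) (hN.inf hrad)
    refine ⟨W', N', h1.trans inf_le_left, hWle.trans (sup_le h2 ?_), h3.trans (Nat.le_succ _),
      h4.mono le_rfl (le_max_right _ _), h5⟩
    rw [Submodule.span_singleton_le_iff_mem]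
    exact Submodule.mem_sup_right (h1.trans inf_le_right)

end Reg

section Vanish

variable {E ι κ : Type*} [AddCommGroup E] [Module ℂ E] [FiniteDimensional ℂ E] [Fintype ι]
  (S : SGConfig E ι κ)

open Classical in
/-- The total codimension of the radicals of small rank, measured modulo `N`. -/
noncomputable def SGConfig.potential (N : Submodule ℂ E) : ℕ :=
  ∑ j, if CodimLE (S.q j).rad 4 then finrank ℂ E - finrank ℂ ↥((S.q j).rad ⊔ N) else 0

theorem SGConfig.potential_le (N : Submodule ℂ E) : S.potential N ≤ 4 * Fintype.card ι := by
  classical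
  unfold potential
  refine (Finset.sum_le_card_nsmul _ _ 4 fun j _ => ?_).trans (by simp [mul_comm])
  split_ifs with h
  · have h1 := Submodule.finrank_mono (le_sup_left : (S.q j).rad ≤ (S.q j).rad ⊔ N)
    unfold CodimLE at h
    omega
  · omega

open Classical in
theorem SGConfig.potential_add_le (N : Submodule ℂ E) (i : ι) (hi : S.q i ∉ vanSub N) :
    S.potential N + (Finset.univ.filter fun j => PairVanish (S.q i) (S.q j)).card ≤
      S.potential (N ⊓ (S.q i).rad) := by
  rw [Finset.card_filter, potential, ← Finset.sum_add_distrib, potential]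
  refine Finset.sum_le_sum fun j _ => ?_
  have hle : (S.q j).rad ⊔ N ⊓ (S.q i).rad ≤ (S.q j).rad ⊔ N := sup_le_sup_left inf_le_left _
  have h1 := Submodule.finrank_mono hle
  have h2 := Submodule.finrank_le ((S.q j).rad ⊔ N)
  by_cases hj : PairVanish (S.q i) (S.q j)
  · obtain ⟨c, d, hcd⟩ := hj
    have hcod : CodimLE (S.q j).rad 4 :=
      QuadraticForm.codimLE_rad_of_vanish fun x hx hx' => (hcd x hx hx').2
    have hlt : (S.q j).rad ⊔ N ⊓ (S.q i).rad < (S.q j).rad ⊔ N := by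
      refine lt_of_le_of_ne hle fun heq => hi fun x hx => ?_
      have hx' : x ∈ (S.q j).rad ⊔ N ⊓ (S.q i).rad := heq ▸ Submodule.mem_sup_right hx
      obtain ⟨g, hg, y, hy, rfl⟩ := Submodule.mem_sup.1 hx'
      rw [add_comm, QuadraticForm.map_add_of_mem_rad hy.2]
      have := QuadraticForm.rad_le_of_vanish (S.not_prod j) (fun x hx hx' => (hcd x hx hx').2) hg
      exact (hcd g this.1 this.2).1
    have h3 := Submodule.finrank_lt_finrank_of_lt hlt
    rw [if_pos hcod, if_pos hcod, if_pos ⟨c, d, hcd⟩]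
    omega
  · rw [if_neg hj]
    split_ifs <;> omega

open Classical in
theorem SGConfig.exists_vanSub_of_pairVanish (N : Submodule ℂ E) {C : ℕ} (hN : CodimLE N C) :
    ∃ N' ≤ N, CodimLE N' (C + 52) ∧ ∀ i, Fintype.card ι ≤
      3 * (Finset.univ.filter fun j => PairVanish (S.q i) (S.q j)).card → S.q i ∈ vanSub N' := by
  have key : ∀ t : ℕ, ∃ N' ≤ N, CodimLE N' (C + 4 * t) ∧ ((∀ i, Fintype.card ι ≤
      3 * (Finset.univ.filter fun j => PairVanish (S.q i) (S.q j)).card → S.q i ∈ vanSub N') ∨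
      t * Fintype.card ι ≤ 3 * S.potential N') := by
    intro t
    induction t with
    | zero => exact ⟨N, le_rfl, hN, Or.inr (by simp)⟩
    | succ t ih =>
      obtain ⟨N', h1, h2, h3⟩ := ih
      by_cases h4 : ∀ i, Fintype.card ι ≤
          3 * (Finset.univ.filter fun j => PairVanish (S.q i) (S.q j)).card → S.q i ∈ vanSub N'
      · exact ⟨N', h1, h2.mono le_rfl (by omega), Or.inl h4⟩
      have h3 := h3.resolve_left h4
      push Not at h4
      obtain ⟨i, hi, hi'⟩ := h4
      have hpos : 0 < Fintype.card ι := Fintype.card_pos_iff.2 ⟨i⟩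
      obtain ⟨j, hj⟩ : (Finset.univ.filter fun j => PairVanish (S.q i) (S.q j)).Nonempty := by
        rw [← Finset.card_pos]; omega
      obtain ⟨c, d, hcd⟩ := (Finset.mem_filter.1 hj).2
      have hcod : CodimLE (S.q i).rad 4 :=
        QuadraticForm.codimLE_rad_of_vanish fun x hx hx' => (hcd x hx hx').1
      refine ⟨N' ⊓ (S.q i).rad, inf_le_left.trans h1,
        (h2.inf hcod).mono le_rfl (by omega), Or.inr ?_⟩
      have := S.potential_add_le N' i hi'
      rw [Nat.succ_mul]
      omega
  obtain ⟨N', h1, h2, h3⟩ := key 13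
  refine ⟨N', h1, h2, h3.elim id fun h3 i => ?_⟩
  have hpos : 0 < Fintype.card ι := Fintype.card_pos_iff.2 ⟨i⟩
  have := S.potential_le N'
  omega

end Vanish

section RegLemmas

variable {E : Type*} [AddCommGroup E] [Module ℂ E] [FiniteDimensional ℂ E]
  {W : Submodule ℂ (QuadraticForm ℂ E)} {N : Submodule ℂ E} {R : ℕ}

theorem sup_symSub_le (W : Submodule ℂ (QuadraticForm ℂ E)) (N : Submodule ℂ E) :
    W ⊔ symSub N ≤ W ⊔ vanSub N := sup_le_sup_left (symSub_le_vanSub N) W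

theorem RegPair.mem_symSub (h : RegPair W N R) {v : QuadraticForm ℂ E} (hv : v ∈ W ⊔ symSub N)
    {T : Submodule ℂ E} (hT : CodimLE T R) (h0 : ∀ x ∈ N, x ∈ T → v x = 0) : v ∈ symSub N := by
  obtain ⟨w, hw, σ, hσ, rfl⟩ := Submodule.mem_sup.1 hv
  have : w = 0 := h w hw T hT fun x hx hx' => by
    have h1 := h0 x hx hx'
    have h2 := symSub_le_vanSub N hσ x hx
    rwa [add_apply, h2, add_zero] at h1
  rwa [this, zero_add]

theorem RegPair.mem_vanSub (h : RegPair W N R) {v : QuadraticForm ℂ E} (hv : v ∈ W ⊔ vanSub N)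
    {T : Submodule ℂ E} (hT : CodimLE T R) (h0 : ∀ x ∈ N, x ∈ T → v x = 0) : v ∈ vanSub N := by
  obtain ⟨w, hw, σ, hσ, rfl⟩ := Submodule.mem_sup.1 hv
  have : w = 0 := h w hw T hT fun x hx hx' => by
    have h1 := h0 x hx hx'
    rwa [add_apply, hσ x hx, add_zero] at h1
  rwa [this, zero_add]

theorem eq_zero_on_of_linMulLin_mem_vanSub {l g : Dual ℂ E} (hl : ∃ x ∈ N, l x ≠ 0)
    (h : QuadraticMap.linMulLin l g ∈ vanSub N) : ∀ x ∈ N, g x = 0 := by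
  rcases Submodule.mul_eq_zero_on N (f := l) (g := g) (PolyFun.dual l) (PolyFun.dual g)
    (fun x hx => h x hx) with h | h
  · obtain ⟨x, hx, hx'⟩ := hl
    exact absurd (h x hx) hx'
  · exact h

theorem eq_zero_of_linMulLin_mem_symSub {l g : Dual ℂ E} (hl : ∃ x ∈ N, l x ≠ 0)
    (h : QuadraticMap.linMulLin l g ∈ symSub N) : g = 0 := by
  have h1 := eq_zero_on_of_linMulLin_mem_vanSub hl (symSub_le_vanSub N h)
  obtain ⟨x, hx, hx'⟩ := hl
  ext y
  have h2 := QuadraticForm.polarBilin_of_mem_rad (h hx) y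
  have h3 : l x * g y = 0 := by
    rw [QuadraticMap.polarBilin_apply_apply, QuadraticMap.polar] at h2
    simp only [QuadraticMap.linMulLin_apply, map_add, h1 x hx] at h2
    linear_combination h2
  simpa [hx'] using h3

theorem RegPair.irrOn (h : RegPair W N 2) {q : QuadraticForm ℂ E} (hq : q ∈ W ⊔ symSub N)
    (hp : ¬ IsProd q) {l : Dual ℂ E} (hl : ∃ x ∈ N, l x ≠ 0) : IrrOn q l := by
  refine IrrOn.of_forall fun c d hcd => ?_
  have h1 : q ∈ symSub N := h.mem_symSub hq ((codimLE_ker c).inf (codimLE_ker l))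
    fun x hx hx' => by
      rw [hcd x hx'.2, show c x = 0 from hx'.1, zero_mul]
  obtain ⟨x, hx, hx'⟩ := hl
  exact (IrrOn.of_mem_rad hp (h1 hx) hx').not_forall c d hcd

/-- A factorization into linear forms on a subspace is unique. -/
theorem exists_scalar_of_mul_eq_mul_on {a b c d : Dual ℂ E} (K : Submodule ℂ E)
    (h : ∀ x ∈ K, a x * b x = c x * d x) (ha : ∃ x ∈ K, a x ≠ 0) (hb : ∃ x ∈ K, b x ≠ 0) :
    ∃ t : ℂ, t ≠ 0 ∧ ((∀ x ∈ K, c x = t * a x ∧ b x = t * d x) ∨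
      ∀ x ∈ K, d x = t * a x ∧ b x = t * c x) := by
  have key : ∀ c d : Dual ℂ E, (∀ x ∈ K, a x * b x = c x * d x) →
      (∀ x ∈ K ⊓ LinearMap.ker a, c x = 0) →
      ∃ t : ℂ, t ≠ 0 ∧ ∀ x ∈ K, c x = t * a x ∧ b x = t * d x := by
    intro c d h h0
    obtain ⟨t, ht⟩ := Dual.eq_smul_of_ker (a := a.domRestrict K) (b := c.domRestrict K)
      fun x hx => h0 x ⟨x.2, hx⟩
    have ht' : ∀ x ∈ K, c x = t * a x := fun x hx => by
      simpa using LinearMap.congr_fun ht ⟨x, hx⟩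
    have h2 : ∀ x ∈ K, b x = t * d x := by
      have := eq_zero_on_of_linMulLin_mem_vanSub (N := K) (l := a) (g := b - t • d) ha
        fun x hx => by
          have := h x hx
          rw [ht' x hx] at this
          simp only [QuadraticMap.linMulLin_apply, LinearMap.sub_apply, LinearMap.smul_apply,
            smul_eq_mul]
          linear_combination this
      intro x hx
      have := this x hx
      simp only [LinearMap.sub_apply, LinearMap.smul_apply, smul_eq_mul] at this
      linear_combination this
    refine ⟨t, ?_, fun x hx => ⟨ht' x hx, h2 x hx⟩⟩
    rintro rfl
    obtain ⟨x, hx, hx'⟩ := hb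
    exact hx' (by rw [h2 x hx, zero_mul])
  rcases Submodule.mul_eq_zero_on (K ⊓ LinearMap.ker a) (f := c) (g := d) (PolyFun.dual c)
    (PolyFun.dual d) (fun x hx => by
      rw [← h x hx.1, show a x = 0 from hx.2, zero_mul]) with h0 | h0
  · obtain ⟨t, ht, h1⟩ := key c d h h0
    exact ⟨t, ht, Or.inl h1⟩
  · obtain ⟨t, ht, h1⟩ := key d c (fun x hx => by rw [h x hx, mul_comm]) h0
    exact ⟨t, ht, Or.inr h1⟩

end RegLemmas

section Nbrs

variable {E ι κ : Type*} [AddCommGroup E] [Module ℂ E] [FiniteDimensional ℂ E]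
  {S : SGConfig E ι κ} {W : Submodule ℂ (QuadraticForm ℂ E)} {N : Submodule ℂ E}

open Classical in
theorem SGConfig.card_third_le [Fintype ι] {V : Submodule ℂ (QuadraticForm ℂ E)} {i : ι}
    (hi : S.q i ∉ V) :
    (Finset.univ.filter fun j => S.q j ∈ V ∧
      ∃ k, k ≠ i ∧ k ≠ j ∧ S.q k ∈ Submodule.span ℂ {S.q i, S.q j}).card ≤
      (Finset.univ.filter fun k => S.q k ∉ V).card := by
  have h : ∀ j, ∃ k, (S.q j ∈ V ∧
      ∃ k, k ≠ i ∧ k ≠ j ∧ S.q k ∈ Submodule.span ℂ {S.q i, S.q j}) →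
      k ≠ i ∧ k ≠ j ∧ S.q k ∈ Submodule.span ℂ {S.q i, S.q j} := fun j => by
    by_cases hj : S.q j ∈ V ∧
      ∃ k, k ≠ i ∧ k ≠ j ∧ S.q k ∈ Submodule.span ℂ {S.q i, S.q j}
    · exact ⟨hj.2.choose, fun _ => hj.2.choose_spec⟩
    · exact ⟨i, fun h => absurd h hj⟩
  choose k hk using h
  -- the third form is `α F + β G` with `α ≠ 0`, `β ≠ 0`
  have hcoef : ∀ j, (S.q j ∈ V ∧
      ∃ k, k ≠ i ∧ k ≠ j ∧ S.q k ∈ Submodule.span ℂ {S.q i, S.q j}) →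
      ∃ α β : ℂ, α ≠ 0 ∧ β ≠ 0 ∧ α • S.q i + β • S.q j = S.q (k j) := fun j hj => by
    obtain ⟨h1, h2, h3⟩ := hk j hj
    obtain ⟨α, β, h⟩ := Submodule.mem_span_pair.1 h3
    refine ⟨α, β, ?_, ?_, h⟩
    · rintro rfl
      exact h2 (S.eq_of_smul (c := β) (by rw [← h]; module))
    · rintro rfl
      exact h1 (S.eq_of_smul (c := α) (by rw [← h]; module))
  refine Finset.card_le_card_of_injOn k (fun j hj => ?_) fun j hj j' hj' hjj => ?_
  · have hj := (Finset.mem_filter.1 hj).2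
    obtain ⟨α, β, hα, -, h⟩ := hcoef j hj
    simp only [Finset.coe_filter, Finset.mem_univ, true_and, Set.mem_ofPred_eq]
    intro hV
    refine hi ?_
    have h1 : α • S.q i ∈ V := by
      have := V.sub_mem hV (V.smul_mem β hj.1)
      rwa [← h, add_sub_cancel_right] at this
    exact (V.smul_mem_iff hα).1 h1
  · have hj := (Finset.mem_filter.1 hj).2
    have hj' := (Finset.mem_filter.1 hj').2
    obtain ⟨α, β, hα, hβ, h⟩ := hcoef j hj
    obtain ⟨α', β', hα', hβ', h'⟩ := hcoef j' hj'
    rw [hjj, ← h'] at h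
    have h1 : (α - α') • S.q i = β' • S.q j' - β • S.q j := by
      rw [sub_smul, sub_eq_sub_iff_add_eq_add, h]
      abel
    have h2 : α - α' = 0 := by
      by_contra hne
      refine hi ((V.smul_mem_iff hne).1 ?_)
      rw [h1]
      exact V.sub_mem (V.smul_mem _ hj'.1) (V.smul_mem _ hj.1)
    rw [h2, zero_smul] at h1
    refine S.eq_of_smul (c := β⁻¹ * β') ?_
    rw [mul_smul, sub_eq_zero.1 h1.symm, smul_smul, inv_mul_cancel₀ hβ, one_smul]

/-- All product neighbours of a form outside `W ⊔ vanSub N` differ from it by products of linear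
forms with prescribed restrictions to `N`. -/
theorem SGConfig.exists_common_factors (hreg : RegPair W N 2) {i : ι}
    (hi : S.q i ∉ W ⊔ vanSub N) {j₀ : ι} (hj₀ : S.q j₀ ∈ W ⊔ vanSub N)
    (hp₀ : PairProd (S.q i) (S.q j₀)) :
    ∃ a b : Dual ℂ E, (∃ x ∈ N, a x ≠ 0) ∧ (∃ x ∈ N, b x ≠ 0) ∧
      ∀ j, S.q j ∈ W ⊔ vanSub N → PairProd (S.q i) (S.q j) → ∃ (s : ℂ) (c d : Dual ℂ E), s ≠ 0 ∧
        s • S.q j = S.q i - QuadraticMap.linMulLin c d ∧ (∀ x ∈ N, c x = a x) ∧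
        ∀ x ∈ N, d x = b x := by
  have key : ∀ j, PairProd (S.q i) (S.q j) → ∃ (s : ℂ) (c d : Dual ℂ E), s ≠ 0 ∧
      s • S.q j = S.q i - QuadraticMap.linMulLin c d := by
    rintro j ⟨α, β, hα, hβ, c, d, h⟩
    refine ⟨-(β / α), α⁻¹ • c, d, by simp [hα, hβ], QuadraticForm.ext_iff'.2 fun x => ?_⟩
    have := h x
    simp only [add_apply, smul_apply, smul_eq_mul, sub_apply, QuadraticMap.linMulLin_apply,
      LinearMap.smul_apply] at this ⊢
    field_simp
    linear_combination -this
  obtain ⟨s₀, a, b, hs₀, h₀⟩ := key j₀ hp₀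
  have hab : ¬ ∀ x ∈ N, a x * b x = 0 := fun h => hi (by
    have h1 : S.q i = s₀ • S.q j₀ + QuadraticMap.linMulLin a b := by rw [h₀]; abel
    rw [h1]
    exact Submodule.add_mem _ (Submodule.smul_mem _ _ hj₀) (Submodule.mem_sup_right h))
  push Not at hab
  obtain ⟨x, hx, hab⟩ := hab
  have ha : ∃ x ∈ N, a x ≠ 0 := ⟨x, hx, left_ne_zero_of_mul hab⟩
  have hb : ∃ x ∈ N, b x ≠ 0 := ⟨x, hx, right_ne_zero_of_mul hab⟩
  refine ⟨a, b, ha, hb, fun j hj hp => ?_⟩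
  obtain ⟨s, c, d, hs, h⟩ := key j hp
  have hmem : QuadraticMap.linMulLin a b - QuadraticMap.linMulLin c d ∈ W ⊔ vanSub N := by
    have h1 : QuadraticMap.linMulLin a b - QuadraticMap.linMulLin c d =
      s • S.q j - s₀ • S.q j₀ := by rw [h, h₀]; abel
    rw [h1]
    exact Submodule.sub_mem _ (Submodule.smul_mem _ _ hj) (Submodule.smul_mem _ _ hj₀)
  have hvan := hreg.mem_vanSub hmem ((codimLE_ker a).inf (codimLE_ker c)) fun y _ hy => by
    have h1 : a y = 0 := hy.1
    have h2 : c y = 0 := hy.2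
    simp [h1, h2]
  obtain ⟨t, ht, h1⟩ := exists_scalar_of_mul_eq_mul_on (c := c) (d := d) N (fun y hy => by
    have := hvan y hy
    simp only [sub_apply, QuadraticMap.linMulLin_apply] at this
    linear_combination this) ha hb
  rcases h1 with h1 | h1
  · refine ⟨s, t⁻¹ • c, t • d, hs, ?_, fun y hy => ?_, fun y hy => ?_⟩
    · rw [h]
      refine QuadraticForm.ext_iff'.2 fun y => ?_
      simp only [sub_apply, QuadraticMap.linMulLin_apply, LinearMap.smul_apply, smul_eq_mul]
      field_simp
    · rw [LinearMap.smul_apply, smul_eq_mul, (h1 y hy).1, inv_mul_cancel_left₀ ht]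
    · rw [LinearMap.smul_apply, smul_eq_mul, (h1 y hy).2]
  · refine ⟨s, t⁻¹ • d, t • c, hs, ?_, fun y hy => ?_, fun y hy => ?_⟩
    · rw [h]
      refine QuadraticForm.ext_iff'.2 fun y => ?_
      simp only [sub_apply, QuadraticMap.linMulLin_apply, LinearMap.smul_apply, smul_eq_mul]
      field_simp
    · rw [LinearMap.smul_apply, smul_eq_mul, (h1 y hy).1, inv_mul_cancel_left₀ ht]
    · rw [LinearMap.smul_apply, smul_eq_mul, (h1 y hy).2]

theorem SGConfig.exists_sq_of_common_factors (hreg : RegPair W N 2) {i : ι} {a b : Dual ℂ E}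
    (ha : ∃ x ∈ N, a x ≠ 0) (hb : ∃ x ∈ N, b x ≠ 0) {P : ι → Prop}
    (hP : ∀ j, P j → S.q j ∈ W ⊔ symSub N)
    (h : ∀ j, P j → ∃ (s : ℂ) (c d : Dual ℂ E), s ≠ 0 ∧
        s • S.q j = S.q i - QuadraticMap.linMulLin c d ∧ (∀ x ∈ N, c x = a x) ∧
        ∀ x ∈ N, d x = b x) {j₀ j₁ : ι} (hj₀ : P j₀) (hj₁ : P j₁) (hne : j₁ ≠ j₀) :
    ∃ e : Dual ℂ E, (∃ x ∈ N, e x ≠ 0) ∧ ∀ j, P j → ∃ (s : ℂ) (u : Dual ℂ E), s ≠ 0 ∧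
      (∀ x ∈ N, u x = 0) ∧ s • S.q j = S.q i - QuadraticMap.linMulLin (e - u) (e + u) := by
  obtain ⟨s₀, c₀, d₀, hs₀, h₀, hc₀, hd₀⟩ := h j₀ hj₀
  have key : ∀ j, P j → ∀ (s : ℂ) (c d : Dual ℂ E),
      s • S.q j = S.q i - QuadraticMap.linMulLin c d → (∀ x ∈ N, c x = a x) →
      (∀ x ∈ N, d x = b x) → ∀ x ∈ N, ∀ y, a x * (d y - d₀ y) + b x * (c y - c₀ y) = 0 := by
    intro j hj s c d h hc hd x hx y
    have hmem : QuadraticMap.linMulLin c₀ d₀ - QuadraticMap.linMulLin c d ∈ W ⊔ symSub N := by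
      have h1 : QuadraticMap.linMulLin c₀ d₀ - QuadraticMap.linMulLin c d =
        s • S.q j - s₀ • S.q j₀ := by rw [h, h₀]; abel
      rw [h1]
      exact Submodule.sub_mem _ (Submodule.smul_mem _ _ (hP j hj))
        (Submodule.smul_mem _ _ (hP j₀ hj₀))
    have hsym := hreg.mem_symSub hmem (codimLE_top.mono le_rfl (Nat.zero_le _)) fun y hy _ => by
      simp [hc y hy, hd y hy, hc₀ y hy, hd₀ y hy]
    have h2 := QuadraticForm.polarBilin_of_mem_rad (hsym hx) y
    rw [QuadraticMap.polarBilin_apply_apply, QuadraticMap.polar] at h2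
    simp only [sub_apply, QuadraticMap.linMulLin_apply, map_add, hc x hx, hd x hx, hc₀ x hx,
      hd₀ x hx] at h2
    linear_combination -h2
  obtain ⟨xb, hxb, hxb'⟩ := hb
  by_cases hind : ∃ x ∈ N, b x = 0 ∧ a x ≠ 0
  · exfalso
    obtain ⟨x, hx, hx0, hx'⟩ := hind
    obtain ⟨s, c, d, hs, h, hc, hd⟩ := h j₁ hj₁
    have hk := key j₁ hj₁ s c d h hc hd
    have hdd : d = d₀ := by
      ext y
      have := hk x hx y
      rw [hx0, zero_mul, add_zero] at this
      simpa [hx', sub_eq_zero] using this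
    have hcc : c = c₀ := by
      ext y
      have := hk xb hxb y
      rw [hdd, sub_self, mul_zero, zero_add] at this
      simpa [hxb', sub_eq_zero] using this
    rw [hdd, hcc, ← h₀] at h
    refine hne (S.eq_of_smul (c := s⁻¹ * s₀) ?_)
    rw [mul_smul, ← h, smul_smul, inv_mul_cancel₀ hs, one_smul]
  push Not at hind
  obtain ⟨μ, hμ⟩ := Dual.eq_smul_of_ker (a := b.domRestrict N) (b := a.domRestrict N)
    fun x hx => hind x x.2 hx
  have hμ' : ∀ x ∈ N, a x = μ * b x := fun x hx => by simpa using LinearMap.congr_fun hμ ⟨x, hx⟩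
  have hμ0 : μ ≠ 0 := by
    rintro rfl
    obtain ⟨x, hx, hx'⟩ := ha
    exact hx' (by rw [hμ' x hx, zero_mul])
  obtain ⟨ν, hν⟩ := IsAlgClosed.exists_pow_nat_eq μ (n := 2) two_pos
  rw [eq_comm] at hν
  have hν0 : ν ≠ 0 := by rintro rfl; exact hμ0 (by rw [hν]; ring)
  refine ⟨(1 / 2 : ℂ) • (ν⁻¹ • c₀ + ν • d₀), ⟨xb, hxb, ?_⟩, fun j hj => ?_⟩
  · have : ((1 / 2 : ℂ) • (ν⁻¹ • c₀ + ν • d₀)) xb = ν * b xb := by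
      simp only [LinearMap.add_apply, LinearMap.smul_apply, smul_eq_mul, hc₀ xb hxb, hd₀ xb hxb,
        hμ' xb hxb, hν]
      field_simp
      ring
    rw [this]
    exact mul_ne_zero hν0 hxb'
  · obtain ⟨s, c, d, hs, h, hc, hd⟩ := h j hj
    have hk := key j hj s c d h hc hd xb hxb
    have hk' : ∀ y, μ * (d y - d₀ y) + (c y - c₀ y) = 0 := fun y => by
      have := hk y
      rw [hμ' xb hxb] at this
      have h3 : b xb * (μ * (d y - d₀ y) + (c y - c₀ y)) = 0 := by linear_combination this
      exact (mul_eq_zero.1 h3).resolve_left hxb'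
    refine ⟨s, (1 / 2 : ℂ) • (ν • d - ν⁻¹ • c), hs, fun x hx => ?_, ?_⟩
    · simp only [LinearMap.sub_apply, LinearMap.smul_apply, smul_eq_mul, hc x hx, hd x hx,
        hμ' x hx, hν]
      field_simp
      ring
    · rw [h]
      refine QuadraticForm.ext_iff'.2 fun y => ?_
      have h4 : c y = c₀ y - ν ^ 2 * (d y - d₀ y) := by
        rw [← hν]; linear_combination hk' y
      simp only [LinearMap.sub_apply, LinearMap.add_apply, LinearMap.smul_apply, smul_eq_mul,
        sub_apply, QuadraticMap.linMulLin_apply, h4]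
      field_simp
      ring

end Nbrs

section Step

variable {E ι κ : Type*} [AddCommGroup E] [Module ℂ E] [FiniteDimensional ℂ E]
  {S : SGConfig E ι κ} {W : Submodule ℂ (QuadraticForm ℂ E)} {N : Submodule ℂ E}

theorem SGConfig.card_le_of_fibers [DecidableEq ι] (i : ι) (J T : Finset ι) (l : ι → Dual ℂ E)
    (hl : ∀ j ∈ J, ∀ j' ∈ J, j ≠ j' → LinearIndependent ℂ ![l j, l j'])
    (h : ∀ j ∈ J, ∃ k ∈ T, k ≠ i ∧ ∃ (μ : ℂ) (g : Dual ℂ E), ∀ x,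
      S.q k x = μ * S.q i x + l j x * g x) : J.card ≤ 6 * T.card := by
  have h' : ∀ j, ∃ k, j ∈ J → k ∈ T ∧ k ≠ i ∧ ∃ (μ : ℂ) (g : Dual ℂ E), ∀ x,
      S.q k x = μ * S.q i x + l j x * g x := fun j => by
    by_cases hj : j ∈ J
    · obtain ⟨k, hk⟩ := h j hj
      exact ⟨k, fun _ => hk⟩
    · exact ⟨i, fun h => absurd h hj⟩
  choose k hk using h'
  refine Finset.card_le_mul_card_image_of_maps_to (f := k) (fun j hj => (hk j hj).1) 6
    fun r hr => ?_
  by_cases hri : r = i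
  · rw [Finset.filter_false_of_mem]
    · simp
    · intro j hj h
      exact (hk j hj).2.1 (h.trans hri)
  · refine card_le_six_of_fiber (A := S.q r) (S.not_prod i) (fun c hc => hri (S.eq_of_smul hc)) _ l
      (fun j hj j' hj' => hl j (Finset.mem_filter.1 hj).1 j' (Finset.mem_filter.1 hj').1)
      fun j hj => ?_
    obtain ⟨h1, h2⟩ := Finset.mem_filter.1 hj
    have := (hk j h1).2.2
    rwa [h2] at this

theorem linearIndependent_sub_of_vanish {e u v : Dual ℂ E} (he : ∃ x ∈ N, e x ≠ 0)
    (hu : ∀ x ∈ N, u x = 0) (hv : ∀ x ∈ N, v x = 0) (huv : u ≠ v) :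
    LinearIndependent ℂ ![e - u, e - v] := by
  rw [LinearIndependent.pair_iff]
  intro s t hst
  obtain ⟨x, hx, hx'⟩ := he
  have h1 : s + t = 0 := by
    have := LinearMap.congr_fun hst x
    simp only [LinearMap.add_apply, LinearMap.smul_apply, LinearMap.sub_apply, hu x hx, hv x hx,
      sub_zero, smul_eq_mul, LinearMap.zero_apply] at this
    have : (s + t) * e x = 0 := by linear_combination this
    exact (mul_eq_zero.1 this).resolve_right hx'
  have h2 : t = -s := by linear_combination h1
  have h3 : s • (v - u) = 0 := by
    rw [← hst, h2]; module
  have h4 : s = 0 := (smul_eq_zero.1 h3).resolve_right (sub_ne_zero.2 huv.symm)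
  exact ⟨h4, by rw [h2, h4, neg_zero]⟩

theorem mem_span_sup_symSub {q w : QuadraticForm ℂ E} {s : ℂ} (hs : s ≠ 0) {t : ℂ}
    {c d : Dual ℂ E} (h : s • q = t • w + QuadraticMap.linMulLin c d) {M : Submodule ℂ E}
    (hc : ∀ x ∈ M, c x = 0) (hd : ∀ x ∈ M, d x = 0) :
    q ∈ Submodule.span ℂ {w} ⊔ symSub M := by
  rw [← Submodule.smul_mem_iff _ hs, h]
  exact Submodule.add_mem_sup
    (Submodule.smul_mem _ _ (Submodule.mem_span_singleton_self w))
    (dualProd_mem_symSub (fun x => QuadraticMap.linMulLin_apply _ _ x) hc hd)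

theorem finrank_span_sup_symSub_le (w : QuadraticForm ℂ E) {M : Submodule ℂ E} {C : ℕ}
    (hM : CodimLE M C) : finrank ℂ ↥(Submodule.span ℂ {w} ⊔ symSub M) ≤ 1 + C ^ 2 := by
  refine (Submodule.finrank_add_le_finrank_add_finrank _ _).trans (add_le_add ?_ ?_)
  · exact (finrank_span_le_card ({w} : Set _)).trans (by simp)
  · exact finrank_symSub_le hM

/-- A third form meeting `q i` along `l` is captured by the regular pair only trivially. -/
theorem RegPair.eq_of_third (hreg : RegPair W N 2) {i k : ι} {l g : Dual ℂ E} {μ : ℂ}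
    (hl : ∃ x ∈ N, l x ≠ 0) (hi : S.q i ∈ W ⊔ symSub N) (hk : S.q k ∈ W ⊔ symSub N)
    (h : ∀ x, S.q k x = μ * S.q i x + l x * g x) : k = i := by
  have h1 : QuadraticMap.linMulLin l g = S.q k - μ • S.q i :=
    QuadraticForm.ext_iff'.2 fun x => by simp [h x]
  have h2 : QuadraticMap.linMulLin l g ∈ W ⊔ symSub N := by
    rw [h1]
    exact Submodule.sub_mem _ hk (Submodule.smul_mem _ _ hi)
  have h3 := hreg.mem_symSub h2 ((codimLE_ker l).mono le_rfl one_le_two) fun x _ hx => by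
    simp [show l x = 0 from hx]
  have h4 := eq_zero_of_linMulLin_mem_symSub hl h3
  exact S.eq_of_forall (c := μ) fun x => by simp [h x, h4]

theorem RegPair.third_mem (hreg : RegPair W N 2) {i k : ι} {l g : Dual ℂ E} {μ : ℂ}
    (hl : ∃ x ∈ N, l x ≠ 0) (hi : S.q i ∈ W ⊔ symSub N) (hk : S.q k ∈ W ⊔ vanSub N)
    (h : ∀ x, S.q k x = μ * S.q i x + l x * g x) : ∀ x ∈ N, g x = 0 := by
  have h1 : QuadraticMap.linMulLin l g = S.q k - μ • S.q i :=
    QuadraticForm.ext_iff'.2 fun x => by simp [h x]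
  have h2 : QuadraticMap.linMulLin l g ∈ W ⊔ vanSub N := by
    rw [h1]
    exact Submodule.sub_mem _ hk (Submodule.smul_mem _ _ (sup_symSub_le W N hi))
  exact eq_zero_on_of_linMulLin_mem_vanSub hl
    (hreg.mem_vanSub h2 ((codimLE_ker l).mono le_rfl one_le_two) fun x _ hx => by
      simp [show l x = 0 from hx])

variable [Fintype ι] [Finite κ]

open Classical in
theorem SGConfig.exists_capture_step (hreg : RegPair W N 2) {C : ℕ} (hN : CodimLE N C)
    (hR : 100 * (Finset.univ.filter fun k => S.q k ∉ W ⊔ vanSub N).card ≤ Fintype.card ι) {i : ι}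
    (hi : S.q i ∉ W ⊔ vanSub N)
    (hnb : Fintype.card ι ≤ 2 * (Finset.univ.filter fun j => S.q j ∈ W ⊔ vanSub N ∧
      PairProd (S.q i) (S.q j)).card) :
    ∃ W' : Submodule ℂ (QuadraticForm ℂ E), finrank ℂ W' ≤ 1 + (C + 2) ^ 2 ∧
      Fintype.card ι ≤ 100 * (Finset.univ.filter fun j => S.q j ∉ W ⊔ symSub N ∧
        S.q j ∈ W').card := by
  by_contra hcon
  push Not at hcon
  set m := Fintype.card ι with hm
  set R := Finset.univ.filter fun k => S.q k ∉ W ⊔ vanSub N with hRdef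
  set J := Finset.univ.filter fun j => S.q j ∈ W ⊔ vanSub N ∧ PairProd (S.q i) (S.q j) with hJ
  have hm100 : 100 ≤ m := by
    have : 0 < R.card := Finset.card_pos.2 ⟨i, by simp [hRdef, hi]⟩
    omega
  obtain ⟨j₀, hj₀⟩ : J.Nonempty := Finset.card_pos.1 (by omega)
  have hj₀' := (Finset.mem_filter.1 hj₀).2
  obtain ⟨a, b, ha, hb, hab⟩ := SGConfig.exists_common_factors hreg hi hj₀'.1 hj₀'.2
  -- few of the neighbours lie outside `W ⊔ symSub N`
  set J₁ := J.filter fun j => S.q j ∉ W ⊔ symSub N with hJ₁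
  set J₂ := J.filter fun j => S.q j ∈ W ⊔ symSub N with hJ₂
  have hJ₁c : 100 * J₁.card < m := by
    refine lt_of_le_of_lt (Nat.mul_le_mul_left _ (Finset.card_le_card fun j hj => ?_))
      (hcon (Submodule.span ℂ {S.q i} ⊔ symSub (N ⊓ (LinearMap.ker a ⊓ LinearMap.ker b)))
        (finrank_span_sup_symSub_le _ (hN.inf ((codimLE_ker a).inf (codimLE_ker b)))))
    obtain ⟨hj1, hj2⟩ := Finset.mem_filter.1 hj
    obtain ⟨-, hj3, hj4⟩ := Finset.mem_filter.1 hj1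
    refine Finset.mem_filter.2 ⟨Finset.mem_univ _, hj2, ?_⟩
    obtain ⟨s, c, d, hs, h, hc, hd⟩ := hab j hj3 hj4
    refine mem_span_sup_symSub (t := 1) (c := -c) (d := d) hs ?_ (fun x hx => ?_) fun x hx => ?_
    · rw [h]
      refine QuadraticForm.ext_iff'.2 fun x => ?_
      simp
      ring
    · simp [hc x hx.1, show a x = 0 from hx.2.1]
    · rw [hd x hx.1, show b x = 0 from hx.2.2]
  have hJc : J₂.card + J₁.card = J.card :=
    Finset.card_filter_add_card_filter_not (s := J) fun j => S.q j ∈ W ⊔ symSub N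
  obtain ⟨j₁, hj₁, j₂, hj₂, hne⟩ := Finset.one_lt_card.1 (show 1 < J₂.card by omega)
  have hJ₂mem : ∀ j ∈ J₂, S.q j ∈ W ⊔ symSub N ∧ j ∈ J := fun j hj =>
    (Finset.mem_filter.1 hj).symm
  obtain ⟨e, he, hsq⟩ := SGConfig.exists_sq_of_common_factors (P := fun j => j ∈ J₂) hreg ha hb
    (fun j hj => (hJ₂mem j hj).1)
    (fun j hj => by
      obtain ⟨-, h1, h2⟩ := Finset.mem_filter.1 (hJ₂mem j hj).2
      exact hab j h1 h2) hj₂ hj₁ hne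
  have hsq' : ∀ j, ∃ (s : ℂ) (u : Dual ℂ E), j ∈ J₂ → s ≠ 0 ∧ (∀ x ∈ N, u x = 0) ∧
      s • S.q j = S.q i - QuadraticMap.linMulLin (e - u) (e + u) := fun j => by
    by_cases hj : j ∈ J₂
    · obtain ⟨s, u, h⟩ := hsq j hj
      exact ⟨s, u, fun _ => h⟩
    · exact ⟨0, 0, fun h => absurd h hj⟩
  choose s u hsu using hsq'
  have hlne : ∀ j ∈ J₂, ∃ x ∈ N, (e - u j) x ≠ 0 := fun j hj => by
    obtain ⟨x, hx, hx'⟩ := he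
    exact ⟨x, hx, by simpa [(hsu j hj).2.1 x hx] using hx'⟩
  have hlind : ∀ j ∈ J₂, ∀ j' ∈ J₂, j ≠ j' →
      LinearIndependent ℂ ![(e - u j), (e - u j')] := fun j hj j' hj' hne => by
    refine linearIndependent_sub_of_vanish he (hsu j hj).2.1 (hsu j' hj').2.1 fun h => hne ?_
    have h1 := (hsu j hj).2.2
    rw [h, ← (hsu j' hj').2.2] at h1
    refine S.eq_of_smul (c := (s j)⁻¹ * s j') ?_
    rw [mul_smul, ← h1, smul_smul, inv_mul_cancel₀ (hsu j hj).1, one_smul]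
  -- the relation between `q i` and `q j`
  have hrel : ∀ j ∈ J₂, ∀ x, s j * S.q j x = S.q i x - (e - u j) x * (e + u j) x := fun j hj x => by
    have := congrArg (fun q : QuadraticForm ℂ E => q x) (hsu j hj).2.2
    simpa [mul_add] using this
  set T₁ := R ∪ J₁ with hT₁
  set J₃ := J₂.filter fun j => ∃ k ∈ T₁, k ≠ i ∧ ∃ (μ : ℂ) (g : Dual ℂ E), ∀ x,
      S.q k x = μ * S.q i x + (e - u j) x * g x with hJ₃
  have hJ₃c : J₃.card ≤ 6 * T₁.card :=
    S.card_le_of_fibers i J₃ T₁ (fun j => e - u j)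
      (fun j hj j' hj' => hlind j (Finset.mem_filter.1 hj).1 j' (Finset.mem_filter.1 hj').1)
      fun j hj => (Finset.mem_filter.1 hj).2
  -- the remaining `e - u j` are proportional to members of the configuration
  have hmemf : ∀ j ∈ J₂ \ J₃, ∃ k, ∃ a : ℂ, S.f k = a • (e - u j) := fun j hj => by
    obtain ⟨hj, hj3⟩ := Finset.mem_sdiff.1 hj
    obtain ⟨hs, hu, -⟩ := hsu j hj
    have hjA := (hJ₂mem j hj).1
    have hji : j ≠ i := fun h => hi (h ▸ sup_symSub_le W N hjA)
    have hirr := hreg.irrOn hjA (S.not_prod j) (hlne j hj)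
    rcases S.exists_of_irrOn hji hirr (fun x hx hx' => by
      have := hrel j hj x
      rw [hx, hx'] at this
      linear_combination -this) with ⟨k, ⟨hkj, hki⟩, μ, g, h⟩ | h
    · exfalso
      have hμ : μ ≠ 0 := by
        rintro rfl
        exact S.not_prod k ⟨e - u j, g, fun x => by rw [h x]; ring⟩
      have hrel' : ∀ x, S.q k x = (μ / s j) * S.q i x +
          (e - u j) x * (g - (μ / s j) • (e + u j)) x := fun x => by
        have h1 : S.q j x = (S.q i x - (e - u j) x * (e + u j) x) / s j := by
          rw [← hrel j hj x, mul_div_cancel_left₀ _ hs]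
        rw [h x, h1]
        simp only [LinearMap.sub_apply, LinearMap.smul_apply, smul_eq_mul]
        field_simp
        ring
      refine hj3 (Finset.mem_filter.2 ⟨hj, k, ?_, hki, _, _, hrel'⟩)
      rw [hT₁, Finset.mem_union]
      by_cases hkB : S.q k ∈ W ⊔ vanSub N
      · right
        refine Finset.mem_filter.2 ⟨Finset.mem_filter.2 ⟨Finset.mem_univ _, hkB, ?_⟩, fun hkA => ?_⟩
        · refine ⟨-(μ / s j), 1, neg_ne_zero.2 (div_ne_zero hμ hs), one_ne_zero, e - u j,
            g - (μ / s j) • (e + u j), fun x => ?_⟩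
          rw [add_apply, smul_apply, smul_apply, smul_eq_mul, smul_eq_mul, hrel' x]
          ring
        · exact hkj (hreg.eq_of_third (hlne j hj) hjA hkA h)
      · left
        simp [hRdef, hkB]
    · exact h
  obtain ⟨hj₁A, -⟩ := hJ₂mem j₁ hj₁
  set M := N ⊓ LinearMap.ker e with hMdef
  set T₂ := Finset.univ.filter fun j => S.q j ∉ W ⊔ symSub N ∧
    S.q j ∈ Submodule.span ℂ {S.q j₁} ⊔ symSub M with hT₂
  have hT₂c : 100 * T₂.card < m :=
    hcon _ ((finrank_span_sup_symSub_le _ (hN.inf (codimLE_ker e))).trans (by gcongr; omega))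
  have hJ₄c : (J₂ \ J₃).card ≤ 6 * (R ∪ T₂).card := by
    refine S.card_le_of_fibers j₁ _ _ (fun j => e - u j)
      (fun j hj j' hj' => hlind j (Finset.mem_sdiff.1 hj).1 j' (Finset.mem_sdiff.1 hj').1)
      fun j hj => ?_
    have hj2 := (Finset.mem_sdiff.1 hj).1
    obtain ⟨r, t, hr⟩ := hmemf j hj
    have ht : t ≠ 0 := by
      rintro rfl
      exact S.f_ne r (by rw [hr, zero_smul])
    have hrne : ∃ x ∈ N, S.f r x ≠ 0 := by
      obtain ⟨x, hx, hx'⟩ := hlne j hj2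
      exact ⟨x, hx, by rw [hr]; exact mul_ne_zero ht hx'⟩
    obtain ⟨k, hk, μ, g, h⟩ := S.exists_of_irrOn_f (hreg.irrOn hj₁A (S.not_prod j₁) hrne)
    refine ⟨k, ?_, hk, μ, t • g, fun x => ?_⟩
    · rw [Finset.mem_union]
      by_cases hkB : S.q k ∈ W ⊔ vanSub N
      · right
        refine Finset.mem_filter.2 ⟨Finset.mem_univ _,
          fun hkA => hk (hreg.eq_of_third hrne hj₁A hkA h), ?_⟩
        have hg := hreg.third_mem hrne hj₁A hkB h
        refine mem_span_sup_symSub (s := 1) (t := μ) (c := S.f r) (d := g) one_ne_zero ?_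
          (fun x hx => ?_) fun x hx => hg x hx.1
        · exact QuadraticForm.ext_iff'.2 fun x => by simp [h x]
        · rw [hr]
          simp [(hsu j hj2).2.1 x hx.1, show e x = 0 from hx.2]
      · left
        simp [hRdef, hkB]
    · rw [h x, hr]
      simp only [LinearMap.smul_apply, smul_eq_mul]
      ring
  have h1 : T₁.card ≤ R.card + J₁.card := Finset.card_union_le _ _
  have h2 : (R ∪ T₂).card ≤ R.card + T₂.card := Finset.card_union_le _ _
  have h3 : (J₂ \ J₃).card = J₂.card - J₃.card :=
    Finset.card_sdiff_of_subset (Finset.filter_subset _ _)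
  omega

end Step

section Absorb

open Classical in
/-- The invariant of the absorption process: few forms lie outside `W ⊔ vanSub N`, and none of them
vanishes together with many others. -/
structure SGConfig.Absorbing {E ι κ : Type*} [AddCommGroup E] [Module ℂ E] [FiniteDimensional ℂ E]
    [Fintype ι] (S : SGConfig E ι κ) (C : ℕ) (W : Submodule ℂ (QuadraticForm ℂ E))
    (N : Submodule ℂ E) : Prop where
  finrank_le : finrank ℂ W ≤ C
  codimLE : CodimLE N C
  reg : RegPair W N 2
  card_le : 100 * (Finset.univ.filter fun k => S.q k ∉ W ⊔ vanSub N).card ≤ Fintype.card ι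
  mem_of_pairVanish : ∀ i, Fintype.card ι ≤
    3 * (Finset.univ.filter fun j => PairVanish (S.q i) (S.q j)).card → S.q i ∈ vanSub N

theorem SGConfig.exists_absorbing_base : ∃ C : ℕ,
    ∀ (E ι κ : Type) [AddCommGroup E] [Module ℂ E] [FiniteDimensional ℂ E] [Fintype ι]
      [Fintype κ] (S : SGConfig E ι κ), ∃ W N, S.Absorbing C W N := by
  classical
  obtain ⟨C, hC⟩ := SGConfig.exists_absorbing (1 / 100) (by norm_num)
  obtain ⟨C', hC'⟩ := exists_regPair 2 C (C + 52)
  refine ⟨max C C', fun E ι κ _ _ _ _ _ S => ?_⟩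
  obtain ⟨W₀, N₀, -, h1, h2, h3⟩ := hC E ι κ S
  obtain ⟨N₁, hN₁, h4, h5⟩ := S.exists_vanSub_of_pairVanish N₀ h2
  obtain ⟨W, N, h6, h7, h8, h9, h10⟩ := hC' E W₀ N₁ h1 h4
  refine ⟨W, N, h8.trans (le_max_left _ _), h9.mono le_rfl (le_max_right _ _), h10, ?_,
    fun i hi => vanSub_mono h6 (h5 i (by convert hi))⟩
  have hle : W₀ ⊔ vanSub N₀ ≤ W ⊔ vanSub N :=
    sup_le (h7.trans (sup_symSub_le W N)) ((vanSub_mono (h6.trans hN₁)).trans le_sup_right)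
  have h11 : (Finset.univ.filter fun k => S.q k ∉ W ⊔ vanSub N).card ≤
      (Finset.univ.filter fun k => S.q k ∉ W₀ ⊔ vanSub N₀).card :=
    Finset.card_le_card (Finset.monotone_filter_right _ fun k _ hk hk' => hk (hle hk'))
  have h12 : ((100 * (Finset.univ.filter fun k => S.q k ∉ W₀ ⊔ vanSub N₀).card : ℕ) : ℝ) ≤
      (Fintype.card ι : ℕ) := by
    push_cast
    linarith
  refine le_trans ?_ (Nat.cast_le.1 h12)
  refine Nat.mul_le_mul_left _ ?_
  convert h11

open Classical in
theorem SGConfig.Absorbing.card_pairProd {E ι κ : Type*} [AddCommGroup E] [Module ℂ E]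
    [FiniteDimensional ℂ E] [Fintype ι] [Finite κ] {S : SGConfig E ι κ} {C : ℕ}
    {W : Submodule ℂ (QuadraticForm ℂ E)} {N : Submodule ℂ E} (h : S.Absorbing C W N) {i : ι}
    (hi : S.q i ∉ W ⊔ vanSub N) :
    Fintype.card ι ≤ 2 * (Finset.univ.filter fun j => S.q j ∈ W ⊔ vanSub N ∧
      PairProd (S.q i) (S.q j)).card := by
  have h1 := h.card_le
  have h2 : ¬ Fintype.card ι ≤
      3 * (Finset.univ.filter fun j => PairVanish (S.q i) (S.q j)).card := fun h2 =>
    hi (Submodule.mem_sup_right (h.mem_of_pairVanish i h2))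
  have h3 := SGConfig.card_third_le hi
  have h4 := Finset.card_filter_add_card_filter_not (s := Finset.univ)
    (fun k => S.q k ∈ W ⊔ vanSub N)
  rw [Finset.card_univ] at h4
  set B := Finset.univ.filter fun k => S.q k ∈ W ⊔ vanSub N
  set T₁ := Finset.univ.filter fun j => S.q j ∈ W ⊔ vanSub N ∧
      ∃ k, k ≠ i ∧ k ≠ j ∧ S.q k ∈ Submodule.span ℂ {S.q i, S.q j}
  set T₂ := Finset.univ.filter fun j => S.q j ∈ W ⊔ vanSub N ∧ PairProd (S.q i) (S.q j)
  set T₃ := Finset.univ.filter fun j => PairVanish (S.q i) (S.q j)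
  have h5 : B ⊆ T₁ ∪ (T₂ ∪ T₃) := by
    intro j hj
    have hj := (Finset.mem_filter.1 hj).2
    have hij : i ≠ j := by rintro rfl; exact hi hj
    simp only [Finset.mem_union, T₁, T₂, T₃, Finset.mem_filter, Finset.mem_univ, true_and]
    rcases S.trichotomy hij with h | h | h
    · exact Or.inl ⟨hj, h⟩
    · exact Or.inr (Or.inl ⟨hj, h⟩)
    · exact Or.inr (Or.inr h)
  have h6 := (Finset.card_le_card h5).trans (Finset.card_union_le _ _)
  have h7 := Finset.card_union_le T₂ T₃
  omega

open Classical in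
theorem SGConfig.exists_mem_sup_vanSub : ∃ C : ℕ,
    ∀ (E ι κ : Type) [AddCommGroup E] [Module ℂ E] [FiniteDimensional ℂ E] [Fintype ι]
      [Fintype κ] (S : SGConfig E ι κ), ∃ (W : Submodule ℂ (QuadraticForm ℂ E))
      (N : Submodule ℂ E), finrank ℂ W ≤ C ∧ CodimLE N C ∧ ∀ i, S.q i ∈ W ⊔ vanSub N := by
  have key : ∀ t : ℕ, ∃ C : ℕ,
      ∀ (E ι κ : Type) [AddCommGroup E] [Module ℂ E] [FiniteDimensional ℂ E] [Fintype ι]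
        [Fintype κ] (S : SGConfig E ι κ), ∃ W N, S.Absorbing C W N ∧
        ((∀ i, S.q i ∈ W ⊔ vanSub N) ∨ t * Fintype.card ι ≤
          100 * (Finset.univ.filter fun k => S.q k ∈ W ⊔ symSub N).card) := by
    intro t
    induction t with
    | zero =>
      obtain ⟨C, hC⟩ := SGConfig.exists_absorbing_base
      refine ⟨C, fun E ι κ _ _ _ _ _ S => ?_⟩
      obtain ⟨W, N, h⟩ := hC E ι κ S
      exact ⟨W, N, h, Or.inr (by simp)⟩
    | succ t ih =>
      obtain ⟨C, hC⟩ := ih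
      obtain ⟨C', hC'⟩ := exists_regPair 2 (C + C ^ 2 + (1 + (C + 2) ^ 2)) C
      refine ⟨max (C + C ^ 2 + (1 + (C + 2) ^ 2)) C', fun E ι κ _ _ _ _ _ S => ?_⟩
      obtain ⟨W, N, h, ht⟩ := hC E ι κ S
      by_cases hall : ∀ i, S.q i ∈ W ⊔ vanSub N
      · have hle : C ≤ max (C + C ^ 2 + (1 + (C + 2) ^ 2)) C' :=
          le_trans (by omega) (le_max_left _ _)
        exact ⟨W, N, ⟨h.finrank_le.trans hle, h.codimLE.mono le_rfl hle, h.reg, h.card_le,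
          h.mem_of_pairVanish⟩, Or.inl hall⟩
      have ht := ht.resolve_left hall
      push Not at hall
      obtain ⟨i, hi⟩ := hall
      obtain ⟨W', h1, h2⟩ := SGConfig.exists_capture_step h.reg h.codimLE h.card_le hi
        (h.card_pairProd hi)
      have hfr : finrank ℂ ↥((W ⊔ symSub N) ⊔ W') ≤ C + C ^ 2 + (1 + (C + 2) ^ 2) :=
        (Submodule.finrank_add_le_finrank_add_finrank _ _).trans (add_le_add
          ((Submodule.finrank_add_le_finrank_add_finrank _ _).trans
            (add_le_add h.finrank_le (finrank_symSub_le h.codimLE))) h1)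
      obtain ⟨W₂, N₂, h3, h4, h5, h6, h7⟩ := hC' E _ N hfr h.codimLE
      have hle : W ⊔ vanSub N ≤ W₂ ⊔ vanSub N₂ :=
        sup_le ((le_sup_left.trans le_sup_left).trans (h4.trans (sup_symSub_le _ _)))
          ((vanSub_mono h3).trans le_sup_right)
      refine ⟨W₂, N₂, ⟨h5.trans (le_max_left _ _), h6.mono le_rfl (le_max_right _ _), h7, ?_,
        fun j hj => vanSub_mono h3 (h.mem_of_pairVanish j hj)⟩, Or.inr ?_⟩
      · refine le_trans (Nat.mul_le_mul_left _ (Finset.card_le_card ?_)) h.card_le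
        exact Finset.monotone_filter_right _ fun k _ hk hk' => hk (hle hk')
      · set A := Finset.univ.filter fun k => S.q k ∈ W ⊔ symSub N with hA
        set B := Finset.univ.filter fun k => S.q k ∉ W ⊔ symSub N ∧ S.q k ∈ W' with hB
        have hd : Disjoint A B := by
          rw [Finset.disjoint_left]
          intro k hk hk'
          exact (Finset.mem_filter.1 hk').2.1 (Finset.mem_filter.1 hk).2
        have hs : A ∪ B ⊆ Finset.univ.filter fun k => S.q k ∈ W₂ ⊔ symSub N₂ := by
          intro k hk
          refine Finset.mem_filter.2 ⟨Finset.mem_univ _, h4 ?_⟩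
          rcases Finset.mem_union.1 hk with hk | hk
          · exact Submodule.mem_sup_left (Finset.mem_filter.1 hk).2
          · exact Submodule.mem_sup_right (Finset.mem_filter.1 hk).2.2
        have hc := Finset.card_le_card hs
        rw [Finset.card_union_of_disjoint hd] at hc
        rw [Nat.succ_mul]
        omega
  obtain ⟨C, hC⟩ := key 101
  refine ⟨C, fun E ι κ _ _ _ _ _ S => ?_⟩
  obtain ⟨W, N, h, ht⟩ := hC E ι κ S
  refine ⟨W, N, h.finrank_le, h.codimLE, ht.elim id fun ht i => ?_⟩
  have hpos : 0 < Fintype.card ι := Fintype.card_pos_iff.2 ⟨i⟩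
  have h8 := Finset.card_filter_le (Finset.univ : Finset ι) fun k => S.q k ∈ W ⊔ symSub N
  rw [Finset.card_univ] at h8
  omega

end Absorb

section Affine

variable {M : Type*} [AddCommGroup M] [Module ℂ M]

/-- The homogenization of the polynomial `x ↦ g.1 x + g.2.1 x + g.2.2`. -/
def hatQ (g : QuadraticForm ℂ M × Dual ℂ M × ℂ) : QuadraticForm ℂ (ℂ × M) :=
  g.1.comp (LinearMap.snd ℂ ℂ M) + QuadraticMap.linMulLin (LinearMap.fst ℂ ℂ M)
    (g.2.1 ∘ₗ LinearMap.snd ℂ ℂ M + g.2.2 • LinearMap.fst ℂ ℂ M)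

theorem hatQ_apply (g : QuadraticForm ℂ M × Dual ℂ M × ℂ) (x : ℂ × M) :
    hatQ g x = g.1 x.2 + x.1 * (g.2.1 x.2 + g.2.2 * x.1) := by
  simp [hatQ]
  ring

theorem hatQ_eq_of_ne_zero (g : QuadraticForm ℂ M × Dual ℂ M × ℂ) (x : ℂ × M) (hx : x.1 ≠ 0) :
    hatQ g x = x.1 ^ 2 * (g.1 (x.1⁻¹ • x.2) + g.2.1 (x.1⁻¹ • x.2) + g.2.2) := by
  rw [hatQ_apply, QuadraticForm.map_smul', map_smul, smul_eq_mul]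
  field_simp
  ring

theorem hatQ_ext_comb {g a b : QuadraticForm ℂ M × Dual ℂ M × ℂ} {α β : ℂ}
    (h : ∀ x, hatQ g x = α * hatQ a x + β * hatQ b x) : g = α • a + β • b := by
  have h1 : ∀ n, g.1 n = α * a.1 n + β * b.1 n := fun n => by
    have := h (0, n)
    simpa [hatQ_apply] using this
  have h2 : g.2.2 = α * a.2.2 + β * b.2.2 := by
    have := h (1, 0)
    simpa [hatQ_apply] using this
  refine Prod.ext (QuadraticForm.ext_iff'.2 fun n => by simpa using h1 n)
    (Prod.ext (LinearMap.ext fun n => ?_) (by simpa using h2))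
  have := h (1, n)
  simp only [hatQ_apply, h1, h2] at this
  simp only [Prod.snd_add, Prod.smul_snd, Prod.fst_add, Prod.smul_fst, LinearMap.add_apply,
    LinearMap.smul_apply, smul_eq_mul]
  linear_combination this

variable [FiniteDimensional ℂ M] {τ : Type*} [Finite τ]
  {g : τ → QuadraticForm ℂ M × Dual ℂ M × ℂ} {W : Submodule ℂ (QuadraticForm ℂ M)}

theorem RegPair.eq_zero_of_vanish (h : RegPair W ⊤ 2) {w : QuadraticForm ℂ M} (hw : w ∈ W)
    (c d : Dual ℂ M) (h0 : ∀ x, c x = 0 → d x = 0 → w x = 0) : w = 0 :=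
  h w hw _ ((codimLE_ker c).inf (codimLE_ker d)) fun x _ hx => h0 x hx.1 hx.2

theorem RegPair.not_isProd_hatQ (h : RegPair W ⊤ 2) {a : QuadraticForm ℂ M × Dual ℂ M × ℂ}
    (hw : a.1 ∈ W) (hne : a.1 ≠ 0) : ¬ IsProd (hatQ a) := by
  rintro ⟨c, d, hcd⟩
  refine hne (h.eq_zero_of_vanish hw (c ∘ₗ LinearMap.inr ℂ ℂ M) 0 fun x hx _ => ?_)
  have h1 := hcd (0, x)
  have h2 : c (0, x) = 0 := by simpa using hx
  rw [h2, zero_mul, hatQ_apply] at h1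
  simpa using h1

theorem exists_comb_of_quad_indep (hreg : RegPair W ⊤ 2) (hw : ∀ A, (g A).1 ∈ W)
    (hcov : ∀ A B, A ≠ B → ∀ n, (g A).1 n + (g A).2.1 n + (g A).2.2 = 0 →
      (g B).1 n + (g B).2.1 n + (g B).2.2 = 0 →
      ∃ C, (C ≠ A ∧ C ≠ B) ∧ (g C).1 n + (g C).2.1 n + (g C).2.2 = 0) {A B : τ}
    (hAB : LinearIndependent ℂ ![(g A).1, (g B).1]) :
    ∃ C, (C ≠ A ∧ C ≠ B) ∧ ∃ α β : ℂ, g C = α • g A + β • g B := by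
  classical
  cases nonempty_fintype τ
  have hne : A ≠ B := by
    rintro rfl
    exact hAB.ne_smul 1 (one_smul _ _).symm
  have hA0 : (g A).1 ≠ 0 := hAB.ne_zero 0
  have hB0 : (g B).1 ≠ 0 := hAB.ne_zero 1
  have hAB' := LinearIndependent.pair_iff.1 hAB
  have hcomb : ∀ α β : ℂ, ∀ c d : Dual ℂ M,
      (∀ x, c x = 0 → d x = 0 → α * (g A).1 x + β * (g B).1 x = 0) → α = 0 ∧ β = 0 := by
    intro α β c d h
    refine hAB' α β (hreg.eq_zero_of_vanish (W.add_mem (W.smul_mem _ (hw A))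
      (W.smul_mem _ (hw B))) c d fun x hx hx' => by simpa using h x hx hx')
  rcases pencil_structure (F := hatQ (g A)) (G := hatQ (g B))
    (H := fun C : Option τ => C.elim (dualSq (LinearMap.fst ℂ ℂ M)) fun C => hatQ (g C))
    (s := Finset.univ.filter fun C : Option τ => C ≠ some A ∧ C ≠ some B)
    (hreg.not_isProd_hatQ (hw A) hA0) (hreg.not_isProd_hatQ (hw B) hB0) (fun x hx hx' => by
      by_cases h0 : x.1 = 0
      · exact ⟨none, by simp, by simp [h0]⟩
      · rw [hatQ_eq_of_ne_zero _ _ h0] at hx hx'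
        obtain ⟨C, hC, h1⟩ := hcov A B hne (x.1⁻¹ • x.2)
          ((mul_eq_zero.1 hx).resolve_left (pow_ne_zero 2 h0))
          ((mul_eq_zero.1 hx').resolve_left (pow_ne_zero 2 h0))
        refine ⟨some C, by simpa using hC, ?_⟩
        change hatQ (g C) x = 0
        rw [hatQ_eq_of_ne_zero _ _ h0, h1, mul_zero]) with ⟨C, hC, α, β, h⟩ | h | h
  · rcases C with _ | C
    · exfalso
      obtain ⟨rfl, rfl⟩ := hcomb α β 0 0 fun x _ _ => by
        have := h (0, x)
        simpa [hatQ_apply] using this.symm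
      have := h (1, 0)
      simp at this
    · exact ⟨C, by simpa using hC, α, β, hatQ_ext_comb h⟩
  · exfalso
    obtain ⟨α, β, hα, -, c, d, h⟩ := h
    refine hα (hcomb α β (c ∘ₗ LinearMap.inr ℂ ℂ M) 0 fun x hx _ => ?_).1
    have h1 := h (0, x)
    have h2 : c (0, x) = 0 := by simpa using hx
    rw [h2] at h1
    simpa [hatQ_apply] using h1
  · exfalso
    obtain ⟨c, d, h⟩ := h
    refine one_ne_zero (hcomb 1 0 (c ∘ₗ LinearMap.inr ℂ ℂ M) (d ∘ₗ LinearMap.inr ℂ ℂ M)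
      fun x hx hx' => ?_).1
    have h1 := (h (0, x) (by simpa using hx) (by simpa using hx')).1
    simpa [hatQ_apply] using h1

theorem exists_comb_of_quad_dep (hreg : RegPair W ⊤ 2) (hw : ∀ A, (g A).1 ∈ W)
    (hcov : ∀ A B, A ≠ B → ∀ n, (g A).1 n + (g A).2.1 n + (g A).2.2 = 0 →
      (g B).1 n + (g B).2.1 n + (g B).2.2 = 0 →
      ∃ C, (C ≠ A ∧ C ≠ B) ∧ (g C).1 n + (g C).2.1 n + (g C).2.2 = 0) {A B : τ} {r : ℂ}
    (hA : (g A).1 ≠ 0) (hB : (g B).1 = r • (g A).1) (hd : (g B).2.1 - r • (g A).2.1 ≠ 0) :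
    ∃ C, (C ≠ A ∧ C ≠ B) ∧ ∃ α β : ℂ, g C = α • g A + β • g B := by
  have hne : A ≠ B := by
    rintro rfl
    have h1 : (1 - r) • (g A).1 = 0 := by rw [sub_smul, one_smul, ← hB, sub_self]
    have h2 : r = 1 := (sub_eq_zero.1 ((smul_eq_zero.1 h1).resolve_right hA)).symm
    exact hd (by rw [h2, one_smul, sub_self])
  set d := (g B).2.1 - r • (g A).2.1 with hddef
  set s := (g B).2.2 - r * (g A).2.2 with hsdef
  let D : Dual ℂ (ℂ × M) := d ∘ₗ LinearMap.snd ℂ ℂ M + s • LinearMap.fst ℂ ℂ M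
  have hD : ∀ x, D x = d x.2 + s * x.1 := fun x => by simp [D]
  have hBA : ∀ x, hatQ (g B) x = r * hatQ (g A) x + x.1 * D x := fun x => by
    rw [hatQ_apply, hatQ_apply, hB, hD, hddef, hsdef]
    simp only [smul_apply, smul_eq_mul, LinearMap.sub_apply, LinearMap.smul_apply]
    ring
  have hirr : IrrOn (hatQ (g A)) D := by
    refine IrrOn.of_forall fun c e hce => hA ?_
    refine hreg.eq_zero_of_vanish (hw A) (c ∘ₗ LinearMap.inr ℂ ℂ M) d fun x hx hx' => ?_
    have h1 := hce (0, x) (by simp [hD, hx'])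
    have h2 : c (0, x) = 0 := by simpa using hx
    rw [h2, zero_mul, hatQ_apply] at h1
    simpa using h1
  rcases hirr.exists_of_cover (H := fun C => hatQ (g C))
    (f := fun _ : Unit => (LinearMap.fst ℂ ℂ M : Dual ℂ (ℂ × M))) (fun C => C ≠ A ∧ C ≠ B)
    (fun _ => True) (fun x hx hx' => by
      by_cases h0 : x.1 = 0
      · exact Or.inr ⟨(), trivial, h0⟩
      · left
        have hxB : hatQ (g B) x = 0 := by rw [hBA, hx, hx']; ring
        rw [hatQ_eq_of_ne_zero _ _ h0] at hx hxB
        obtain ⟨C, hC, h1⟩ := hcov A B hne (x.1⁻¹ • x.2)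
          ((mul_eq_zero.1 hx).resolve_left (pow_ne_zero 2 h0))
          ((mul_eq_zero.1 hxB).resolve_left (pow_ne_zero 2 h0))
        refine ⟨C, hC, ?_⟩
        rw [hatQ_eq_of_ne_zero _ _ h0, h1, mul_zero]) with ⟨C, hC, μ, γ, h⟩ | ⟨-, -, a, h⟩
  · refine ⟨C, hC, ?_⟩
    have h1 : (g C).1 - μ • (g A).1 = 0 := by
      refine hreg.eq_zero_of_vanish (W.sub_mem (hw C) (W.smul_mem _ (hw A))) d 0 fun x hx _ => ?_
      have := h (0, x)
      simp only [hatQ_apply, hD, hx] at this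
      simp only [sub_apply, smul_apply, smul_eq_mul]
      linear_combination this
    have h2 : ∀ x : M, γ (0, x) = 0 := by
      have : γ ∘ₗ LinearMap.inr ℂ ℂ M = 0 := by
        have h3 := Dual.mul_eq_zero_of_forall (a := d) (b := γ ∘ₗ LinearMap.inr ℂ ℂ M) fun x => by
          have h4 := h (0, x)
          have h5 := congrArg (fun q : QuadraticForm ℂ M => q x) h1
          simp only [sub_apply, smul_apply, smul_eq_mul, zero_apply] at h5
          simp only [hatQ_apply, hD] at h4
          simp only [LinearMap.comp_apply, LinearMap.inr_apply]
          linear_combination h5 - h4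
        exact h3.resolve_left hd
      intro x
      exact LinearMap.congr_fun this x
    have h3 : ∀ x : ℂ × M, γ x = x.1 * γ (1, 0) := fun x => by
      have : x = (0, x.2) + x.1 • ((1, 0) : ℂ × M) := by ext <;> simp
      conv_lhs => rw [this, map_add, map_smul, h2, zero_add, smul_eq_mul]
    refine ⟨μ - γ (1, 0) * r, γ (1, 0), hatQ_ext_comb fun x => ?_⟩
    rw [h x, hBA, h3]
    ring
  · exfalso
    obtain ⟨x, hx⟩ : ∃ x, d x ≠ 0 := by
      by_contra hcon
      push Not at hcon
      exact hd (LinearMap.ext hcon)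
    have h1 := LinearMap.congr_fun h (0, x)
    simp only [LinearMap.fst_apply, LinearMap.smul_apply, smul_eq_mul, hD, mul_zero,
      add_zero] at h1
    have ha : a = 0 := (mul_eq_zero.1 h1.symm).resolve_right hx
    have h2 := LinearMap.congr_fun h (1, 0)
    simp [ha] at h2

theorem exists_comb_of_quad_zero (hreg : RegPair W ⊤ 2) (hw : ∀ A, (g A).1 ∈ W)
    (hcov : ∀ A B, A ≠ B → ∀ n, (g A).1 n + (g A).2.1 n + (g A).2.2 = 0 →
      (g B).1 n + (g B).2.1 n + (g B).2.2 = 0 →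
      ∃ C, (C ≠ A ∧ C ≠ B) ∧ (g C).1 n + (g C).2.1 n + (g C).2.2 = 0) {A B : τ}
    (hA : (g A).1 = 0) (hB : (g B).1 = 0)
    (hd : LinearIndependent ℂ ![(g A).2.1, (g B).2.1]) :
    ∃ C, (C ≠ A ∧ C ≠ B) ∧ ∃ α β : ℂ, g C = α • g A + β • g B := by
  classical
  cases nonempty_fintype τ
  have hne : A ≠ B := by
    rintro rfl
    exact hd.ne_smul 1 (one_smul _ _).symm
  let D : τ → Dual ℂ (ℂ × M) := fun C =>
    (g C).2.1 ∘ₗ LinearMap.snd ℂ ℂ M + (g C).2.2 • LinearMap.fst ℂ ℂ M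
  have hD : ∀ C x, D C x = (g C).2.1 x.2 + (g C).2.2 * x.1 := fun C x => by simp [D]
  have hz : ∀ C, (g C).1 = 0 → ∀ x, hatQ (g C) x = x.1 * D C x := fun C hC x => by
    rw [hatQ_apply, hC, hD, zero_apply, zero_add]
  let K : Submodule ℂ (ℂ × M) := LinearMap.ker (D A) ⊓ LinearMap.ker (D B)
  have htK : ¬ ∀ x ∈ K, x.1 = 0 := by
    intro h
    obtain ⟨r, s, hrs⟩ := Dual.eq_comb_of_ker (a := D A) (l := D B)
      (e := (LinearMap.fst ℂ ℂ M : Dual ℂ (ℂ × M))) fun x hx hx' => h x ⟨hx, hx'⟩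
    obtain ⟨rfl, rfl⟩ := LinearIndependent.pair_iff.1 hd r s (LinearMap.ext fun x => by
      have := hrs (0, x)
      simpa [hD] using this.symm)
    have := hrs (1, 0)
    simp at this
  obtain ⟨C, hC, h⟩ := (PolyIrred.submodule K).exists_of_prod
    (s := Finset.univ.filter fun C : Option τ => C ≠ some A ∧ C ≠ some B)
    (f := fun C x => C.elim x.1 fun C => hatQ (g C) x)
    (fun C _ => by
      rcases C with _ | C
      · exact PolyFun.dual (LinearMap.fst ℂ ℂ M : Dual ℂ (ℂ × M))
      · exact PolyFun.quad (hatQ (g C)))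
    (fun x hx => by
      by_cases h0 : x.1 = 0
      · exact ⟨none, by simp, h0⟩
      · have hxA : hatQ (g A) x = 0 := by rw [hz A hA, show D A x = 0 from hx.1, mul_zero]
        have hxB : hatQ (g B) x = 0 := by rw [hz B hB, show D B x = 0 from hx.2, mul_zero]
        rw [hatQ_eq_of_ne_zero _ _ h0] at hxA hxB
        obtain ⟨C, hC, h1⟩ := hcov A B hne (x.1⁻¹ • x.2)
          ((mul_eq_zero.1 hxA).resolve_left (pow_ne_zero 2 h0))
          ((mul_eq_zero.1 hxB).resolve_left (pow_ne_zero 2 h0))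
        refine ⟨some C, by simpa using hC, ?_⟩
        change hatQ (g C) x = 0
        rw [hatQ_eq_of_ne_zero _ _ h0, h1, mul_zero])
  rcases C with _ | C
  · exact absurd h htK
  have h : ∀ x ∈ K, hatQ (g C) x = 0 := h
  have hC0 : (g C).1 = 0 := by
    refine hreg.eq_zero_of_vanish (hw C) (g A).2.1 (g B).2.1 fun x hx hx' => ?_
    have := h (0, x) ⟨by simp [hD, hx], by simp [hD, hx']⟩
    simpa [hatQ_apply] using this
  have hDC : ∀ x ∈ K, D C x = 0 :=
    (Submodule.mul_eq_zero_on K (PolyFun.dual (LinearMap.fst ℂ ℂ M : Dual ℂ (ℂ × M)))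
      (PolyFun.dual (D C)) fun x hx => by
        have := h x hx
        rwa [hz C hC0] at this).resolve_left htK
  obtain ⟨α, β, hαβ⟩ := Dual.eq_comb_of_ker (a := D A) (l := D B) (e := D C)
    fun x hx hx' => hDC x ⟨hx, hx'⟩
  refine ⟨C, by simpa using hC, α, β, hatQ_ext_comb fun x => ?_⟩
  rw [hz C hC0, hz A hA, hz B hB, hαβ]
  ring

/-- Polynomials of degree at most two on an affine space, any two of which meet inside the others,
span a bounded space modulo the constants. -/
theorem finrank_span_le_of_affine_cover (hreg : RegPair W ⊤ 2) (hw : ∀ A, (g A).1 ∈ W)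
    (hcov : ∀ A B, A ≠ B → ∀ n, (g A).1 n + (g A).2.1 n + (g A).2.2 = 0 →
      (g B).1 n + (g B).2.1 n + (g B).2.2 = 0 →
      ∃ C, (C ≠ A ∧ C ≠ B) ∧ (g C).1 n + (g C).2.1 n + (g C).2.2 = 0)
    (hne : ∀ A B, A ≠ B → ((g A).1, (g A).2.1) ≠ 0 → ∀ s : ℂ, g B ≠ s • g A) :
    finrank ℂ (Submodule.span ℂ (Set.range fun A => ((g A).1, (g A).2.1))) ≤ 49 := by
  classical
  cases nonempty_fintype τ
  set v : τ → QuadraticForm ℂ M × Dual ℂ M := fun A => ((g A).1, (g A).2.1) with hv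
  have hcomb : ∀ A B, LinearIndependent ℂ ![v A, v B] →
      ∃ C, (C ≠ A ∧ C ≠ B) ∧ ∃ α β : ℂ, g C = α • g A + β • g B := by
    have key : ∀ A B, LinearIndependent ℂ ![v A, v B] → (g A).1 ≠ 0 →
        ∃ C, (C ≠ A ∧ C ≠ B) ∧ ∃ α β : ℂ, g C = α • g A + β • g B := by
      intro A B h hA
      by_cases hAB : LinearIndependent ℂ ![(g A).1, (g B).1]
      · exact exists_comb_of_quad_indep hreg hw hcov hAB
      · rw [LinearIndependent.pair_iff' hA] at hAB
        push Not at hAB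
        obtain ⟨r, hr⟩ := hAB
        refine exists_comb_of_quad_dep hreg hw hcov hA hr.symm fun h0 => ?_
        have h1 := LinearIndependent.pair_iff.1 h r (-1) (Prod.ext
          (by simp [hv, hr]) (by
            simp only [hv, Prod.snd_add, Prod.smul_snd, Prod.snd_zero]
            rw [sub_eq_zero.1 h0]; module))
        exact one_ne_zero (neg_eq_zero.1 h1.2)
    intro A B h
    by_cases hA : (g A).1 = 0
    · by_cases hB : (g B).1 = 0
      · refine exists_comb_of_quad_zero hreg hw hcov hA hB ?_
        rw [LinearIndependent.pair_iff] at h ⊢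
        intro s t hst
        refine h s t (Prod.ext (by simp [hv, hA, hB]) (by simpa [hv] using hst))
      · obtain ⟨C, hC, α, β, h⟩ := key B A (LinearIndependent.pair_symm_iff.1 h) hB
        exact ⟨C, hC.symm, β, α, by rw [h, add_comm]⟩
    · exact key A B h hA
  let v' : {A // v A ≠ 0} → QuadraticForm ℂ M × Dual ℂ M := fun A => v A
  have hle : Submodule.span ℂ (Set.range v) ≤ Submodule.span ℂ (Set.range v') := by
    rw [Submodule.span_le]
    rintro _ ⟨A, rfl⟩
    by_cases hA : v A = 0
    · rw [hA]; exact Submodule.zero_mem _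
    · exact Submodule.subset_span ⟨⟨A, hA⟩, rfl⟩
  refine (Submodule.finrank_mono hle).trans
    (finrank_span_le_of_third_vector v' (fun A => A.2) fun A B h => ?_)
  obtain ⟨C, hC, α, β, hαβ⟩ := hcomb A B h
  have hα : α ≠ 0 := by
    rintro rfl
    exact hne B C hC.2.symm B.2 β (by rw [hαβ]; module)
  have hβ : β ≠ 0 := by
    rintro rfl
    exact hne A C hC.1.symm A.2 α (by rw [hαβ]; module)
  have hvC : v C = α • v A + β • v B := by
    simp only [hv, hαβ]
    rfl
  have h' := LinearIndependent.pair_iff.1 h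
  have hC0 : v C ≠ 0 := fun h0 => hα (h' α β (by rw [← h0, hvC])).1
  refine ⟨⟨C, hC0⟩, ?_, ?_, ?_⟩
  · exact Submodule.mem_span_pair.2 ⟨α, β, hvC.symm⟩
  · rw [LinearIndependent.pair_iff]
    intro s t hst
    have h1 := h' (s + t * α) (t * β) (by
      rw [← hst]; change _ = s • v A + t • v C; rw [hvC]; module)
    have ht : t = 0 := (mul_eq_zero.1 h1.2).resolve_right hβ
    exact ⟨by simpa [ht] using h1.1, ht⟩
  · rw [LinearIndependent.pair_iff]
    intro s t hst
    have h1 := h' (t * α) (s + t * β) (by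
      rw [← hst]; change _ = s • v B + t • v C; rw [hvC]; module)
    have ht : t = 0 := (mul_eq_zero.1 h1.1).resolve_right hα
    exact ⟨by simpa [ht] using h1.2, ht⟩

end Affine

section Forms

variable {E ι κ : Type*} [AddCommGroup E] [Module ℂ E] (S : SGConfig E ι κ)

/-- The polynomial functions of a configuration, as one family. -/
def SGConfig.form : ι ⊕ κ → E → ℂ := Sum.elim (fun i x => S.q i x) (fun k x => S.f k x)

theorem SGConfig.form_cover {A B : ι ⊕ κ} (hAB : A ≠ B) (x : E) (hA : S.form A x = 0)
    (hB : S.form B x = 0) : ∃ C, (C ≠ A ∧ C ≠ B) ∧ S.form C x = 0 := by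
  rcases A with i | i <;> rcases B with j | j <;> simp only [SGConfig.form, Sum.elim_inl,
    Sum.elim_inr] at hA hB
  · rcases S.cover_qq i j (fun h => hAB (by rw [h])) x hA hB with ⟨k, hk, h⟩ | ⟨k, h⟩
    · exact ⟨Sum.inl k, by simpa using hk, h⟩
    · exact ⟨Sum.inr k, by simp, h⟩
  · rcases S.cover_qf i j x hA hB with ⟨k, hk, h⟩ | ⟨k, hk, h⟩
    · exact ⟨Sum.inl k, by simpa using hk, h⟩
    · exact ⟨Sum.inr k, by simpa using hk, h⟩
  · rcases S.cover_qf j i x hB hA with ⟨k, hk, h⟩ | ⟨k, hk, h⟩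
    · exact ⟨Sum.inl k, by simpa using hk, h⟩
    · exact ⟨Sum.inr k, by simpa using hk, h⟩
  · rcases S.cover_ff i j (fun h => hAB (by rw [h])) x hA hB with ⟨k, h⟩ | ⟨k, hk, h⟩
    · exact ⟨Sum.inl k, by simp, h⟩
    · exact ⟨Sum.inr k, by simpa using hk, h⟩

theorem PolyFun.shift {f : E → ℂ} (hf : PolyFun f) (y : E) : PolyFun fun x => f (x + y) :=
  fun γ h => hf (fun t => γ t + y) (h.add (PolyCurve.const y))

variable [FiniteDimensional ℂ E]

theorem SGConfig.polyFun_form (A : ι ⊕ κ) : PolyFun (S.form A) := by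
  rcases A with i | k
  · exact PolyFun.quad (S.q i)
  · exact PolyFun.dual (S.f k)

theorem SGConfig.polyIrred_form (A : ι ⊕ κ) : PolyIrred {x | S.form A x = 0} := by
  rcases A with i | k
  · exact PolyIrred.zeros (S.not_prod i)
  · exact PolyIrred.submodule (LinearMap.ker (S.f k))

theorem SGConfig.exists_form_ne {A B : ι ⊕ κ} (hAB : A ≠ B) :
    ∃ x, S.form A x = 0 ∧ S.form B x ≠ 0 := by
  rcases A with i | i <;> rcases B with j | j <;> simp only [SGConfig.form, Sum.elim_inl,
    Sum.elim_inr]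
  · by_contra hcon
    push Not at hcon
    obtain ⟨c, hc⟩ := QuadraticForm.eq_smul_of_zeros_subset (S.not_prod i) hcon
    exact hAB (by rw [S.eq_of_forall hc])
  · exact exists_zero_dual_ne (S.not_prod i) (S.f_ne j)
  · by_contra hcon
    push Not at hcon
    obtain ⟨b, hb⟩ := QuadraticForm.exists_dvd_of_ker _ _ hcon
    exact S.not_prod j ⟨_, _, hb⟩
  · by_contra hcon
    push Not at hcon
    obtain ⟨c, hc⟩ := Dual.eq_smul_of_ker hcon
    exact (S.f_indep j i fun h => hAB (by rw [h])).ne_smul c hc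

/-- A form whose zero set is preserved by the translations in `N` is invariant under them. -/
theorem SGConfig.form_add_of_zeros (A : ι ⊕ κ) {N : Submodule ℂ E}
    (h : ∀ y ∈ N, ∀ x, S.form A x = 0 → S.form A (x + y) = 0) {y : E} (hy : y ∈ N) (x : E) :
    S.form A (x + y) = S.form A x := by
  rcases A with i | k <;> simp only [SGConfig.form, Sum.elim_inl, Sum.elim_inr] at h ⊢
  · have hrad : y ∈ (S.q i).rad := by
      by_contra hcon
      obtain ⟨z, hz, hz'⟩ := exists_zero_dual_ne (S.not_prod i)
        (l := (S.q i).polarBilin y) fun h0 => hcon (LinearMap.mem_ker.2 h0)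
      have h1 := h y hy z hz
      have h2 := h (-y) (N.neg_mem hy) z hz
      rw [QuadraticForm.map_add', hz] at h1 h2
      rw [QuadraticMap.map_neg, map_neg] at h2
      rw [QuadraticForm.polarBilin_symm] at hz'
      apply hz'
      linear_combination (h1 - h2) / 2
    rw [add_comm, QuadraticForm.map_add_of_mem_rad hrad]
  · have := h y hy 0 (map_zero _)
    rw [zero_add] at this
    rw [map_add, this, add_zero]

theorem SGConfig.invariant_or_exists {A B : ι ⊕ κ} (hAB : A ≠ B) (N : Submodule ℂ E) :
    (∀ y ∈ N, ∀ x, S.form A (x + y) = S.form A x) ∨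
      ∃ y ∈ N, ∃ x, S.form A x * S.form B (x + y) - S.form A (x + y) * S.form B x ≠ 0 := by
  by_contra hcon
  push Not at hcon
  obtain ⟨⟨y, hy, x, hx⟩, h⟩ := hcon
  refine hx (S.form_add_of_zeros A (fun y hy => ?_) hy x)
  rcases (S.polyIrred_form A).2 (fun x => S.form A (x + y)) (S.form B)
    ((S.polyFun_form A).shift y) (S.polyFun_form B) (fun x hx => by
      have h1 := h y hy x
      rw [Set.mem_ofPred_eq] at hx
      rw [hx] at h1
      linear_combination -h1) with h1 | h1
  · exact h1
  · obtain ⟨x, hx, hx'⟩ := S.exists_form_ne hAB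
    exact absurd (h1 x hx) hx'

/-- A base point at which no two forms agree, up to scalars, along `N`. -/
def SGConfig.Generic (N : Submodule ℂ E) (P : E) : Prop :=
  ∀ A B, A ≠ B → (∀ y ∈ N, ∀ x, S.form A (x + y) = S.form A x) ∨
    ∀ s : ℂ, ∃ y ∈ N, S.form B (P + y) ≠ s * S.form A (P + y)

theorem SGConfig.exists_generic [Finite ι] [Finite κ] (N : Submodule ℂ E) {l : Dual ℂ E}
    (hl : l ≠ 0) : ∃ P, S.Generic N P ∧ l P ≠ 0 := by
  classical
  cases nonempty_fintype ι
  cases nonempty_fintype κ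
  have h : ∀ p : (ι ⊕ κ) × (ι ⊕ κ), ∃ y ∈ N, p.1 ≠ p.2 →
      ¬ (∀ y ∈ N, ∀ x, S.form p.1 (x + y) = S.form p.1 x) →
      ∃ x, S.form p.1 x * S.form p.2 (x + y) - S.form p.1 (x + y) * S.form p.2 x ≠ 0 := fun p => by
    by_cases hp : p.1 = p.2
    · exact ⟨0, N.zero_mem, fun h => absurd hp h⟩
    · rcases S.invariant_or_exists hp N with h | ⟨y, hy, h⟩
      · exact ⟨0, N.zero_mem, fun _ h' => absurd h h'⟩
      · exact ⟨y, hy, fun _ _ => h⟩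
  choose y hy hyp using h
  set s : Finset ((ι ⊕ κ) × (ι ⊕ κ)) := Finset.univ.filter fun p => p.1 ≠ p.2 ∧
    ¬ (∀ y ∈ N, ∀ x, S.form p.1 (x + y) = S.form p.1 x) with hs
  obtain ⟨P, -, hP⟩ := (PolyIrred.univ (E := E)).exists_ne_zero (insert none (s.map .some))
    (f := fun o x => o.elim (l x) fun p =>
      S.form p.1 x * S.form p.2 (x + y p) - S.form p.1 (x + y p) * S.form p.2 x)
    (by
      rintro (_ | p) -
      · exact PolyFun.dual l
      · exact ((S.polyFun_form _).mul ((S.polyFun_form _).shift _)).sub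
          (((S.polyFun_form _).shift _).mul (S.polyFun_form _)))
    (by
      rintro (_ | p) hp
      · obtain ⟨x, hx⟩ := DFunLike.ne_iff.1 hl
        exact ⟨x, trivial, by simpa using hx⟩
      · have hp' : p ∈ s := by simpa using hp
        obtain ⟨h1, h2⟩ := (Finset.mem_filter.1 hp').2
        obtain ⟨x, hx⟩ := hyp p h1 h2
        exact ⟨x, trivial, hx⟩)
  refine ⟨P, fun A B hAB => ?_, hP none (by simp)⟩
  by_cases hinv : ∀ y ∈ N, ∀ x, S.form A (x + y) = S.form A x
  · exact Or.inl hinv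
  · refine Or.inr fun c => ?_
    by_contra hcon
    push Not at hcon
    refine hP (some (A, B)) (by
      rw [Finset.mem_insert, Finset.mem_map]
      exact Or.inr ⟨(A, B), Finset.mem_filter.2 ⟨Finset.mem_univ _, hAB, hinv⟩, rfl⟩) ?_
    have h0 := hcon 0 N.zero_mem
    rw [add_zero] at h0
    simp only [Option.elim_some, h0, hcon _ (hy (A, B))]
    ring

end Forms

section Restrict

variable {E : Type*} [AddCommGroup E] [Module ℂ E]

/-- Restriction of quadratic forms to a subspace. -/
def resQ (N : Submodule ℂ E) : QuadraticForm ℂ E →ₗ[ℂ] QuadraticForm ℂ N where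
  toFun q := q.comp N.subtype
  map_add' p q := by ext x; simp
  map_smul' c q := by ext x; simp

@[simp] theorem resQ_apply (N : Submodule ℂ E) (q : QuadraticForm ℂ E) (x : N) :
    resQ N q x = q x := rfl

/-- The quadratic and linear parts of a quadratic form along the translate `P + N`. -/
def germQ (N : Submodule ℂ E) (P : E) : QuadraticForm ℂ E →ₗ[ℂ] QuadraticForm ℂ N × Dual ℂ N :=
  (resQ N).prod ((LinearMap.lcomp ℂ ℂ N.subtype) ∘ₗ (LinearMap.applyₗ P) ∘ₗ (polarLin E))

variable [FiniteDimensional ℂ E]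

theorem RegPair.map_resQ {W : Submodule ℂ (QuadraticForm ℂ E)} {N : Submodule ℂ E} {R : ℕ}
    (h : RegPair W N R) : RegPair (W.map (resQ N)) ⊤ R := by
  rintro _ ⟨w, hw, rfl⟩ T hT h0
  obtain ⟨M, hM⟩ := Submodule.exists_isCompl N
  have hdisj : Disjoint (T.map N.subtype) M :=
    hM.disjoint.mono_left (Submodule.map_subtype_le N T)
  rw [h w hw (T.map N.subtype ⊔ M) ?_ ?_, map_zero]
  · have h1 := Submodule.finrank_add_eq_of_isCompl hM
    have h2 := Submodule.finrank_sup_add_finrank_inf_eq (T.map N.subtype) M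
    rw [hdisj.eq_bot, finrank_bot, Submodule.finrank_map_subtype_eq] at h2
    unfold CodimLE at hT ⊢
    omega
  · intro x hx hxT
    obtain ⟨_, ⟨y, hy, rfl⟩, z, hz, rfl⟩ := Submodule.mem_sup.1 hxT
    have hzN : z ∈ N := by
      have := N.sub_mem hx y.2
      simpa using this
    have hz0 : z = 0 := Submodule.disjoint_def.1 hM.disjoint z hzN hz
    have := h0 y trivial hy
    simpa [hz0] using this

/-- Finitely many points of a set separating linear forms complete a subspace to the whole. -/
theorem exists_finset_sup_span_eq_top {G : Set E} (hG : ∀ l : Dual ℂ E, l ≠ 0 → ∃ P ∈ G, l P ≠ 0)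
    {d : ℕ} {N : Submodule ℂ E} (hN : CodimLE N d) :
    ∃ s : Finset E, (s : Set E) ⊆ G ∧ s.card ≤ d ∧ N ⊔ Submodule.span ℂ (s : Set E) = ⊤ := by
  classical
  induction d generalizing N with
  | zero =>
    refine ⟨∅, by simp, by simp, ?_⟩
    have : N = ⊤ := Submodule.eq_top_of_finrank_eq (le_antisymm (Submodule.finrank_le N) hN)
    simp [this]
  | succ d ih =>
    by_cases htop : N = ⊤
    · exact ⟨∅, by simp, by simp, by simp [htop]⟩
    obtain ⟨l, hl, hNl⟩ := Submodule.exists_le_ker_of_lt_top N (lt_top_iff_ne_top.2 htop)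
    obtain ⟨P, hP, hlP⟩ := hG l hl
    have hlt : N < N ⊔ Submodule.span ℂ {P} := by
      refine lt_of_le_of_ne le_sup_left fun h => hlP (hNl ?_)
      rw [h]
      exact Submodule.mem_sup_right (Submodule.mem_span_singleton_self P)
    have := Submodule.finrank_lt_finrank_of_lt hlt
    obtain ⟨s, hs, hcard, hsup⟩ := ih (N := N ⊔ Submodule.span ℂ {P}) (by
      unfold CodimLE at hN ⊢
      omega)
    refine ⟨insert P s, ?_, (Finset.card_insert_le _ _).trans (by omega), ?_⟩
    · rw [Finset.coe_insert]
      exact Set.insert_subset hP hs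
    · rw [Finset.coe_insert, Submodule.span_insert, ← sup_assoc, hsup]

theorem finrank_le_map_add_inf_ker {V U : Type*} [AddCommGroup V] [Module ℂ V]
    [FiniteDimensional ℂ V] [AddCommGroup U] [Module ℂ U] (φ : V →ₗ[ℂ] U) (K : Submodule ℂ V) :
    finrank ℂ K ≤ finrank ℂ (K.map φ) + finrank ℂ (K ⊓ LinearMap.ker φ : Submodule ℂ V) := by
  have h := LinearMap.finrank_range_add_finrank_ker (φ.domRestrict K)
  rw [LinearMap.range_domRestrict] at h
  have h2 : finrank ℂ (LinearMap.ker (φ.domRestrict K)) ≤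
      finrank ℂ (K ⊓ LinearMap.ker φ : Submodule ℂ V) := by
    rw [← Submodule.finrank_map_subtype_eq K (LinearMap.ker (φ.domRestrict K))]
    refine Submodule.finrank_mono ?_
    rintro _ ⟨x, hx, rfl⟩
    exact ⟨x.2, by simpa using hx⟩
  omega

theorem finrank_le_card_mul_add {V U α : Type*} [AddCommGroup V] [Module ℂ V]
    [FiniteDimensional ℂ V] [AddCommGroup U] [Module ℂ U] [FiniteDimensional ℂ U]
    (φ : α → V →ₗ[ℂ] U) (b : ℕ) (s : Finset α) (K : Submodule ℂ V)
    (h : ∀ a ∈ s, finrank ℂ (K.map (φ a)) ≤ b) {L : Submodule ℂ V}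
    (hL : ∀ v ∈ K, (∀ a ∈ s, φ a v = 0) → v ∈ L) :
    finrank ℂ K ≤ s.card * b + finrank ℂ L := by
  classical
  induction s using Finset.induction_on generalizing K with
  | empty => simpa using Submodule.finrank_mono fun v hv => hL v hv (by simp)
  | insert a s ha ih =>
    have h1 := finrank_le_map_add_inf_ker (φ a) K
    have h2 := ih (K ⊓ LinearMap.ker (φ a))
      (fun c hc => (Submodule.finrank_mono (Submodule.map_mono inf_le_left)).trans
        (h c (Finset.mem_insert_of_mem hc)))
      (fun v hv hv' => hL v hv.1 (by
        simp only [Finset.mem_insert, forall_eq_or_imp]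
        exact ⟨hv.2, hv'⟩))
    have h3 := h a (Finset.mem_insert_self a s)
    rw [Finset.card_insert_of_notMem ha, add_mul, one_mul]
    omega

end Restrict

section Bound

variable {E ι κ : Type*} [AddCommGroup E] [Module ℂ E] (S : SGConfig E ι κ)

/-- The Taylor expansions of the forms of a configuration along `P + N`. -/
def SGConfig.germ (N : Submodule ℂ E) (P : E) : ι ⊕ κ → QuadraticForm ℂ N × Dual ℂ N × ℂ :=
  Sum.elim (fun i => (resQ N (S.q i), (S.q i).polarBilin P ∘ₗ N.subtype, S.q i P))
    (fun k => (0, S.f k ∘ₗ N.subtype, S.f k P))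

theorem SGConfig.germ_eval (N : Submodule ℂ E) (P : E) (A : ι ⊕ κ) (n : N) :
    (S.germ N P A).1 n + (S.germ N P A).2.1 n + (S.germ N P A).2.2 = S.form A (P + n) := by
  rcases A with i | k
  · simp only [SGConfig.germ, SGConfig.form, Sum.elim_inl, resQ_apply]
    rw [QuadraticForm.map_add']
    simp only [LinearMap.comp_apply, Submodule.subtype_apply]
    ring
  · simp [SGConfig.germ, SGConfig.form, add_comm]

variable [FiniteDimensional ℂ E] [Finite ι] [Finite κ]

theorem SGConfig.finrank_germ_le {W : Submodule ℂ (QuadraticForm ℂ E)} {N : Submodule ℂ E}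
    (hreg : RegPair W N 2) (hW : ∀ i, S.q i ∈ W ⊔ vanSub N) {P : E} (hP : S.Generic N P) :
    finrank ℂ (Submodule.span ℂ (Set.range fun A => ((S.germ N P A).1, (S.germ N P A).2.1))) ≤
      49 := by
  refine finrank_span_le_of_affine_cover hreg.map_resQ ?_ ?_ ?_
  · rintro (i | k)
    · obtain ⟨w, hw, v, hv, h⟩ := Submodule.mem_sup.1 (hW i)
      refine ⟨w, hw, ?_⟩
      simp only [SGConfig.germ, Sum.elim_inl, ← h, map_add]
      rw [left_eq_add]
      ext x
      exact mem_vanSub.1 hv x x.2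
    · exact Submodule.zero_mem _
  · intro A B hAB n hA hB
    simp only [SGConfig.germ_eval] at hA hB ⊢
    exact S.form_cover hAB _ hA hB
  · intro A B hAB hv s hs
    rcases hP A B hAB with h | h
    · apply hv
      have h1 : ∀ n : N, (S.germ N P A).1 n + (S.germ N P A).2.1 n = 0 := fun n => by
        have e1 := S.germ_eval N P A n
        have e2 := S.germ_eval N P A 0
        rw [h n n.2] at e1
        simp only [map_zero, Submodule.coe_zero, add_zero, zero_add] at e2
        linear_combination e1 - e2
      have h2 : ∀ n : N, (S.germ N P A).1 n = 0 := fun n => by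
        have e1 := h1 n
        have e2 := h1 (-n)
        rw [QuadraticMap.map_neg, map_neg] at e2
        linear_combination (e1 + e2) / 2
      refine Prod.ext (QuadraticForm.ext_iff'.2 fun n => ?_) (LinearMap.ext fun n => ?_)
      · simpa using h2 n
      · have := h1 n
        rw [h2, zero_add] at this
        simpa using this
    · obtain ⟨y, hy, hne⟩ := h s
      apply hne
      have e1 := S.germ_eval N P A ⟨y, hy⟩
      have e2 := S.germ_eval N P B ⟨y, hy⟩
      rw [hs] at e2
      simp only [Prod.smul_fst, Prod.smul_snd, smul_apply, LinearMap.smul_apply,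
        smul_eq_mul] at e1 e2
      rw [← e1, ← e2]
      ring

theorem SGConfig.finrank_span_q_le {W : Submodule ℂ (QuadraticForm ℂ E)} {N : Submodule ℂ E}
    {d : ℕ} (hd : CodimLE N d) (hreg : RegPair W N 2) (hW : ∀ i, S.q i ∈ W ⊔ vanSub N)
    (l : Dual ℂ E) (hl : l ≠ 0) :
    finrank ℂ (Submodule.span ℂ (Set.range S.q)) ≤ (d + 1) * 49 + d ^ 2 := by
  classical
  obtain ⟨P₀, hP₀, -⟩ := S.exists_generic N hl
  obtain ⟨s, hs, hcard, hsup⟩ := exists_finset_sup_span_eq_top (G := {P | S.Generic N P})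
    (fun l hl => S.exists_generic N hl) hd
  have h := finrank_le_card_mul_add (germQ N) 49 (insert P₀ s) (Submodule.span ℂ (Set.range S.q))
    (fun P hP => by
      have hgen : S.Generic N P := by
        rcases Finset.mem_insert.1 hP with rfl | hP
        · exact hP₀
        · exact hs hP
      refine le_trans (Submodule.finrank_mono ?_) (S.finrank_germ_le hreg hW hgen)
      rw [Submodule.map_span, Submodule.span_le]
      rintro _ ⟨_, ⟨i, rfl⟩, rfl⟩
      exact Submodule.subset_span ⟨Sum.inl i, rfl⟩) (L := symSub N)
    (fun v _ hv => by
      have hvN : ∀ x ∈ N, v x = 0 := fun x hx => by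
        have := congrArg Prod.fst (hv P₀ (Finset.mem_insert_self _ _))
        exact DFunLike.congr_fun this (⟨x, hx⟩ : N)
      rw [mem_symSub]
      intro x hx
      refine LinearMap.mem_ker.2 ?_
      have hle : N ⊔ Submodule.span ℂ (s : Set E) ≤ LinearMap.ker (v.polarBilin x) := by
        refine sup_le (fun y hy => ?_) (Submodule.span_le.2 fun P hP => ?_)
        · have := hvN (x + y) (N.add_mem hx hy)
          rw [QuadraticForm.map_add', hvN x hx, hvN y hy] at this
          rw [LinearMap.mem_ker]
          linear_combination this
        · have := congrArg Prod.snd (hv P (Finset.mem_insert_of_mem hP))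
          have := DFunLike.congr_fun this (⟨x, hx⟩ : N)
          rw [SetLike.mem_coe, LinearMap.mem_ker, QuadraticForm.polarBilin_symm]
          exact this
      rw [hsup] at hle
      exact LinearMap.ext fun y => hle (Submodule.mem_top : y ∈ ⊤))
  have h1 := finrank_symSub_le hd
  have h2 : (insert P₀ s).card ≤ d + 1 := (Finset.card_insert_le _ _).trans (by omega)
  have h3 : (insert P₀ s).card * 49 ≤ (d + 1) * 49 := Nat.mul_le_mul_right _ h2
  omega

theorem SGConfig.finrank_span_f_le {W : Submodule ℂ (QuadraticForm ℂ E)} {N : Submodule ℂ E}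
    {d : ℕ} (hd : CodimLE N d) (hreg : RegPair W N 2) (hW : ∀ i, S.q i ∈ W ⊔ vanSub N)
    (l : Dual ℂ E) (hl : l ≠ 0) :
    finrank ℂ (Submodule.span ℂ (Set.range S.f)) ≤ 49 + d := by
  obtain ⟨P₀, hP₀, -⟩ := S.exists_generic N hl
  have h := finrank_le_map_add_inf_ker (LinearMap.lcomp ℂ ℂ N.subtype)
    (Submodule.span ℂ (Set.range S.f))
  have h1 : finrank ℂ ((Submodule.span ℂ (Set.range S.f)).map (LinearMap.lcomp ℂ ℂ N.subtype)) ≤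
      49 := by
    refine le_trans ?_ (S.finrank_germ_le hreg hW hP₀)
    refine le_trans (Submodule.finrank_mono (t := (Submodule.span ℂ (Set.range fun A =>
      ((S.germ N P₀ A).1, (S.germ N P₀ A).2.1))).map (LinearMap.snd ℂ _ _)) ?_)
      (Submodule.finrank_map_le _ _)
    rw [Submodule.map_span, Submodule.map_span, Submodule.span_le]
    rintro _ ⟨_, ⟨k, rfl⟩, rfl⟩
    exact Submodule.subset_span ⟨_, ⟨Sum.inr k, rfl⟩, rfl⟩
  have h2 : finrank ℂ (Submodule.span ℂ (Set.range S.f) ⊓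
      LinearMap.ker (LinearMap.lcomp ℂ ℂ N.subtype) : Submodule ℂ (Dual ℂ E)) ≤ d := by
    refine (Submodule.finrank_mono (t := N.dualAnnihilator) fun g hg => ?_).trans ?_
    · rw [Submodule.mem_dualAnnihilator]
      intro x hx
      exact LinearMap.congr_fun (LinearMap.mem_ker.1 hg.2) (⟨x, hx⟩ : N)
    · have := Subspace.finrank_add_finrank_dualAnnihilator_eq N
      unfold CodimLE at hd
      omega
  exact h.trans (add_le_add h1 h2)

end Bound

/-- The span of all forms of a configuration, the linear ones squared, has bounded dimension. -/
theorem SGConfig.exists_finrank_le : ∃ c : ℕ,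
    ∀ (E ι κ : Type) [AddCommGroup E] [Module ℂ E] [FiniteDimensional ℂ E] [Finite ι]
      [Finite κ] (S : SGConfig E ι κ),
      finrank ℂ (Submodule.span ℂ (Set.range S.q ∪ Set.range fun k => dualSq (S.f k))) ≤ c := by
  obtain ⟨C, hC⟩ := SGConfig.exists_mem_sup_vanSub
  obtain ⟨d, hd⟩ := exists_regPair 2 C C
  refine ⟨(d + 1) * 49 + d ^ 2 + (49 + d) ^ 2, fun E ι κ _ _ _ _ _ S => ?_⟩
  cases nonempty_fintype ι
  cases nonempty_fintype κ
  by_cases htriv : ∀ l : Dual ℂ E, l = 0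
  · have : ∀ q : QuadraticForm ℂ E, q = 0 := fun q => polarLin_injective (by
      ext x y
      exact LinearMap.congr_fun ((htriv _).trans (htriv _).symm) y)
    have hbot : Submodule.span ℂ (Set.range S.q ∪ Set.range fun k => dualSq (S.f k)) = ⊥ :=
      Submodule.eq_bot_iff _ |>.2 fun q _ => this q
    rw [hbot, finrank_bot]
    exact Nat.zero_le _
  push Not at htriv
  obtain ⟨l, hl⟩ := htriv
  obtain ⟨W₀, N₀, hW₀, hN₀, hq⟩ := hC E ι κ S
  obtain ⟨W, N, hN, hWW, -, hNd, hreg⟩ := hd E W₀ N₀ hW₀ hN₀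
  have hW : ∀ i, S.q i ∈ W ⊔ vanSub N := fun i =>
    (sup_le (hWW.trans (sup_symSub_le W N)) ((vanSub_mono hN).trans le_sup_right)) (hq i)
  have h1 := S.finrank_span_q_le hNd hreg hW l hl
  have h2 := S.finrank_span_f_le hNd hreg hW l hl
  have h3 : finrank ℂ (Submodule.span ℂ (Set.range fun k => dualSq (S.f k))) ≤ (49 + d) ^ 2 := by
    refine (Submodule.finrank_mono ?_).trans (finrank_symSub_le
      ((codimLE_dualCoannihilator (Submodule.span ℂ (Set.range S.f))).mono le_rfl h2))
    rw [Submodule.span_le]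
    rintro _ ⟨k, rfl⟩
    refine mem_symSub.2 fun x hx => ker_le_rad_dualSq _ (LinearMap.mem_ker.2 ?_)
    exact (Submodule.mem_dualCoannihilator _).1 hx _ (Submodule.subset_span ⟨k, rfl⟩)
  rw [Submodule.span_union]
  exact (Submodule.finrank_add_le_finrank_add_finrank _ _).trans (by omega)

section Translation

open MvPolynomial

variable {n : ℕ}

theorem MvPolynomial.IsHomogeneous.exists_dual {p : MvPolynomial (Fin n) ℂ}
    (hp : p.IsHomogeneous 1) : ∃ l : Dual ℂ (Fin n → ℂ), ∀ x, l x = eval x p := by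
  rw [← mem_homogeneousSubmodule, homogeneousSubmodule_one_eq_span_X] at hp
  induction hp using Submodule.span_induction with
  | mem p hp =>
    obtain ⟨i, rfl⟩ := hp
    exact ⟨LinearMap.proj i, fun x => by simp⟩
  | zero => exact ⟨0, fun x => by simp⟩
  | add p q _ _ hp hq =>
    obtain ⟨a, ha⟩ := hp
    obtain ⟨b, hb⟩ := hq
    exact ⟨a + b, fun x => by simp [ha, hb]⟩
  | smul c p _ hp =>
    obtain ⟨a, ha⟩ := hp
    exact ⟨c • a, fun x => by simp [ha]⟩

theorem MvPolynomial.IsHomogeneous.exists_quadraticForm {p : MvPolynomial (Fin n) ℂ}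
    (hp : p.IsHomogeneous 2) : ∃ q : QuadraticForm ℂ (Fin n → ℂ), ∀ x, q x = eval x p := by
  rw [← mem_homogeneousSubmodule, ← homogeneousSubmodule_one_pow, sq] at hp
  induction hp using Submodule.mul_induction_on' with
  | mem_mul_mem a ha b hb =>
    obtain ⟨l, hl⟩ := IsHomogeneous.exists_dual ha
    obtain ⟨r, hr⟩ := IsHomogeneous.exists_dual hb
    exact ⟨QuadraticMap.linMulLin l r, fun x => by simp [hl, hr]⟩
  | add p _ q _ hp hq =>
    obtain ⟨a, ha⟩ := hp
    obtain ⟨b, hb⟩ := hq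
    exact ⟨a + b, fun x => by simp [ha, hb]⟩

/-- The polynomial of a linear form. -/
noncomputable def dualPoly (l : Dual ℂ (Fin n → ℂ)) : MvPolynomial (Fin n) ℂ :=
  ∑ i, C (l (Pi.single i 1)) * X i

theorem eval_dualPoly (l : Dual ℂ (Fin n → ℂ)) (x : Fin n → ℂ) : eval x (dualPoly l) = l x := by
  simp only [dualPoly, map_sum, map_mul, eval_C, eval_X]
  conv_rhs => rw [LinearMap.pi_apply_eq_sum_univ l x]
  refine Finset.sum_congr rfl fun i _ => ?_
  rw [smul_eq_mul, mul_comm]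
  congr 2
  ext j
  simp [Pi.single_apply, eq_comm]

theorem not_isUnit_dualPoly (l : Dual ℂ (Fin n → ℂ)) : ¬ IsUnit (dualPoly l) := fun h => by
  have := h.map (eval (0 : Fin n → ℂ))
  rw [eval_dualPoly, map_zero] at this
  exact not_isUnit_zero this

theorem Irreducible.not_isProd {p : MvPolynomial (Fin n) ℂ} (hp : Irreducible p)
    {q : QuadraticForm ℂ (Fin n → ℂ)} (hq : ∀ x, q x = eval x p) : ¬ IsProd q := by
  rintro ⟨c, d, h⟩
  have : p = dualPoly c * dualPoly d := MvPolynomial.funext fun x => by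
    rw [← hq, h, map_mul, eval_dualPoly, eval_dualPoly]
  rcases hp.isUnit_or_isUnit this with h | h
  · exact not_isUnit_dualPoly c h
  · exact not_isUnit_dualPoly d h

theorem exists_eval_eq_zero_of_mem_radical {m : ℕ} {Q : Fin m → MvPolynomial (Fin n) ℂ}
    {i j : Fin m}
    (h : (∏ k ∈ (Finset.univ.erase i).erase j, Q k) ∈ (Ideal.span {Q i, Q j}).radical)
    {x : Fin n → ℂ} (hi : eval x (Q i) = 0) (hj : eval x (Q j) = 0) :
    ∃ k, (k ≠ i ∧ k ≠ j) ∧ eval x (Q k) = 0 := by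
  obtain ⟨N, hN⟩ := Ideal.mem_radical_iff.1 h
  obtain ⟨a, b, hab⟩ := Ideal.mem_span_pair.1 hN
  have h1 := congrArg (eval x) hab
  rw [map_add, map_mul, map_mul, hi, hj, mul_zero, mul_zero, add_zero, map_pow, map_prod] at h1
  obtain ⟨k, hk, hk0⟩ := Finset.prod_eq_zero_iff.1 (eq_zero_of_pow_eq_zero h1.symm)
  rw [Finset.mem_erase, Finset.mem_erase] at hk
  exact ⟨k, ⟨hk.2.1, hk.1⟩, hk0⟩

/-- The values of polynomials as a linear map into functions. -/
noncomputable def evalLin (n : ℕ) : MvPolynomial (Fin n) ℂ →ₗ[ℂ] ((Fin n → ℂ) → ℂ) where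
  toFun p x := eval x p
  map_add' p q := by ext x; simp
  map_smul' c p := by ext x; simp

/-- The values of quadratic forms as a linear map into functions. -/
def quadLin (n : ℕ) : QuadraticForm ℂ (Fin n → ℂ) →ₗ[ℂ] ((Fin n → ℂ) → ℂ) where
  toFun q x := q x
  map_add' p q := by ext x; simp
  map_smul' c p := by ext x; simp

theorem finrank_span_le_of_eval {α : Type*} {Q : α → MvPolynomial (Fin n) ℂ}
    {T : Set (QuadraticForm ℂ (Fin n → ℂ))} (h : ∀ i, ∃ q ∈ T, ∀ x, q x = eval x (Q i)) :
    finrank ℂ (Submodule.span ℂ (Set.range Q)) ≤ finrank ℂ (Submodule.span ℂ T) := by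
  have hinj : Function.Injective (evalLin n) := fun p q hpq =>
    MvPolynomial.funext fun x => congrFun hpq x
  rw [(Submodule.equivMapOfInjective _ hinj _).finrank_eq]
  refine le_trans (Submodule.finrank_mono ?_)
    (Submodule.finrank_map_le (quadLin n) (Submodule.span ℂ T))
  rw [Submodule.map_span, Submodule.span_le]
  rintro _ ⟨_, ⟨i, rfl⟩, rfl⟩
  obtain ⟨q, hq, hq'⟩ := h i
  exact ⟨q, Submodule.subset_span hq, funext hq'⟩

theorem LinearIndependent.pair_of_ne_smul {X : Type*} [AddCommGroup X] [Module ℂ X] {x y : X}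
    (h1 : ∀ c : ℂ, x ≠ c • y) (h2 : ∀ c : ℂ, y ≠ c • x) : LinearIndependent ℂ ![x, y] := by
  rw [LinearIndependent.pair_iff]
  intro s t h
  constructor
  · by_contra hs
    refine h1 (-(s⁻¹ * t)) ?_
    rw [neg_smul, mul_smul, eq_neg_of_add_eq_zero_right h, smul_neg, neg_neg, inv_smul_smul₀ hs]
  · by_contra ht
    refine h2 (-(t⁻¹ * s)) ?_
    rw [neg_smul, mul_smul, eq_neg_of_add_eq_zero_left h, smul_neg, neg_neg, inv_smul_smul₀ ht]

theorem exists_sgConfig {m : ℕ} (hm : 2 ≤ m) {Q : Fin m → MvPolynomial (Fin n) ℂ}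
    (hhom : ∀ i, (Q i).IsHomogeneous 2)
    (htype : ∀ i, Irreducible (Q i) ∨ ∃ l : MvPolynomial (Fin n) ℂ, l.IsHomogeneous 1 ∧ Q i = l ^ 2)
    (hind : ∀ i j, i ≠ j → LinearIndependent ℂ ![Q i, Q j])
    (hrad : ∀ i j, i ≠ j →
      (∏ k ∈ (Finset.univ.erase i).erase j, Q k) ∈ (Ideal.span {Q i, Q j}).radical) :
    ∃ S : SGConfig (Fin n → ℂ) {i // Irreducible (Q i)} {i // ¬ Irreducible (Q i)},
      (∀ i x, S.q i x = eval x (Q i)) ∧ ∀ k x, S.f k x ^ 2 = eval x (Q k) := by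
  have hq : ∀ i : {i // Irreducible (Q i)}, ∃ q : QuadraticForm ℂ (Fin n → ℂ),
      ∀ x, q x = eval x (Q i) := fun i => (hhom i).exists_quadraticForm
  have hf : ∀ k : {i // ¬ Irreducible (Q i)}, ∃ f : Dual ℂ (Fin n → ℂ),
      ∀ x, f x ^ 2 = eval x (Q k) := fun k => by
    obtain ⟨l, hl, h⟩ := (htype k).resolve_left k.2
    obtain ⟨f, hf⟩ := hl.exists_dual
    exact ⟨f, fun x => by rw [hf, h, map_pow]⟩
  choose q hq using hq
  choose f hf using hf
  have hcov : ∀ i j, i ≠ j → ∀ x, eval x (Q i) = 0 → eval x (Q j) = 0 →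
      (∃ k : {i // Irreducible (Q i)}, ((k : Fin m) ≠ i ∧ (k : Fin m) ≠ j) ∧ q k x = 0) ∨
      ∃ k : {i // ¬ Irreducible (Q i)}, ((k : Fin m) ≠ i ∧ (k : Fin m) ≠ j) ∧ f k x = 0 := by
    intro i j hij x hi hj
    obtain ⟨k, hk, hk0⟩ := exists_eval_eq_zero_of_mem_radical (hrad i j hij) hi hj
    by_cases hirr : Irreducible (Q k)
    · exact Or.inl ⟨⟨k, hirr⟩, hk, by rw [hq, hk0]⟩
    · exact Or.inr ⟨⟨k, hirr⟩, hk, eq_zero_of_pow_eq_zero ((hf ⟨k, hirr⟩ x).trans hk0)⟩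
  have hqi : ∀ i j, i ≠ j → ∀ c : ℂ, q i ≠ c • q j := fun i j hij c h =>
    (hind i j fun h => hij (Subtype.ext h)).ne_smul c (MvPolynomial.funext fun x => by
      rw [← hq, h, smul_apply, hq, smul_eval, smul_eq_mul])
  have hfi : ∀ i j, i ≠ j → ∀ c : ℂ, f i ≠ c • f j := fun i j hij c h =>
    (hind i j fun h => hij (Subtype.ext h)).ne_smul (c ^ 2) (MvPolynomial.funext fun x => by
      rw [← hf, h, LinearMap.smul_apply, smul_eval, smul_eq_mul, mul_pow, hf])
  refine ⟨⟨q, f, fun i => i.2.not_isProd (hq i),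
    fun i j hij => LinearIndependent.pair_of_ne_smul (hqi i j hij) (hqi j i hij.symm), ?_,
    fun i j hij => LinearIndependent.pair_of_ne_smul (hfi i j hij) (hfi j i hij.symm),
    ?_, ?_, ?_⟩, hq, hf⟩
  · intro k hk
    have : Nontrivial (Fin m) := Fin.nontrivial_iff_two_le.2 hm
    obtain ⟨j, hj⟩ := exists_ne (k : Fin m)
    refine (hind k j hj.symm).ne_smul 0 (MvPolynomial.funext fun x => ?_)
    rw [← hf, hk]
    simp
  · intro i j hij x hi hj
    rcases hcov i j (fun h => hij (Subtype.ext h)) x ((hq i x).symm.trans hi)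
      ((hq j x).symm.trans hj) with ⟨k, hk, h⟩ | ⟨k, -, h⟩
    · exact Or.inl ⟨k, ⟨fun e => hk.1 (by rw [e]), fun e => hk.2 (by rw [e])⟩, h⟩
    · exact Or.inr ⟨k, h⟩
  · intro i j x hi hj
    rcases hcov i j (fun h => j.2 (h ▸ i.2)) x ((hq i x).symm.trans hi)
      ((hf j x).symm.trans (by rw [hj]; simp)) with ⟨k, hk, h⟩ | ⟨k, hk, h⟩
    · exact Or.inl ⟨k, fun e => hk.1 (by rw [e]), h⟩
    · exact Or.inr ⟨k, fun e => hk.2 (by rw [e]), h⟩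
  · intro i j hij x hi hj
    rcases hcov i j (fun h => hij (Subtype.ext h)) x ((hf i x).symm.trans (by rw [hi]; simp))
      ((hf j x).symm.trans (by rw [hj]; simp)) with ⟨k, -, h⟩ | ⟨k, hk, h⟩
    · exact Or.inl ⟨k, h⟩
    · exact Or.inr ⟨k, ⟨fun e => hk.1 (by rw [e]), fun e => hk.2 (by rw [e])⟩, h⟩

end Translation

open MvPolynomial

/-- There is a universal constant `c` such that any finite family of
pairwise linearly independent homogeneous quadratics in `ℂ[x₁,…,xₙ]`, each irreducible or the
square of a linear form, satisfying that for every `i ≠ j` the product of the remaining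
polynomials lies in `√⟨Q i, Q j⟩`, spans a space of dimension at most `c`. -/
theorem statement0 :
    ∃ c : ℕ, ∀ (n m : ℕ) (Q : Fin m → MvPolynomial (Fin n) ℂ),
      (∀ i, (Q i).IsHomogeneous 2) →
      (∀ i, Irreducible (Q i) ∨
        ∃ l : MvPolynomial (Fin n) ℂ, l.IsHomogeneous 1 ∧ Q i = l ^ 2) →
      (∀ i j, i ≠ j → LinearIndependent ℂ ![Q i, Q j]) →
      (∀ i j, i ≠ j →
        (∏ k ∈ (Finset.univ.erase i).erase j, Q k) ∈ (Ideal.span {Q i, Q j}).radical) →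
      Module.finrank ℂ (Submodule.span ℂ (Set.range Q)) ≤ c := by
  obtain ⟨c, hc⟩ := SGConfig.exists_finrank_le
  refine ⟨c + 1, fun n m Q hhom htype hind hrad => ?_⟩
  by_cases hm : 2 ≤ m
  · obtain ⟨S, hq, hf⟩ := exists_sgConfig hm hhom htype hind hrad
    refine (finrank_span_le_of_eval fun i => ?_).trans ((hc _ _ _ S).trans (Nat.le_succ c))
    by_cases hi : Irreducible (Q i)
    · exact ⟨_, Or.inl ⟨⟨i, hi⟩, rfl⟩, hq ⟨i, hi⟩⟩
    · exact ⟨_, Or.inr ⟨⟨i, hi⟩, rfl⟩, fun x => by rw [dualSq_apply, hf]⟩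
  · refine (finrank_range_le_card Q).trans ?_
    rw [Fintype.card_fin]
    omega
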